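/- Let q be a power of an odd prime, F_q a finite field with q elements, m ≥ 0, and let J ∈ M_{2m+1}(F_q) be an invertible symmetric matrix. Let G = SO(J) = {g ∈ GL(2m+1, F_q) : gᵀ J g = J and det g = 1} and let R be a complete set of irreducible complex representations of G. Then Σ_{ρ ∈ R} dim ρ = Σ_{k=0}^{m} q^{2k(m−k+1)} · binom(m,k)_{q²} (as real numbers). -/

import Mathlib

open Matrix CategoryTheory
open scoped Classical

noncomputable section

/-- The Frobenius–Schur indicator of a complex-valued function on a finite group. -/
def fsIndicator (G : Type*) [Group G] [Fintype G] (χ : G → ℂ) : ℂ :=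
  (Fintype.card G : ℂ)⁻¹ * ∑ g : G, χ (g * g)

/-- The twisted Frobenius–Schur indicator of a complex-valued function on a finite group,
with respect to a map `σ`. -/
def twistedFSIndicator (G : Type*) [Group G] [Fintype G] (σ : G → G) (χ : G → ℂ) : ℂ :=
  (Fintype.card G : ℂ)⁻¹ * ∑ g : G, χ (g * σ g)

/-- A complex-valued function is real-valued if all its values are real. -/
def IsRealValued {G : Type*} (χ : G → ℂ) : Prop := ∀ g : G, ∃ r : ℝ, χ g = (r : ℂ)

/-- The Gaussian binomial coefficient `binom(m,k)_q` as a real number. -/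
def gbinom (m k : ℕ) (q : ℝ) : ℝ := ∏ i ∈ Finset.Icc 1 k, (q ^ (m - k + i) - 1) / (q ^ i - 1)

section Groups

variable {N F : Type*} [Fintype N] [DecidableEq N] [Field F]

theorem sim_one (J : Matrix N N F) :
    ((1 : GL N F) : Matrix N N F)ᵀ * J * ((1 : GL N F) : Matrix N N F) = ((1 : Fˣ) : F) • J := by
  simp

theorem sim_mul {J : Matrix N N F} (a b : GL N F) (c d : Fˣ)
    (hc : (a : Matrix N N F)ᵀ * J * (a : Matrix N N F) = (c : F) • J)
    (hd : (b : Matrix N N F)ᵀ * J * (b : Matrix N N F) = (d : F) • J) :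
    ((a * b : GL N F) : Matrix N N F)ᵀ * J * ((a * b : GL N F) : Matrix N N F)
      = ((c * d : Fˣ) : F) • J := by
  calc ((a * b : GL N F) : Matrix N N F)ᵀ * J * ((a * b : GL N F) : Matrix N N F)
      = (b : Matrix N N F)ᵀ * ((a : Matrix N N F)ᵀ * J * (a : Matrix N N F)) *
          (b : Matrix N N F) := by
        rw [show ((a * b : GL N F) : Matrix N N F) = (a : Matrix N N F) * b from rfl,
          transpose_mul]
        simp only [Matrix.mul_assoc]
    _ = (b : Matrix N N F)ᵀ * ((c : F) • J) * (b : Matrix N N F) := by rw [hc]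
    _ = (c : F) • ((b : Matrix N N F)ᵀ * J * (b : Matrix N N F)) := by
        rw [Matrix.mul_smul, Matrix.smul_mul]
    _ = (c : F) • ((d : F) • J) := by rw [hd]
    _ = ((c * d : Fˣ) : F) • J := by rw [smul_smul, Units.val_mul]

theorem sim_inv {J : Matrix N N F} (a : GL N F) (c : Fˣ)
    (hc : (a : Matrix N N F)ᵀ * J * (a : Matrix N N F) = (c : F) • J) :
    ((a⁻¹ : GL N F) : Matrix N N F)ᵀ * J * ((a⁻¹ : GL N F) : Matrix N N F)
      = ((c⁻¹ : Fˣ) : F) • J := by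
  have ht : ((a⁻¹ : GL N F) : Matrix N N F)ᵀ * (a : Matrix N N F)ᵀ = 1 := by
    rw [← transpose_mul, a.mul_inv, transpose_one]
  have key : ((a⁻¹ : GL N F) : Matrix N N F)ᵀ * ((a : Matrix N N F)ᵀ * J * (a : Matrix N N F)) *
      ((a⁻¹ : GL N F) : Matrix N N F) = J := by
    calc ((a⁻¹ : GL N F) : Matrix N N F)ᵀ * ((a : Matrix N N F)ᵀ * J * (a : Matrix N N F)) *
        ((a⁻¹ : GL N F) : Matrix N N F)
        = (((a⁻¹ : GL N F) : Matrix N N F)ᵀ * (a : Matrix N N F)ᵀ) * J *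
          ((a : Matrix N N F) * ((a⁻¹ : GL N F) : Matrix N N F)) := by
          simp only [Matrix.mul_assoc]
      _ = J := by rw [ht, a.mul_inv, Matrix.one_mul, Matrix.mul_one]
  have key2 : ((a⁻¹ : GL N F) : Matrix N N F)ᵀ * ((c : F) • J) * ((a⁻¹ : GL N F) : Matrix N N F)
      = (c : F) • (((a⁻¹ : GL N F) : Matrix N N F)ᵀ * J * ((a⁻¹ : GL N F) : Matrix N N F)) := by
    rw [Matrix.mul_smul, Matrix.smul_mul]
  have h3 : (c : F) • (((a⁻¹ : GL N F) : Matrix N N F)ᵀ * J *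
      ((a⁻¹ : GL N F) : Matrix N N F)) = J := by rw [← key2, ← hc, key]
  calc ((a⁻¹ : GL N F) : Matrix N N F)ᵀ * J * ((a⁻¹ : GL N F) : Matrix N N F)
      = ((c⁻¹ : Fˣ) : F) • ((c : F) • (((a⁻¹ : GL N F) : Matrix N N F)ᵀ * J *
          ((a⁻¹ : GL N F) : Matrix N N F))) := by
        rw [smul_smul, ← Units.val_mul, inv_mul_cancel, Units.val_one, one_smul]
    _ = ((c⁻¹ : Fˣ) : F) • J := by rw [h3]

/-- The similitude group of the bilinear form given by the matrix `J`:  all invertible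
matrices `g` with `gᵀ * J * g = c • J` for some nonzero scalar `c` (the similitude of `g`). -/
def similitudeGroup (J : Matrix N N F) : Subgroup (GL N F) where
  carrier := {g | ∃ c : Fˣ, (g : Matrix N N F)ᵀ * J * (g : Matrix N N F) = (c : F) • J}
  one_mem' := ⟨1, sim_one J⟩
  mul_mem' := by rintro a b ⟨c, hc⟩ ⟨d, hd⟩; exact ⟨c * d, sim_mul a b c d hc hd⟩
  inv_mem' := by rintro a ⟨c, hc⟩; exact ⟨c⁻¹, sim_inv a c hc⟩

/-- The isometry group of the bilinear form given by the matrix `J`:  all invertible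
matrices `g` with `gᵀ * J * g = J`. -/
def fixGroup (J : Matrix N N F) : Subgroup (GL N F) where
  carrier := {g | (g : Matrix N N F)ᵀ * J * (g : Matrix N N F) = J}
  one_mem' := by simp
  mul_mem' := by
    intro a b ha hb
    have := sim_mul (J := J) a b 1 1 (by simpa using ha) (by simpa using hb)
    simpa using this
  inv_mem' := by
    intro a ha
    have := sim_inv (J := J) a 1 (by simpa using ha)
    simpa using this

/-- The group of isometries of determinant one of the bilinear form given by the matrix `J`. -/
def specialFixGroup (J : Matrix N N F) : Subgroup (GL N F) where
  carrier := {g | (g : Matrix N N F)ᵀ * J * (g : Matrix N N F) = J ∧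
    ((g : Matrix N N F)).det = 1}
  one_mem' := ⟨by simp, by simp⟩
  mul_mem' := by
    rintro a b ⟨ha1, ha2⟩ ⟨hb1, hb2⟩
    refine ⟨(fixGroup J).mul_mem ha1 hb1, ?_⟩
    rw [show ((a * b : GL N F) : Matrix N N F) = (a : Matrix N N F) * b from rfl,
      Matrix.det_mul, ha2, hb2, one_mul]
  inv_mem' := by
    rintro a ⟨ha1, ha2⟩
    refine ⟨(fixGroup J).inv_mem ha1, ?_⟩
    have h := congrArg Matrix.det a.mul_inv
    rw [Matrix.det_mul, ha2, one_mul, Matrix.det_one] at h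
    exact h

/-- The connected component of the similitude group of the symmetric bilinear form on a
`2 * m`-dimensional space given by the matrix `J`:  all similitudes `g`, with similitude
character `μ`, such that `det g = μ(g) ^ m`. -/
def connSimilitudeGroup (J : Matrix N N F) (m : ℕ) : Subgroup (GL N F) where
  carrier := {g | ∃ c : Fˣ, (g : Matrix N N F)ᵀ * J * (g : Matrix N N F) = (c : F) • J ∧
    ((g : Matrix N N F)).det = (c : F) ^ m}
  one_mem' := ⟨1, sim_one J, by simp⟩
  mul_mem' := by
    rintro a b ⟨c, hc1, hc2⟩ ⟨d, hd1, hd2⟩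
    refine ⟨c * d, sim_mul a b c d hc1 hd1, ?_⟩
    rw [show ((a * b : GL N F) : Matrix N N F) = (a : Matrix N N F) * b from rfl,
      Matrix.det_mul, hc2, hd2, Units.val_mul, mul_pow]
  inv_mem' := by
    rintro a ⟨c, hc1, hc2⟩
    refine ⟨c⁻¹, sim_inv a c hc1, ?_⟩
    have h := congrArg Matrix.det a.mul_inv
    rw [Matrix.det_mul, hc2, Matrix.det_one] at h
    have hc : ((c : F) ^ m)⁻¹ = ((c⁻¹ : Fˣ) : F) ^ m := by
      rw [← inv_pow]
      norm_cast
    rw [← hc]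
    exact (inv_eq_of_mul_eq_one_right h).symm

theorem neg_one_mem_similitudeGroup (J : Matrix N N F) : (-1 : GL N F) ∈ similitudeGroup J := by
  refine ⟨1, ?_⟩
  have h : ((-1 : GL N F) : Matrix N N F) = -1 := by simp
  rw [h]
  simp

/-- The standard symplectic form matrix `[[0, I], [-I, 0]]`. -/
def Jsp (n : ℕ) (F : Type*) [Field F] : Matrix (Fin n ⊕ Fin n) (Fin n ⊕ Fin n) F :=
  Matrix.fromBlocks 0 1 (-1) 0

/-- The standard split symmetric form matrix `[[0, I], [I, 0]]`. -/
def Jsplit (n : ℕ) (F : Type*) [Field F] : Matrix (Fin n ⊕ Fin n) (Fin n ⊕ Fin n) F :=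
  Matrix.fromBlocks 0 1 1 0

/-- A symmetric matrix `J` of size `2n` is split if it is congruent to `[[0, I], [I, 0]]`. -/
def IsSplit {n : ℕ} (J : Matrix (Fin n ⊕ Fin n) (Fin n ⊕ Fin n) F) : Prop :=
  ∃ P : GL (Fin n ⊕ Fin n) F,
    (P : Matrix (Fin n ⊕ Fin n) (Fin n ⊕ Fin n) F)ᵀ * J * P = Jsplit n F

/-- The symplectic similitude group `GSp(2n, F)`. -/
def GSp (n : ℕ) (F : Type*) [Field F] : Subgroup (GL (Fin n ⊕ Fin n) F) :=
  similitudeGroup (Jsp n F)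

/-- The symplectic group `Sp(2n, F)`. -/
def Sp (n : ℕ) (F : Type*) [Field F] : Subgroup (GL (Fin n ⊕ Fin n) F) :=
  fixGroup (Jsp n F)


/-- The underlying matrix of an element of a matrix subgroup. -/
def matOf {S : Subgroup (GL N F)} (g : ↥S) : Matrix N N F := ((g : GL N F) : Matrix N N F)

end Groups

noncomputable instance subgroupFintype {G : Type*} [Group G] [Finite G] (S : Subgroup G) :
    Fintype S := Fintype.ofFinite _

namespace OrthModel

section Reps

variable {G : Type*} [Group G] {M : Type*} [AddCommGroup M] [Module ℂ M]

/-- A submodule is stable under a representation. -/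
def Stable (ρ : Representation ℂ G M) (p : Submodule ℂ M) : Prop :=
  ∀ g, ∀ x ∈ p, ρ g x ∈ p

/-- Irreducibility, stated through stable submodules. -/
def Irr (ρ : Representation ℂ G M) : Prop :=
  (∃ x : M, x ≠ 0) ∧ ∀ p : Submodule ℂ M, Stable ρ p → p = ⊥ ∨ p = ⊤

/-- The restriction of a representation to a stable submodule. -/
def subRep (ρ : Representation ℂ G M) (p : Submodule ℂ M) (h : Stable ρ p) :
    Representation ℂ G p where
  toFun g := (ρ g).restrict (h g)
  map_one' := by ext; simp [LinearMap.restrict_apply]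
  map_mul' a b := by ext; simp [LinearMap.restrict_apply]

@[simp] lemma subRep_apply (ρ : Representation ℂ G M) (p : Submodule ℂ M) (h : Stable ρ p) (g : G)
    (x : p) : ((subRep ρ p h g x : p) : M) = ρ g x := rfl

/-- Invariance of a bilinear form under a representation. -/
def Invar (ρ : Representation ℂ G M) (B : M →ₗ[ℂ] M →ₗ[ℂ] ℂ) : Prop :=
  ∀ g x y, B (ρ g x) (ρ g y) = B x y

lemma Invar.right_inv {ρ : Representation ℂ G M} {B : M →ₗ[ℂ] M →ₗ[ℂ] ℂ} (h : Invar ρ B)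
    (g : G) (x y : M) : B x (ρ g y) = B (ρ g⁻¹ x) y := by
  rw [← h g (ρ g⁻¹ x) y]; simp

lemma Invar.left_inv {ρ : Representation ℂ G M} {B : M →ₗ[ℂ] M →ₗ[ℂ] ℂ} (h : Invar ρ B)
    (g : G) (x y : M) : B (ρ g x) y = B x (ρ g⁻¹ y) := by
  rw [← h g x (ρ g⁻¹ y)]; simp

lemma exists_stable_compl [Finite G] (ρ : Representation ℂ G M) (p : Submodule ℂ M)
    (h : Stable ρ p) : ∃ p', Stable ρ p' ∧ IsCompl p p' := by
  obtain ⟨⟨q, hq⟩, hc⟩ := exists_isCompl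
    (⟨p, fun g x hx => h g x hx⟩ : Subrepresentation ρ)
  refine ⟨q, fun g x hx => hq g hx, ?_⟩
  have h1 := congrArg Subrepresentation.toSubmodule hc.inf_eq_bot
  have h2 := congrArg Subrepresentation.toSubmodule hc.sup_eq_top
  exact ⟨disjoint_iff.2 h1, codisjoint_iff.2 h2⟩

lemma char_add_of_isCompl [FiniteDimensional ℂ M] (ρ : Representation ℂ G M) {p q : Submodule ℂ M}
    (hp : Stable ρ p) (hq : Stable ρ q) (h : IsCompl p q) (g : G) :
    ρ.character g = (subRep ρ p hp).character g + (subRep ρ q hq).character g := by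
  unfold Representation.character
  rw [← LinearMap.trace_prodMap', ← LinearMap.trace_conj' _ (Submodule.prodEquivOfIsCompl p q h)]
  congr 1
  refine LinearMap.ext fun x => ?_
  obtain ⟨y, rfl⟩ := (Submodule.prodEquivOfIsCompl p q h).surjective x
  simp [LinearEquiv.conj_apply]

lemma char_eq_of_equiv {N : Type*} [AddCommGroup N] [Module ℂ N] (ρ : Representation ℂ G M)
    (σ : Representation ℂ G N) (e : M ≃ₗ[ℂ] N) (he : ∀ g x, e (ρ g x) = σ g (e x)) (g : G) :
    ρ.character g = σ.character g := by
  unfold Representation.character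
  rw [← LinearMap.trace_conj' _ e]
  congr 1
  refine LinearMap.ext fun x => ?_
  simp [LinearEquiv.conj_apply, he]

lemma Stable.subRep_map {ρ : Representation ℂ G M} {p : Submodule ℂ M} {h : Stable ρ p}
    {s : Submodule ℂ p} (hs : Stable (subRep ρ p h) s) : Stable ρ (s.map p.subtype) := by
  rintro g _ ⟨x, hx, rfl⟩
  exact ⟨_, hs g x hx, rfl⟩

lemma exists_irr_le [FiniteDimensional ℂ M] (ρ : Representation ℂ G M) (p : Submodule ℂ M)
    (h : Stable ρ p) (hp : p ≠ ⊥) : ∃ s, ∃ hs : Stable ρ s, s ≤ p ∧ Irr (subRep ρ s hs) := by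
  let P : ℕ → Prop := fun n => ∃ s : Submodule ℂ M,
    Stable ρ s ∧ s ≤ p ∧ s ≠ ⊥ ∧ Module.finrank ℂ s = n
  have hP : ∃ n, P n := ⟨_, p, h, le_rfl, hp, rfl⟩
  obtain ⟨s, hs, hsp, hs0, hn⟩ := Nat.find_spec hP
  refine ⟨s, hs, hsp, ?_, fun r hr => ?_⟩
  · obtain ⟨x, hx, hx0⟩ := (Submodule.ne_bot_iff _).1 hs0
    exact ⟨⟨x, hx⟩, by simpa using hx0⟩
  · by_cases hr0 : r = ⊥
    · exact Or.inl hr0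
    refine Or.inr ?_
    have h1 : P (Module.finrank ℂ (r.map s.subtype)) := by
      refine ⟨_, Stable.subRep_map hr, (Submodule.map_subtype_le _ _).trans hsp, ?_, rfl⟩
      intro h0
      exact hr0 (Submodule.map_injective_of_injective s.subtype_injective (by rw [h0, Submodule.map_bot]))
    have h2 := Nat.find_min' hP h1
    rw [← hn, LinearEquiv.finrank_eq (Submodule.equivMapOfInjective _ s.subtype_injective r).symm]
      at h2
    exact Submodule.eq_top_of_finrank_eq (le_antisymm (Submodule.finrank_le r) h2)

lemma exists_isMax_le {P : Submodule ℂ M → Prop} [FiniteDimensional ℂ M] (h : P ⊥) :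
    ∃ L, P L ∧ ∀ L', P L' → L ≤ L' → L' = L := by
  obtain ⟨L, h1, h2⟩ := exists_maximal_of_wellFoundedGT P ⟨⊥, h⟩
  exact ⟨L, h1, fun L' h3 h4 => le_antisymm (h2 h3 h4) h4⟩

/-- Induction principle: a property of representations additive over complements holds as soon as
it holds for irreducible ones. -/
lemma char_induction {H : Type*} [Group H] [Finite H] (P : (H → ℂ) → Prop) (h0 : P 0)
    (hadd : ∀ a b, P a → P b → P (a + b))
    (hirr : ∀ (N : Type) [AddCommGroup N] [Module ℂ N] [FiniteDimensional ℂ N]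
      (σ : Representation ℂ H N), Irr σ → P σ.character) :
    ∀ (N : Type) [AddCommGroup N] [Module ℂ N] [FiniteDimensional ℂ N]
      (σ : Representation ℂ H N), P σ.character := by
  suffices ∀ n, ∀ (N : Type) [AddCommGroup N] [Module ℂ N] [FiniteDimensional ℂ N]
      (σ : Representation ℂ H N), Module.finrank ℂ N = n → P σ.character from
    fun N _ _ _ σ => this _ N σ rfl
  intro n
  induction n using Nat.strong_induction_on with
  | _ n ih =>
    intro N _ _ _ σ hn
    by_cases hN : ∃ x : N, x ≠ 0
    · by_cases hi : Irr σ
      · exact hirr N σ hi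
      · have : ∃ p, Stable σ p ∧ p ≠ ⊥ ∧ p ≠ ⊤ := by
          by_contra hcon
          push Not at hcon
          exact hi ⟨hN, fun p hp => or_iff_not_imp_left.2 (hcon p hp)⟩
        obtain ⟨p, hp, hb, ht⟩ := this
        obtain ⟨r, hr, hc⟩ := exists_stable_compl σ p hp
        have hpr := Submodule.finrank_add_eq_of_isCompl hc
        have h1 : 0 < Module.finrank ℂ p := by
          rw [Module.finrank_pos_iff]; exact Submodule.nontrivial_iff_ne_bot.2 hb
        have h2 : Module.finrank ℂ p < Module.finrank ℂ N := Submodule.finrank_lt ht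
        have : σ.character = (subRep σ p hp).character + (subRep σ r hr).character :=
          funext fun g => char_add_of_isCompl σ hp hr hc g
        rw [this]
        exact hadd _ _ (ih _ (by omega) _ _ rfl) (ih _ (by omega) _ _ rfl)
    · push Not at hN
      have : σ.character = 0 := by
        funext g
        have : σ g = 0 := LinearMap.ext fun x => by simp [hN x]
        simp [Representation.character, this]
      rw [this]; exact h0

end Reps

/-- Every irreducible complex representation of `G` carries no nonzero invariant alternating
form. -/
def Good (G : Type*) [Group G] : Prop :=
  ∀ (M : Type) [AddCommGroup M] [Module ℂ M] [FiniteDimensional ℂ M] (ρ : Representation ℂ G M),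
    Irr ρ → ∀ B : M →ₗ[ℂ] M →ₗ[ℂ] ℂ, Invar ρ B → (∀ x, B x x = 0) → B = 0

lemma Irr.comp {G H : Type*} [Group G] [Group H] {M : Type*} [AddCommGroup M] [Module ℂ M]
    {ρ : Representation ℂ H M} (h : Irr ρ) {f : G →* H} (hf : Function.Surjective f) :
    Irr (ρ.comp f) := by
  refine ⟨h.1, fun p hp => h.2 p fun g x hx => ?_⟩
  obtain ⟨g, rfl⟩ := hf g
  exact hp g x hx

lemma Good.of_surjective {G H : Type*} [Group G] [Group H] (h : Good G) (f : G →* H)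
    (hf : Function.Surjective f) : Good H :=
  fun M _ _ _ ρ hρ B hB hB' => h M (ρ.comp f) (hρ.comp hf) B (fun g => hB (f g)) hB'

section ComplexRep

variable {G : Type*} [Group G] {M : Type} [AddCommGroup M] [Module ℂ M]

lemma skew_of_alt {B : M →ₗ[ℂ] M →ₗ[ℂ] ℂ} (h : ∀ x, B x x = 0) (x y : M) : B x y = - B y x := by
  have := h (x + y)
  simp only [map_add, LinearMap.add_apply, h, zero_add, add_zero] at this
  exact eq_neg_of_add_eq_zero_right this

lemma Good.char_split [Finite G] [FiniteDimensional ℂ M] (hG : Good G) (ρ : Representation ℂ G M)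
    (B : M →ₗ[ℂ] M →ₗ[ℂ] ℂ) (hB : Invar ρ B) (halt : ∀ x, B x x = 0)
    (hnd : ∀ x, (∀ y, B x y = 0) → x = 0) :
    ∃ (N : Type) (_ : AddCommGroup N) (_ : Module ℂ N) (_ : FiniteDimensional ℂ N)
      (φ : Representation ℂ G N), ∀ g, ρ.character g = φ.character g + φ.character g⁻¹ := by
  obtain ⟨L, ⟨hL, hiso⟩, hmax⟩ := exists_isMax_le
    (P := fun L : Submodule ℂ M => Stable ρ L ∧ ∀ x ∈ L, ∀ y ∈ L, B x y = 0)
    ⟨fun g x hx => by rw [(Submodule.mem_bot ℂ).1 hx, map_zero]; exact zero_mem _,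
      fun x hx y _ => by rw [(Submodule.mem_bot ℂ).1 hx, map_zero, LinearMap.zero_apply]⟩
  obtain ⟨Q, hQ, hc⟩ := exists_stable_compl ρ L hL
  have hperp : ∀ x, (∀ y ∈ L, B x y = 0) → x ∈ L := by
    by_contra hcon
    push Not at hcon
    obtain ⟨x, hx, hxL⟩ := hcon
    let R : Submodule ℂ M :=
      { carrier := {z | z ∈ Q ∧ ∀ y ∈ L, B z y = 0}
        add_mem' := fun {a b} ha hb => ⟨add_mem ha.1 hb.1, fun y hy => by
          simp [ha.2 y hy, hb.2 y hy]⟩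
        zero_mem' := ⟨zero_mem _, by simp⟩
        smul_mem' := fun c a ha => ⟨Q.smul_mem c ha.1, fun y hy => by simp [ha.2 y hy]⟩ }
    have hR : Stable ρ R := fun g z hz => ⟨hQ g z hz.1, fun y hy => by
      rw [hB.left_inv]; exact hz.2 _ (hL _ _ hy)⟩
    have hR0 : R ≠ ⊥ := by
      have : x ∈ L ⊔ Q := by rw [hc.sup_eq_top]; trivial
      obtain ⟨l, hl, z, hz, rfl⟩ := Submodule.mem_sup.1 this
      refine (Submodule.ne_bot_iff _).2 ⟨z, ⟨hz, fun y hy => ?_⟩, ?_⟩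
      · have := hx y hy
        simpa [hiso l hl y hy] using this
      · rintro rfl; exact hxL (by simpa using hl)
    obtain ⟨S, hS, hSR, hirr⟩ := exists_irr_le ρ R hR hR0
    have hBS : B.compl₁₂ S.subtype S.subtype = 0 :=
      hG S (subRep ρ S hS) hirr _ (fun g x y => by simp [hB g]) (fun x => by simp [halt])
    have hBS' : ∀ x ∈ S, ∀ y ∈ S, B x y = 0 := fun x hx y hy => by
      simpa using LinearMap.congr_fun₂ hBS ⟨x, hx⟩ ⟨y, hy⟩
    have hSL : L ⊔ S = L := by
      refine hmax _ ⟨?_, ?_⟩ le_sup_left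
      · intro g x hx
        obtain ⟨l, hl, z, hz, rfl⟩ := Submodule.mem_sup.1 hx
        rw [map_add]
        exact add_mem (Submodule.mem_sup_left (hL _ _ hl)) (Submodule.mem_sup_right (hS _ _ hz))
      · intro x hx y hy
        obtain ⟨l, hl, z, hz, rfl⟩ := Submodule.mem_sup.1 hx
        obtain ⟨l', hl', z', hz', rfl⟩ := Submodule.mem_sup.1 hy
        have e := (hSR hz).2 l' hl'
        have e' := (hSR hz').2 l hl
        rw [skew_of_alt halt] at e'
        simp only [map_add, LinearMap.add_apply, hiso l hl l' hl', hBS' z hz z' hz', e, neg_eq_zero.1 e',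
          add_zero]
    obtain ⟨⟨x, hx⟩, hx0⟩ := hirr.1
    apply hx0
    have h1 : x ∈ L := by rw [← hSL]; exact Submodule.mem_sup_right hx
    have h2 := hc.inf_eq_bot
    have : x ∈ L ⊓ Q := ⟨h1, (hSR hx).1⟩
    rw [h2] at this
    simpa using this
  let f : Q →ₗ[ℂ] Module.Dual ℂ L := B.compl₁₂ Q.subtype L.subtype
  let f' : L →ₗ[ℂ] Module.Dual ℂ Q := B.compl₁₂ L.subtype Q.subtype
  have hf : Function.Injective f := by
    rw [← LinearMap.ker_eq_bot, LinearMap.ker_eq_bot']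
    intro x hx
    have : (x : M) ∈ L ⊓ Q :=
      ⟨hperp x fun y hy => by simpa [f] using LinearMap.congr_fun hx ⟨y, hy⟩, x.2⟩
    rw [hc.inf_eq_bot] at this
    simpa using this
  have hf' : Function.Injective f' := by
    rw [← LinearMap.ker_eq_bot, LinearMap.ker_eq_bot']
    intro x hx
    have : (x : M) = 0 := hnd x fun y => by
      have : y ∈ L ⊔ Q := by rw [hc.sup_eq_top]; trivial
      obtain ⟨l, hl, z, hz, rfl⟩ := Submodule.mem_sup.1 this
      have := LinearMap.congr_fun hx ⟨z, hz⟩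
      simp only [f', LinearMap.compl₁₂_apply, Submodule.subtype_apply, LinearMap.zero_apply] at this
      simp [this, hiso x x.2 l hl]
    simpa using this
  have hdim : Module.finrank ℂ Q = Module.finrank ℂ (Module.Dual ℂ L) := by
    have h1 := LinearMap.finrank_le_finrank_of_injective hf
    have h2 := LinearMap.finrank_le_finrank_of_injective hf'
    rw [Subspace.dual_finrank_eq] at *
    omega
  refine ⟨L, inferInstance, inferInstance, inferInstance, subRep ρ L hL, fun g => ?_⟩
  rw [char_add_of_isCompl ρ hL hQ hc, ← Representation.char_dual]
  congr 1
  refine char_eq_of_equiv _ _ (LinearEquiv.ofInjectiveOfFinrankEq f hf hdim) (fun g x => ?_) g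
  ext y
  exact hB.left_inv g x y

end ComplexRep

section Trace

lemma trace_matrix_end {n : Type*} [Fintype n] [DecidableEq n] (f : Matrix n n ℂ →ₗ[ℂ] Matrix n n ℂ) :
    LinearMap.trace ℂ _ f = ∑ i, ∑ j, f (Matrix.single i j 1) i j := by
  rw [LinearMap.trace_eq_matrix_trace ℂ (Matrix.stdBasis ℂ n n), Matrix.trace,
    Fintype.sum_prod_type]
  refine Finset.sum_congr rfl fun i _ => Finset.sum_congr rfl fun j _ => ?_
  rw [Matrix.diag_apply, LinearMap.toMatrix_apply, Matrix.stdBasis_eq_single]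
  rfl

variable {M : Type*} [AddCommGroup M] [Module ℂ M]

/-- Pulling a bilinear form back along an endomorphism. -/
def pull (A : M →ₗ[ℂ] M) : (M →ₗ[ℂ] M →ₗ[ℂ] ℂ) →ₗ[ℂ] (M →ₗ[ℂ] M →ₗ[ℂ] ℂ) where
  toFun B := B.compl₁₂ A A
  map_add' _ _ := rfl
  map_smul' _ _ := rfl

/-- Flipping the arguments and pulling a bilinear form back along an endomorphism. -/
def pullFlip (A : M →ₗ[ℂ] M) : (M →ₗ[ℂ] M →ₗ[ℂ] ℂ) →ₗ[ℂ] (M →ₗ[ℂ] M →ₗ[ℂ] ℂ) where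
  toFun B := B.flip.compl₁₂ A A
  map_add' _ _ := rfl
  map_smul' _ _ := rfl

@[simp] lemma pull_apply (A : M →ₗ[ℂ] M) (B x y) : pull A B x y = B (A x) (A y) := rfl
@[simp] lemma pullFlip_apply (A : M →ₗ[ℂ] M) (B x y) : pullFlip A B x y = B (A y) (A x) := rfl

variable [FiniteDimensional ℂ M]

lemma trace_pull (A : M →ₗ[ℂ] M) :
    LinearMap.trace ℂ _ (pull A) = LinearMap.trace ℂ M A * LinearMap.trace ℂ M A := by
  let b := Module.finBasis ℂ M
  have key : ∀ i j, (LinearMap.toMatrix₂ b b).conj (pull A) (Matrix.single i j 1) i j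
      = LinearMap.toMatrix b b A i i * LinearMap.toMatrix b b A j j := by
    intro i j
    rw [LinearEquiv.conj_apply_apply]
    change LinearMap.toMatrix₂ b b (LinearMap.compl₁₂ _ A A) i j = _
    rw [LinearMap.toMatrix₂_compl₁₂ b b, LinearEquiv.apply_symm_apply]
    simp [Matrix.mul_apply, Matrix.single_apply, ite_and]
  rw [← LinearMap.trace_conj' _ (LinearMap.toMatrix₂ b b), trace_matrix_end,
    LinearMap.trace_eq_matrix_trace ℂ b, Matrix.trace, Finset.sum_mul_sum]
  exact Finset.sum_congr rfl fun i _ => Finset.sum_congr rfl fun j _ => key i j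

lemma trace_pullFlip (A : M →ₗ[ℂ] M) :
    LinearMap.trace ℂ _ (pullFlip A) = LinearMap.trace ℂ M (A * A) := by
  let b := Module.finBasis ℂ M
  have key : ∀ i j, (LinearMap.toMatrix₂ b b).conj (pullFlip A) (Matrix.single i j 1) i j
      = LinearMap.toMatrix b b A i j * LinearMap.toMatrix b b A j i := by
    intro i j
    rw [LinearEquiv.conj_apply_apply]
    have : pullFlip A ((LinearMap.toMatrix₂ b b).symm (Matrix.single i j 1)) =
        LinearMap.compl₁₂ ((LinearMap.toMatrix₂ b b).symm (Matrix.single j i 1)) A A := by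
      ext x y
      simp [Matrix.single_apply, ite_and]
      ring
    rw [this, LinearMap.toMatrix₂_compl₁₂ b b, LinearEquiv.apply_symm_apply]
    simp [Matrix.mul_apply, Matrix.single_apply, ite_and, mul_comm]
  rw [← LinearMap.trace_conj' _ (LinearMap.toMatrix₂ b b), trace_matrix_end,
    LinearMap.trace_eq_matrix_trace ℂ b, Module.End.mul_eq_comp, LinearMap.toMatrix_comp b b b,
    Matrix.trace]
  refine Finset.sum_congr rfl fun i _ => ?_
  rw [Matrix.diag_apply, Matrix.mul_apply]
  exact Finset.sum_congr rfl fun j _ => key i j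

lemma trace_of_range_le_span {E : Type*} [AddCommGroup E] [Module ℂ E] [FiniteDimensional ℂ E]
    (f : E →ₗ[ℂ] E) (v : E) (hv : v ≠ 0) (c : ℂ) (hf : ∀ x, ∃ a : ℂ, f x = a • v)
    (hc : f v = c • v) : LinearMap.trace ℂ E f = c := by
  choose a ha using hf
  have hinj : ∀ s t : ℂ, s • v = t • v → s = t := fun s t h => smul_left_injective ℂ hv h
  let l : E →ₗ[ℂ] ℂ :=
    { toFun := a
      map_add' := fun x y => hinj _ _ (by rw [← ha, add_smul, ← ha, ← ha, map_add])
      map_smul' := fun s x => hinj _ _ (by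
        rw [← ha, RingHom.id_apply, smul_eq_mul, mul_smul, ← ha, map_smul]) }
  have : f = l.smulRight v := LinearMap.ext fun x => by simp [l, ha]
  rw [this, LinearMap.trace_smulRight]
  exact hinj _ _ (by rw [← hc]; exact (ha v).symm)

end Trace

section FS

variable {G : Type*} [Group G] {M : Type*} [AddCommGroup M] [Module ℂ M]

lemma Irr.nondeg {ρ : Representation ℂ G M} (h : Irr ρ) {B : M →ₗ[ℂ] M →ₗ[ℂ] ℂ}
    (hB : Invar ρ B) (h0 : B ≠ 0) (x : M) (hx : ∀ y, B x y = 0) : x = 0 := by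
  have : LinearMap.ker B = ⊥ := by
    refine (h.2 _ fun g z hz => ?_).resolve_right fun ht => h0 (LinearMap.ker_eq_top.1 ht)
    rw [LinearMap.mem_ker] at *
    ext y
    rw [hB.left_inv, hz]; rfl
  rw [← Submodule.mem_bot ℂ, ← this, LinearMap.mem_ker]
  exact LinearMap.ext hx

lemma Irr.form_unique [FiniteDimensional ℂ M] {ρ : Representation ℂ G M} (h : Irr ρ)
    {B B' : M →ₗ[ℂ] M →ₗ[ℂ] ℂ} (hB : Invar ρ B) (h0 : B ≠ 0) (hB' : Invar ρ B') :
    ∃ c : ℂ, B' = c • B := by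
  have hinj : Function.Injective B := by
    rw [← LinearMap.ker_eq_bot, LinearMap.ker_eq_bot']
    exact fun x hx => h.nondeg hB h0 x fun y => by rw [hx]; rfl
  let e : M ≃ₗ[ℂ] Module.Dual ℂ M :=
    LinearEquiv.ofInjectiveOfFinrankEq B hinj Subspace.dual_finrank_eq.symm
  have : Nontrivial M := ⟨⟨h.1.choose, 0, h.1.choose_spec⟩⟩
  obtain ⟨c, hc⟩ := Module.End.exists_eigenvalue (e.symm.toLinearMap ∘ₗ B')
  obtain ⟨v, hv⟩ := hc.exists_hasEigenvector
  have hv1 : B' v = c • B v := by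
    have := congrArg e hv.apply_eq_smul
    simp only [LinearMap.comp_apply, LinearEquiv.coe_coe, LinearEquiv.apply_symm_apply,
      map_smul] at this
    exact this
  refine ⟨c, sub_eq_zero.1 ?_⟩
  have hI : Invar ρ (B' - c • B) := fun g x y => by simp [hB g x y, hB' g x y]
  by_contra hne
  exact hv.2 (h.nondeg hI hne v fun y => by simp [hv1])

lemma Irr.flip_eq [FiniteDimensional ℂ M] {ρ : Representation ℂ G M} (h : Irr ρ)
    {B : M →ₗ[ℂ] M →ₗ[ℂ] ℂ} (hB : Invar ρ B) :
    (∀ x y, B x y = B y x) ∨ (∀ x, B x x = 0) := by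
  by_cases h0 : B = 0
  · simp [h0]
  obtain ⟨c, hc⟩ := h.form_unique hB h0 (B' := B.flip) fun g x y => hB g y x
  have hc' : ∀ x y, B y x = c * B x y := fun x y => by
    simpa using LinearMap.congr_fun₂ hc x y
  by_cases hc1 : c = 1
  · exact Or.inl fun x y => by rw [hc' x y, hc1, one_mul]
  · refine Or.inr fun x => ?_
    have := hc' x x
    have h2 : (1 - c) * B x x = 0 := by linear_combination this
    exact (mul_eq_zero.1 h2).resolve_left (sub_ne_zero.2 (Ne.symm hc1))

variable [Fintype G]

/-- The averaged operators on bilinear forms. -/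
def avgOp (ρ : Representation ℂ G M)
    (T : (M →ₗ[ℂ] M) → ((M →ₗ[ℂ] M →ₗ[ℂ] ℂ) →ₗ[ℂ] (M →ₗ[ℂ] M →ₗ[ℂ] ℂ))) :
    (M →ₗ[ℂ] M →ₗ[ℂ] ℂ) →ₗ[ℂ] (M →ₗ[ℂ] M →ₗ[ℂ] ℂ) :=
  (Fintype.card G : ℂ)⁻¹ • ∑ g, T (ρ g)

lemma avgOp_pull_apply [FiniteDimensional ℂ M] (ρ : Representation ℂ G M) (B x y) :
    avgOp ρ pull B x y = (Fintype.card G : ℂ)⁻¹ * ∑ g, B (ρ g x) (ρ g y) := by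
  simp [avgOp, LinearMap.sum_apply]

lemma avgOp_pullFlip_apply [FiniteDimensional ℂ M] (ρ : Representation ℂ G M) (B x y) :
    avgOp ρ pullFlip B x y = (Fintype.card G : ℂ)⁻¹ * ∑ g, B (ρ g y) (ρ g x) := by
  simp [avgOp, LinearMap.sum_apply]

lemma invar_avgOp_pull [FiniteDimensional ℂ M] (ρ : Representation ℂ G M) (B) :
    Invar ρ (avgOp ρ pull B) := fun h x y => by
  simp only [avgOp_pull_apply, ← Module.End.mul_apply, ← map_mul]
  congr 1
  exact Fintype.sum_equiv (Equiv.mulRight h) _ _ fun g => rfl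

lemma invar_avgOp_pullFlip [FiniteDimensional ℂ M] (ρ : Representation ℂ G M) (B) :
    Invar ρ (avgOp ρ pullFlip B) := fun h x y => by
  simp only [avgOp_pullFlip_apply, ← Module.End.mul_apply, ← map_mul]
  congr 1
  exact Fintype.sum_equiv (Equiv.mulRight h) _ _ fun g => rfl

lemma trace_avgOp_pull [FiniteDimensional ℂ M] (ρ : Representation ℂ G M) :
    LinearMap.trace ℂ _ (avgOp ρ pull)
      = (Fintype.card G : ℂ)⁻¹ * ∑ g, ρ.character g * ρ.character g := by
  simp [avgOp, trace_pull, Representation.character]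

lemma trace_avgOp_pullFlip [FiniteDimensional ℂ M] (ρ : Representation ℂ G M) :
    LinearMap.trace ℂ _ (avgOp ρ pullFlip)
      = (Fintype.card G : ℂ)⁻¹ * ∑ g, ρ.character (g * g) := by
  simp [avgOp, trace_pullFlip, Representation.character]

lemma Irr.sum_sq_of_form [FiniteDimensional ℂ M] {ρ : Representation ℂ G M} (h : Irr ρ)
    {B : M →ₗ[ℂ] M →ₗ[ℂ] ℂ} (hB : Invar ρ B) (h0 : B ≠ 0) (c : ℂ)
    (hc : ∀ x y, B y x = c * B x y) :
    ∑ g, ρ.character (g * g) = c * Fintype.card G := by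
  have hcard : (Fintype.card G : ℂ) ≠ 0 := by simp
  have := trace_of_range_le_span (avgOp ρ pullFlip) B h0 c
    (fun X => h.form_unique hB h0 (invar_avgOp_pullFlip ρ X)) (by
      ext x y
      rw [avgOp_pullFlip_apply]
      simp only [hB _ y x, hc x y]
      simp)
  rw [trace_avgOp_pullFlip] at this
  field_simp at this
  rw [this, mul_comm]

lemma Irr.sum_sq_of_alt [FiniteDimensional ℂ M] {ρ : Representation ℂ G M} (h : Irr ρ)
    {B : M →ₗ[ℂ] M →ₗ[ℂ] ℂ} (hB : Invar ρ B) (h0 : B ≠ 0) (ha : ∀ x, B x x = 0) :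
    ∑ g, ρ.character (g * g) = - (Fintype.card G : ℂ) := by
  rw [h.sum_sq_of_form hB h0 (-1), neg_one_mul]
  intro x y
  have := ha (x + y)
  simp only [map_add, LinearMap.add_apply, ha, zero_add, add_zero] at this
  linear_combination this

lemma Irr.sum_sq_of_symm [FiniteDimensional ℂ M] {ρ : Representation ℂ G M} (h : Irr ρ)
    {B : M →ₗ[ℂ] M →ₗ[ℂ] ℂ} (hB : Invar ρ B) (h0 : B ≠ 0) (ha : ∀ x y, B x y = B y x) :
    ∑ g, ρ.character (g * g) = (Fintype.card G : ℂ) := by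
  rw [h.sum_sq_of_form hB h0 1, one_mul]
  intro x y
  rw [ha, one_mul]

lemma Irr.sum_sq_of_no_form [FiniteDimensional ℂ M] {ρ : Representation ℂ G M}
    (h0 : ∀ B, Invar ρ B → B = 0) :
    ∑ g, ρ.character (g * g) = 0 := by
  have hcard : (Fintype.card G : ℂ) ≠ 0 := by simp
  have h1 : avgOp ρ pullFlip = 0 := LinearMap.ext fun X => h0 _ (invar_avgOp_pullFlip ρ X)
  have := trace_avgOp_pullFlip ρ
  rw [h1, map_zero] at this
  exact (mul_eq_zero.1 this.symm).resolve_left (inv_ne_zero hcard)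

lemma sum_char_sq_of_no_form [FiniteDimensional ℂ M] {ρ : Representation ℂ G M}
    (h0 : ∀ B, Invar ρ B → B = 0) :
    ∑ g, ρ.character g * ρ.character g = 0 := by
  have hcard : (Fintype.card G : ℂ) ≠ 0 := by simp
  have h1 : avgOp ρ pull = 0 := LinearMap.ext fun X => h0 _ (invar_avgOp_pull ρ X)
  have := trace_avgOp_pull ρ
  rw [h1, map_zero] at this
  exact (mul_eq_zero.1 this.symm).resolve_left (inv_ne_zero hcard)

end FS

section Conj

open ComplexOrder in
lemma char_inv_eq_conj {G : Type*} [Group G] [Finite G] {M : Type*} [AddCommGroup M] [Module ℂ M]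
    [FiniteDimensional ℂ M] (ρ : Representation ℂ G M) (g : G) :
    ρ.character g⁻¹ = starRingEnd ℂ (ρ.character g) := by
  have := Fintype.ofFinite G
  let b := Module.finBasis ℂ M
  let A : G → Matrix _ _ ℂ := fun g => LinearMap.toMatrix b b (ρ g)
  have hA : ∀ g h, A (g * h) = A g * A h := fun g h => by
    simp [A, map_mul, Module.End.mul_eq_comp, LinearMap.toMatrix_comp b b b]
  have hA1 : A 1 = 1 := by simp [A, Module.End.one_eq_id]
  let H : Matrix _ _ ℂ := ∑ g, (A g)ᴴ * A g
  have hinv : (A g)ᴴ * H * A g = H := by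
    simp only [H, Finset.mul_sum, Finset.sum_mul]
    refine Fintype.sum_equiv (Equiv.mulRight g) _ _ fun k => ?_
    simp [hA, Matrix.mul_assoc, Matrix.conjTranspose_mul]
  have hH : IsUnit H := by
    refine Matrix.PosDef.isUnit ?_
    have : H = 1 + ∑ g ∈ Finset.univ.erase 1, (A g)ᴴ * A g := by
      have h := Finset.add_sum_erase Finset.univ (fun g => (A g)ᴴ * A g) (Finset.mem_univ (1 : G))
      simp only [hA1, Matrix.conjTranspose_one, Matrix.one_mul] at h
      exact h.symm
    rw [this]
    exact Matrix.PosDef.one.add_posSemidef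
      (Matrix.posSemidef_sum _ fun k _ => Matrix.posSemidef_conjTranspose_mul_self _)
  have hdet : IsUnit H.det := (Matrix.isUnit_iff_isUnit_det _).1 hH
  have hg : A g * A g⁻¹ = 1 := by rw [← hA, mul_inv_cancel, hA1]
  have h1 : H * A g⁻¹ = (A g)ᴴ * H := by
    calc H * A g⁻¹ = (A g)ᴴ * H * A g * A g⁻¹ := by rw [hinv]
      _ = _ := by rw [Matrix.mul_assoc, hg, Matrix.mul_one]
  have h2 : A g⁻¹ = H⁻¹ * ((A g)ᴴ * H) := by
    rw [← h1, ← Matrix.mul_assoc, Matrix.nonsing_inv_mul _ hdet, Matrix.one_mul]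
  have htr : ∀ k, ρ.character k = (A k).trace := fun k => LinearMap.trace_eq_matrix_trace ℂ b _
  rw [htr, htr, h2, ← Matrix.mul_assoc, Matrix.trace_mul_cycle, Matrix.mul_nonsing_inv _ hdet,
    Matrix.one_mul, Matrix.trace_conjTranspose]
  rfl

end Conj

section RealReps

variable {G : Type*} [Group G] [Fintype G]

lemma good_of_sum_sq_nonneg
    (h : ∀ (M : Type) [AddCommGroup M] [Module ℂ M] [FiniteDimensional ℂ M]
      (ρ : Representation ℂ G M), 0 ≤ (∑ g, ρ.character (g * g)).re) : Good G := by
  intro M _ _ _ ρ hρ B hB ha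
  by_contra h0
  have h1 := h M ρ
  rw [hρ.sum_sq_of_alt hB h0 ha] at h1
  have : 0 < Fintype.card G := Fintype.card_pos
  simp at h1

lemma Good.sum_sq_nonneg (hG : Good G) (M : Type) [AddCommGroup M] [Module ℂ M]
    [FiniteDimensional ℂ M] (ρ : Representation ℂ G M) :
    0 ≤ (∑ g, ρ.character (g * g)).re := by
  refine char_induction (fun χ : G → ℂ => 0 ≤ (∑ g, χ (g * g)).re) (by simp) ?_ ?_ M ρ
  · intro a b ha hb
    simp only [Pi.add_apply, Finset.sum_add_distrib, Complex.add_re]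
    exact add_nonneg ha hb
  · intro N _ _ _ σ hσ
    by_cases hn : ∀ B, Invar σ B → B = 0
    · rw [Irr.sum_sq_of_no_form hn]; simp
    · push Not at hn
      obtain ⟨B, hB, h0⟩ := hn
      rcases hσ.flip_eq hB with h | h
      · rw [hσ.sum_sq_of_symm hB h0 h]; simp
      · exact absurd (hG N σ hσ B hB h) h0

lemma exists_form_of_real {M : Type*} [AddCommGroup M] [Module ℂ M]
    [FiniteDimensional ℂ M] {ρ : Representation ℂ G M} (hρ : Irr ρ)
    (hreal : ∀ g, ρ.character g⁻¹ = ρ.character g) : ∃ B, Invar ρ B ∧ B ≠ 0 := by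
  by_contra hcon
  push Not at hcon
  have h := sum_char_sq_of_no_form hcon
  have h1 : ∀ g, ρ.character g * ρ.character g = ((Complex.normSq (ρ.character g) : ℝ) : ℂ) := by
    intro g
    rw [← Complex.mul_conj, ← char_inv_eq_conj, hreal]
  simp only [h1] at h
  rw [← Complex.ofReal_sum, Complex.ofReal_eq_zero,
    Finset.sum_eq_zero_iff_of_nonneg (fun _ _ => Complex.normSq_nonneg _)] at h
  have := h 1 (Finset.mem_univ _)
  rw [Complex.normSq_eq_zero, Representation.char_one] at this
  have : Nontrivial M := ⟨⟨hρ.1.choose, 0, hρ.1.choose_spec⟩⟩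
  have : 0 < Module.finrank ℂ M := Module.finrank_pos
  simp_all

lemma Good.sum_sq_eq_card (hG : Good G) {M : Type} [AddCommGroup M] [Module ℂ M]
    [FiniteDimensional ℂ M] {ρ : Representation ℂ G M} (hρ : Irr ρ)
    (hreal : ∀ g, ρ.character g⁻¹ = ρ.character g) :
    ∑ g, ρ.character (g * g) = Fintype.card G := by
  obtain ⟨B, hB, h0⟩ := exists_form_of_real hρ hreal
  rcases hρ.flip_eq hB with h | h
  · exact hρ.sum_sq_of_symm hB h0 h
  · exact absurd (hG M ρ hρ B hB h) h0

end RealReps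

section Products

/-- Restriction of a representation along a homomorphism. -/
def pullRep {G H : Type*} [Group G] [Group H] {M : Type*} [AddCommGroup M] [Module ℂ M]
    (ρ : Representation ℂ H M) (f : G →* H) : Representation ℂ G M := ρ.comp f

lemma Good.prod {G₁ G₂ : Type*} [Group G₁] [Group G₂] (h1 : Good G₁) (h2 : Good G₂) :
    Good (G₁ × G₂) := by
  intro M _ _ _ ρ hρ B hB ha
  by_contra hB0
  have hnd := hρ.nondeg hB hB0
  let ρ₁ : Representation ℂ G₁ M := ρ.comp (MonoidHom.inl G₁ G₂)
  let ρ₂ : Representation ℂ G₂ M := ρ.comp (MonoidHom.inr G₁ G₂)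
  have hdec : ∀ g x, ρ g x = ρ₁ g.1 (ρ₂ g.2 x) := fun g x => by
    change _ = (ρ _ * ρ _) x
    rw [← map_mul]; simp
  have hcomm : ∀ g h x, ρ₁ g (ρ₂ h x) = ρ₂ h (ρ₁ g x) := fun g h x => by
    change (ρ _ * ρ _) x = (ρ _ * ρ _) x
    rw [← map_mul, ← map_mul]; simp
  have hB1 : Invar ρ₁ B := fun g => hB _
  have hB2 : Invar ρ₂ B := fun g => hB _
  obtain ⟨x₀, hx₀⟩ := hρ.1
  obtain ⟨S, hS, -, hirr⟩ := exists_irr_le ρ₁ ⊤ (fun _ _ _ => trivial)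
    ((Submodule.ne_bot_iff _).2 ⟨x₀, trivial, hx₀⟩)
  let N : Submodule ℂ (S →ₗ[ℂ] M) :=
    { carrier := {f | ∀ g s, f (subRep ρ₁ S hS g s) = ρ₁ g (f s)}
      add_mem' := fun {a b} ha hb g s => by simp [ha g s, hb g s]
      zero_mem' := fun g s => by simp
      smul_mem' := fun c a ha g s => by simp [ha g s] }
  let τ : Representation ℂ G₂ N :=
    { toFun := fun h =>
        { toFun := fun f => ⟨ρ₂ h ∘ₗ f.1, fun g s => by simp [f.2 g s, hcomm]⟩
          map_add' := fun a b => by ext; simp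
          map_smul' := fun c a => by ext; simp }
      map_one' := by ext; simp
      map_mul' := fun a b => by ext; simp }
  have hτ : ∀ h (f : N) s, (τ h f : S →ₗ[ℂ] M) s = ρ₂ h (f.1 s) := fun _ _ _ => rfl
  -- spans of images of stable families of intertwiners
  have hspan : ∀ P : Submodule ℂ N, Stable τ P → P ≠ ⊥ →
      Submodule.span ℂ {x | ∃ f ∈ P, ∃ s, (f : S →ₗ[ℂ] M) s = x} = ⊤ := by
    intro P hP hP0
    refine (hρ.2 _ ?_).resolve_left ?_
    · intro g x hx
      induction hx using Submodule.span_induction with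
      | mem x hx =>
        obtain ⟨f, hf, s, rfl⟩ := hx
        refine Submodule.subset_span ⟨τ g.2 f, hP _ _ hf, subRep ρ₁ S hS g.1 s, ?_⟩
        rw [hτ, hdec, f.2, hcomm]
      | zero => rw [map_zero]; exact zero_mem _
      | add x y _ _ hx hy => rw [map_add]; exact add_mem hx hy
      | smul c x _ hx => rw [map_smul]; exact Submodule.smul_mem _ c hx
    · intro h0
      obtain ⟨f, hf, hf0⟩ := (Submodule.ne_bot_iff _).1 hP0
      apply hf0
      ext s
      have : (f : S →ₗ[ℂ] M) s ∈ Submodule.span ℂ {x | ∃ f ∈ P, ∃ s, (f : S →ₗ[ℂ] M) s = x} :=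
        Submodule.subset_span ⟨f, hf, s, rfl⟩
      rw [h0] at this
      simpa using this
  have hzero : ∀ P : Submodule ℂ N, Stable τ P → P ≠ ⊥ →
      ¬ ∀ f ∈ P, ∀ f' ∈ P, ∀ s s', B ((f : S →ₗ[ℂ] M) s) ((f' : S →ₗ[ℂ] M) s') = 0 := by
    intro P hP hP0 hcon
    have hs := hspan P hP hP0
    have hz : ∀ x, ∀ y, B x y = 0 := by
      intro x y
      have hx : x ∈ Submodule.span ℂ {x | ∃ f ∈ P, ∃ s, (f : S →ₗ[ℂ] M) s = x} := hs ▸ trivial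
      have hy : y ∈ Submodule.span ℂ {x | ∃ f ∈ P, ∃ s, (f : S →ₗ[ℂ] M) s = x} := hs ▸ trivial
      refine Submodule.span_induction₂ ?_ ?_ ?_ ?_ ?_ ?_ ?_ hx hy (p := fun x y _ _ => B x y = 0)
      · rintro _ _ ⟨f, hf, s, rfl⟩ ⟨f', hf', s', rfl⟩
        exact hcon f hf f' hf' s s'
      · intro y _; simp
      · intro y _; simp
      · intro x y z _ _ _ h h'; simp [h, h']
      · intro x y z _ _ _ h h'; simp [h, h']
      · intro c x y _ _ h; simp [h]
      · intro c x y _ _ h; simp [h]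
    exact hB0 (LinearMap.ext₂ hz)
  have hN0 : (⊤ : Submodule ℂ N) ≠ ⊥ := by
    obtain ⟨s, hs⟩ := hirr.1
    refine (Submodule.ne_bot_iff _).2 ⟨⟨S.subtype, fun g s => rfl⟩, trivial, fun h => hs ?_⟩
    have := LinearMap.congr_fun (congrArg Subtype.val h) s
    simpa using this
  have hne := hzero ⊤ (fun _ _ _ => trivial) hN0
  push Not at hne
  obtain ⟨f₀, -, f₁, -, s₀, s₁, hne⟩ := hne
  let bf : N → N → (S →ₗ[ℂ] S →ₗ[ℂ] ℂ) := fun f f' => B.compl₁₂ f.1 f'.1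
  have hbf : ∀ f f', Invar (subRep ρ₁ S hS) (bf f f') := fun f f' g x y => by
    change B (f.1 _) (f'.1 _) = B (f.1 _) (f'.1 _)
    rw [f.2, f'.2, hB1]
  set b₀ := bf f₀ f₁ with hb₀
  have hb0 : b₀ ≠ 0 := fun h => hne (by
    have := LinearMap.congr_fun₂ h s₀ s₁
    simpa [b₀, bf] using this)
  have hsymm : ∀ x y, b₀ x y = b₀ y x := by
    rcases hirr.flip_eq (hbf f₀ f₁) with h | h
    · exact h
    · exact absurd (h1 S _ hirr _ (hbf f₀ f₁) h) hb0
  have hprop : ∀ f f' : N, ∃ c : ℂ, ∀ s s', B (f.1 s) (f'.1 s') = c * b₀ s s' := fun f f' => by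
    obtain ⟨c, hc⟩ := hirr.form_unique (hbf f₀ f₁) hb0 (hbf f f')
    exact ⟨c, fun s s' => LinearMap.congr_fun₂ hc s s'⟩
  have hne' : b₀ s₀ s₁ ≠ 0 := hne
  let c : N →ₗ[ℂ] N →ₗ[ℂ] ℂ := LinearMap.mk₂ ℂ (fun f f' => B (f.1 s₀) (f'.1 s₁))
    (fun a b d => by simp) (fun r a b => by simp) (fun a b d => by simp) (fun r a b => by simp)
  have hc : ∀ f f', c f f' = B (f.1 s₀) (f'.1 s₁) := fun _ _ => rfl
  have hcI : Invar τ c := fun g f f' => by rw [hc, hc, hτ, hτ, hB2]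
  have hcalt : ∀ f, c f f = 0 := fun f => by
    obtain ⟨a, haf⟩ := hprop f f
    have e1 := haf s₀ s₁
    have e2 := haf s₁ s₀
    rw [skew_of_alt ha, hsymm s₁ s₀, ← e1] at e2
    rw [hc]
    linear_combination -(1 / 2 : ℂ) * e2
  have hcB : ∀ f f', c f f' = 0 → ∀ s s', B (f.1 s) (f'.1 s') = 0 := fun f f' h s s' => by
    obtain ⟨a, haf⟩ := hprop f f'
    rw [hc, haf] at h
    rw [haf, (mul_eq_zero.1 h).resolve_right hne', zero_mul]
  obtain ⟨P, hP, -, hPi⟩ := exists_irr_le τ ⊤ (fun _ _ _ => trivial) hN0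
  have hcP : c.compl₁₂ P.subtype P.subtype = 0 :=
    h2 P (subRep τ P hP) hPi _ (fun g x y => hcI g x y) (fun x => hcalt x)
  refine hzero P hP ?_ fun f hf f' hf' => hcB f f' (LinearMap.congr_fun₂ hcP ⟨f, hf⟩ ⟨f', hf'⟩)
  obtain ⟨⟨x, hx⟩, hx0⟩ := hPi.1
  exact (Submodule.ne_bot_iff _).2 ⟨x, hx, fun h => hx0 (by simpa using h)⟩

lemma sum_char_re_nonneg {K : Type*} [Group K] [Fintype K] {M : Type*} [AddCommGroup M]
    [Module ℂ M] [FiniteDimensional ℂ M] (ρ : Representation ℂ K M) :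
    0 ≤ (∑ g, ρ.character g).re := by
  have : Invertible (Nat.card K : ℂ) := invertibleOfNonzero (by simp)
  have h := Representation.card_inv_mul_sum_char_eq_finrank ρ
  have hK : (Nat.card K : ℂ) ≠ 0 := by simp
  rw [inv_mul_eq_iff_eq_mul₀ hK] at h
  rw [h, ← Nat.cast_mul, Complex.natCast_re]
  positivity

/-- The wreath product criterion. -/
lemma Good.wreath {Γ K : Type*} [Group Γ] [Finite Γ] [Group K] [Finite K] (hK : Good K)
    (f : K × K →* Γ) (hf : Function.Injective f) (s : Γ)
    (hs : ∀ a b, s * f (a, b) * s = f (b, a)) (hsr : ∀ p, f p ≠ s)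
    (hcov : ∀ γ, ∃ p, γ = f p ∨ γ = f p * s) : Good Γ := by
  have := Fintype.ofFinite Γ
  have := Fintype.ofFinite K
  refine good_of_sum_sq_nonneg fun M _ _ _ ρ => ?_
  have hbij : Function.Bijective (Sum.elim f fun p => f p * s) := by
    refine ⟨?_, fun γ => ?_⟩
    · rintro (a | a) (b | b) h <;> simp only [Sum.elim_inl, Sum.elim_inr] at h
      · rw [hf h]
      · exact absurd (by rw [map_mul, map_inv, h]; group) (hsr (b⁻¹ * a))
      · exact absurd (by rw [map_mul, map_inv, ← h]; group) (hsr (a⁻¹ * b))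
      · rw [hf (mul_right_cancel h)]
    · obtain ⟨p, h | h⟩ := hcov γ
      · exact ⟨Sum.inl p, h.symm⟩
      · exact ⟨Sum.inr p, h.symm⟩
  rw [← (Equiv.ofBijective _ hbij).sum_comp, Fintype.sum_sum_type, Complex.add_re]
  refine add_nonneg ?_ ?_
  · have := (hK.prod hK).sum_sq_nonneg M (ρ.comp f)
    simpa [Representation.character] using this
  · have key : ∀ a b, ρ.character (f (a, b) * s * (f (a, b) * s)) =
        (pullRep ρ (f.comp ((MonoidHom.id K).prod (MonoidHom.id K)))).character (a * b) := by
      intro a b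
      have e1 : f (a, b) * s * (f (a, b) * s) = f (a * b, b * a) := by
        have := hs a b
        calc _ = f (a, b) * (s * f (a, b) * s) := by group
          _ = _ := by rw [this, ← map_mul]; rfl
      rw [e1, ← Representation.char_conj ρ (f (a * b, b * a)) (f (1, a)), ← map_inv, ← map_mul,
        ← map_mul]
      simp [pullRep, Representation.character, mul_assoc]
    simp only [Equiv.ofBijective_apply, Sum.elim_inr, Fintype.sum_prod_type, key]
    have : ∀ a : K, ∑ b, (pullRep ρ (f.comp ((MonoidHom.id K).prod (MonoidHom.id K)))).character
        (a * b) = ∑ b, (pullRep ρ (f.comp ((MonoidHom.id K).prod (MonoidHom.id K)))).character b :=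
      fun a => Fintype.sum_equiv (Equiv.mulLeft a) _ _ fun _ => rfl
    simp only [this, Complex.re_sum]
    refine Finset.sum_nonneg fun _ _ => ?_
    rw [← Complex.re_sum]
    exact sum_char_re_nonneg _

end Products

section Dihedral

variable {G : Type*} [Group G]

/-- The restriction of a class function to a subgroup splits as a character plus its dual. -/
def Splits (χ : G → ℂ) (S : Subgroup G) : Prop :=
  ∃ (N : Type) (_ : AddCommGroup N) (_ : Module ℂ N) (_ : FiniteDimensional ℂ N)
    (φ : Representation ℂ S N), ∀ h : S, χ h = φ.character h + φ.character h⁻¹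

lemma Splits.mono {χ : G → ℂ} {S S' : Subgroup G} (h : Splits χ S) (hle : S' ≤ S) :
    Splits χ S' := by
  obtain ⟨N, _, _, _, φ, hφ⟩ := h
  exact ⟨N, _, _, inferInstance, φ.comp (Subgroup.inclusion hle),
    fun x => hφ (Subgroup.inclusion hle x)⟩

lemma Good.splits {M : Type} [AddCommGroup M] [Module ℂ M] [FiniteDimensional ℂ M]
    {S : Subgroup G} [Finite S] (hS : Good S) (ρ : Representation ℂ G M)
    {B : M →ₗ[ℂ] M →ₗ[ℂ] ℂ} (hB : Invar ρ B) (ha : ∀ x, B x x = 0)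
    (hnd : ∀ x, (∀ y, B x y = 0) → x = 0) : Splits ρ.character S :=
  hS.char_split (ρ.comp S.subtype) B (fun g => hB g) ha hnd

/-- The internal semidirect product of a cyclic group with a subgroup normalising it. -/
lemma good_dihedral [Finite G] (D : Subgroup G) (y t : G) (ht : t * t = 1)
    (hty : t * y * t⁻¹ = y⁻¹) (hyD : y ∈ D)
    (hD : ∀ d ∈ D, ∃ i : ℤ, d = y ^ i ∨ d = y ^ i * t) : Good D := by
  have := Fintype.ofFinite D
  refine good_of_sum_sq_nonneg fun M _ _ _ ρ => ?_
  let A : Subgroup D := Subgroup.zpowers ⟨y, hyD⟩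
  have hA : ∀ d : D, d ∉ A → d * d = 1 := by
    intro d hd
    obtain ⟨i, h | h⟩ := hD d d.2
    · exact absurd ⟨i, Subtype.ext (by simp [h])⟩ hd
    · apply Subtype.ext
      have e : t * y ^ i * t⁻¹ = (y ^ i)⁻¹ := by rw [← conj_zpow, hty, _root_.inv_zpow]
      have ht' : t⁻¹ = t := inv_eq_of_mul_eq_one_right ht
      rw [Subgroup.coe_mul, h, Subgroup.coe_one]
      calc y ^ i * t * (y ^ i * t) = y ^ i * (t * y ^ i * t⁻¹) * (t * t) := by group
        _ = 1 := by rw [e, ht]; group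
  rw [← Finset.sum_filter_add_sum_filter_not _ (· ∈ A), Complex.add_re]
  refine add_nonneg ?_ ?_
  · have hc : ∀ a b : A, a * b = b * a := fun a b => Std.Commutative.comm (op := (· * ·)) a b
    let sq : A →* A :=
      { toFun := fun a => a * a
        map_one' := by simp
        map_mul' := fun a b => by
          rw [mul_assoc, ← mul_assoc b a b, hc b a]; simp only [mul_assoc] }
    have := Fintype.ofFinite A
    have h := sum_char_re_nonneg (pullRep ρ (A.subtype.comp sq))
    have e : ∑ d with d ∈ A, ρ.character (d * d) =
        ∑ a : A, (pullRep ρ (A.subtype.comp sq)).character a := by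
      rw [Finset.sum_subtype _ (p := (· ∈ A)) (by simp)]
      rfl
    rw [e]; exact h
  · have : ∑ d with d ∉ A, ρ.character (d * d) = ∑ d with d ∉ A, (Module.finrank ℂ M : ℂ) := by
      refine Finset.sum_congr rfl fun d hd => ?_
      rw [hA d (Finset.mem_filter.1 hd).2, Representation.char_one]
    rw [this, Finset.sum_const, nsmul_eq_mul, ← Nat.cast_mul, Complex.natCast_re]
    positivity

lemma Irr.isIrreducible {M : Type*} [AddCommGroup M] [Module ℂ M] {ρ : Representation ℂ G M}
    (h : Irr ρ) : ρ.IsIrreducible := by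
  have : Nontrivial (Subrepresentation ρ) := by
    obtain ⟨x, hx⟩ := h.1
    refine ⟨⊥, ⊤, fun he => hx ?_⟩
    have := congrArg Subrepresentation.toSubmodule he
    have hx : x ∈ (⊤ : Submodule ℂ M) := trivial
    rw [← (show (⊥ : Submodule ℂ M) = ⊤ from this)] at hx
    simpa using hx
  refine ⟨fun p => ?_⟩
  rcases h.2 p.toSubmodule (fun g x hx => p.apply_mem_toSubmodule g hx) with h | h
  · exact Or.inl (Subrepresentation.toSubmodule_injective h)
  · exact Or.inr (Subrepresentation.toSubmodule_injective h)

lemma Irr.sum_char_mul_inv {M : Type*} [AddCommGroup M] [Module ℂ M] [FiniteDimensional ℂ M]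
    [Fintype G] {ρ : Representation ℂ G M} (h : Irr ρ) :
    ∑ g, ρ.character g * ρ.character g⁻¹ = Fintype.card G := by
  have : Invertible (Nat.card G : ℂ) := invertibleOfNonzero (by simp)
  have hG : (Nat.card G : ℂ) ≠ 0 := by simp
  have := h.isIrreducible
  have h1 := Representation.card_inv_mul_sum_char_mul_char_eq_finrank ρ ρ
  rw [Representation.IsIrreducible.finrank_intertwiningMap_self, inv_mul_eq_iff_eq_mul₀ hG] at h1
  simpa using h1

lemma card_le_sum_char_mul_inv {M : Type*} [AddCommGroup M] [Module ℂ M] [FiniteDimensional ℂ M]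
    [Fintype G] (ρ : Representation ℂ G M) (h : ∃ x : M, x ≠ 0) :
    (Fintype.card G : ℝ) ≤ (∑ g, ρ.character g * ρ.character g⁻¹).re := by
  have : Invertible (Nat.card G : ℂ) := invertibleOfNonzero (by simp)
  have hG : (Nat.card G : ℂ) ≠ 0 := by simp
  have h1 := Representation.card_inv_mul_sum_char_mul_char_eq_finrank ρ ρ
  have : Nontrivial (Representation.IntertwiningMap ρ ρ) := by
    obtain ⟨x, hx⟩ := h
    refine ⟨0, Representation.IntertwiningMap.id ρ, fun he => hx ?_⟩
    have := congrArg (fun f => Representation.IntertwiningMap.toLinearMap f x) he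
    exact this.symm
  have h2 : 0 < Module.finrank ℂ (Representation.IntertwiningMap ρ ρ) := by
    have := (Representation.invariantsEquivIntertwiningMap ρ ρ).finrank_eq
    rw [← this]
    have : Nontrivial (Representation.invariants (ρ.linHom ρ)) :=
      (Representation.invariantsEquivIntertwiningMap ρ ρ).toEquiv.nontrivial
    exact Module.finrank_pos
  rw [inv_mul_eq_iff_eq_mul₀ hG] at h1
  rw [h1, ← Nat.cast_mul, Complex.natCast_re, Nat.card_eq_fintype_card]
  exact_mod_cast Nat.le_mul_of_pos_right _ h2

lemma char_mul_inv_eq {M : Type*} [AddCommGroup M] [Module ℂ M] [FiniteDimensional ℂ M]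
    [Finite G] (ρ : Representation ℂ G M) (g : G) :
    ρ.character g * ρ.character g⁻¹ = ((Complex.normSq (ρ.character g) : ℝ) : ℂ) := by
  rw [char_inv_eq_conj, Complex.mul_conj]

lemma good_of_dihedral [Finite G] (D : Subgroup G) (hcard : Nat.card G ≤ 2 * Nat.card D)
    (y t : G) (ht : t * t = 1) (hty : t * y * t⁻¹ = y⁻¹) (hyD : y ∈ D) (htD : t ∈ D)
    (hD : ∀ d ∈ D, ∃ i : ℤ, d = y ^ i ∨ d = y ^ i * t) : Good G := by
  have hGD := good_dihedral D y t ht hty hyD hD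
  have := Fintype.ofFinite G
  have := Fintype.ofFinite D
  intro M _ _ _ ρ hρ B hB ha
  by_contra h0
  obtain ⟨N, _, _, _, φ, hφ⟩ := hGD.splits ρ hB ha (hρ.nondeg hB h0)
  have hinv : ∀ d : D, φ.character d⁻¹ = φ.character d := by
    intro d
    obtain ⟨i, h | h⟩ := hD d d.2
    · rw [← Representation.char_conj φ d ⟨t, htD⟩]
      congr 1
      apply Subtype.ext
      simp only [Subgroup.coe_mul, Subgroup.coe_inv, h]
      rw [← conj_zpow, hty, _root_.inv_zpow]
    · congr 1
      apply Subtype.ext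
      have e : t * y ^ i * t⁻¹ = (y ^ i)⁻¹ := by rw [← conj_zpow, hty, _root_.inv_zpow]
      have ht' : t⁻¹ = t := inv_eq_of_mul_eq_one_right ht
      rw [Subgroup.coe_inv, h, _root_.mul_inv_rev, ← e, ht']
      calc t * (t * y ^ i * t) = t * t * (y ^ i * t) := by group
        _ = _ := by rw [ht, one_mul]
  have hd : ∀ d : D, Complex.normSq (ρ.character d) = 4 * Complex.normSq (φ.character d) := by
    intro d
    rw [hφ d, hinv d, ← two_mul, Complex.normSq_mul]
    norm_num
  have hNx : ∃ x : N, x ≠ 0 := by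
    by_contra hcon
    push Not at hcon
    have : Subsingleton N := ⟨fun a b => by rw [hcon a, hcon b]⟩
    have h1 := hφ 1
    rw [inv_one, Representation.char_one, Module.finrank_zero_of_subsingleton,
      show ((1 : D) : G) = 1 from rfl, Representation.char_one] at h1
    have : Nontrivial M := ⟨⟨hρ.1.choose, 0, hρ.1.choose_spec⟩⟩
    have : 0 < Module.finrank ℂ M := Module.finrank_pos
    simp at h1
    omega
  have h1 := hρ.sum_char_mul_inv
  have h2 := card_le_sum_char_mul_inv φ hNx
  simp only [char_mul_inv_eq, ← Complex.ofReal_sum, Complex.ofReal_re] at h1 h2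
  have h3 : ∑ g, Complex.normSq (ρ.character g) = Fintype.card G := by exact_mod_cast h1
  have h4 : ∑ d : D, Complex.normSq (ρ.character d) ≤ ∑ g, Complex.normSq (ρ.character g) := by
    rw [← Finset.sum_subtype (Finset.univ.filter (· ∈ D)) (by simp)
      (fun g => Complex.normSq (ρ.character g))]
    exact Finset.sum_le_sum_of_subset_of_nonneg (Finset.filter_subset _ _)
      fun _ _ _ => Complex.normSq_nonneg _
  simp only [hd] at h4
  rw [← Finset.mul_sum, h3] at h4
  have h5 : (4 : ℝ) * Fintype.card D ≤ Fintype.card G := by linarith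
  rw [Nat.card_eq_fintype_card, Nat.card_eq_fintype_card] at hcard
  have h6 : 0 < Fintype.card D := Fintype.card_pos
  have h7 : 4 * Fintype.card D ≤ Fintype.card G := by exact_mod_cast h5
  omega

end Dihedral

section Integrality

variable {M : Type*} [AddCommGroup M] [Module ℂ M] [FiniteDimensional ℂ M]

lemma isIntegral_trace (A : Module.End ℂ M) {n : ℕ} (hn : 0 < n) (h : A ^ (n + 1) = A) :
    IsIntegral ℤ (LinearMap.trace ℂ M A) := by
  rw [Module.End.trace_eq_sum_roots_charpoly_of_splits (IsAlgClosed.splits _)]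
  refine IsIntegral.multiset_sum fun c hc => ?_
  have hc' := (Module.End.hasEigenvalue_iff_isRoot_charpoly A c).2 (Polynomial.isRoot_of_mem_roots hc)
  obtain ⟨v, hv⟩ := hc'.exists_hasEigenvector
  have h1 := hv.pow_apply (n + 1)
  rw [h, hv.apply_eq_smul] at h1
  have h2 : c = c ^ (n + 1) := smul_left_injective ℂ hv.2 h1
  by_cases h0 : c = 0
  · rw [h0]; exact isIntegral_zero
  · refine IsIntegral.of_pow hn ?_
    have : c ^ n = 1 := by
      rw [pow_succ] at h2
      exact mul_right_cancel₀ h0 (by rw [one_mul, ← h2])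
    rw [this]; exact isIntegral_one

variable {G : Type*} [Group G] [Finite G]

lemma isIntegral_average (ρ : Representation ℂ G M) {R : Type*} [Group R] [Fintype R]
    (j : R →* G) (x : G) (hx : ∀ t, j t * x = x * j t) :
    IsIntegral ℤ ((Fintype.card R : ℂ)⁻¹ * ∑ t, ρ.character (x * j t)) := by
  have : Invertible (Fintype.card R : ℂ) := invertibleOfNonzero (by simp)
  set P : Module.End ℂ M := (pullRep ρ j).averageMap with hPdef
  have hP : P = (Fintype.card R : ℂ)⁻¹ • ∑ t, ρ (j t) := by
    rw [hPdef]
    simp [GroupAlgebra.average, map_sum, pullRep]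
  have hPP : P * P = P := by
    have h := Representation.isProj_averageMap (pullRep ρ j)
    exact LinearMap.ext fun v => h.map_id _ (h.map_mem v)
  have hcomm : Commute (ρ x) P := by
    rw [hP]
    refine Commute.smul_right (Commute.sum_right _ _ _ fun t _ => ?_) _
    change ρ x * ρ (j t) = ρ (j t) * ρ x
    rw [← map_mul, ← map_mul, hx]
  have htr : (Fintype.card R : ℂ)⁻¹ * ∑ t, ρ.character (x * j t) =
      LinearMap.trace ℂ M (ρ x * P) := by
    rw [hP, mul_smul_comm, map_smul, smul_eq_mul, Finset.mul_sum Finset.univ (fun t => ρ (j t)), map_sum]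
    simp [Representation.character]
  rw [htr]
  refine isIntegral_trace _ (orderOf_pos x) ?_
  have hPn : ∀ n : ℕ, P ^ (n + 1) = P := fun n => by
    induction n with
    | zero => simp
    | succ n ih => rw [pow_succ, ih, hPP]
  rw [hcomm.mul_pow, hPn, ← map_pow, pow_succ, pow_orderOf_eq_one, one_mul]

lemma isIntegral_average_sq (ρ : Representation ℂ G M) {R : Type*} [Group R] [Fintype R]
    (j : R →* G) (x : G) (hx : ∀ t, j t * x = x * j t) :
    IsIntegral ℤ ((Fintype.card R : ℂ)⁻¹ * ∑ t, ρ.character (x * j t) ^ 2) := by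
  have := isIntegral_average (ρ.tprod ρ) j x hx
  simpa only [Representation.char_tensor, Pi.mul_apply, ← sq] using this

lemma isIntegral_average_mul_inv (ρ : Representation ℂ G M) {R : Type*} [Group R] [Fintype R]
    (j : R →* G) (x : G) (hx : ∀ t, j t * x = x * j t) :
    IsIntegral ℤ ((Fintype.card R : ℂ)⁻¹ *
      ∑ t, ρ.character (x * j t) * ρ.character (x * j t)⁻¹) := by
  have := isIntegral_average (ρ.tprod ρ.dual) j x hx
  simpa only [Representation.char_tensor, Pi.mul_apply, Representation.char_dual] using this

lemma isIntegral_char (ρ : Representation ℂ G M) (x : G) : IsIntegral ℤ (ρ.character x) := by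
  refine isIntegral_trace (ρ x) (orderOf_pos x) ?_
  rw [← map_pow, pow_succ, pow_orderOf_eq_one, one_mul]

end Integrality

section DimensionSum

variable {G : Type*} [Group G]

lemma irr_of_sum_char {M : Type*} [AddCommGroup M] [Module ℂ M] [FiniteDimensional ℂ M]
    [Fintype G] (ρ : Representation ℂ G M)
    (h : ∑ g, ρ.character g * ρ.character g⁻¹ = Fintype.card G) : Irr ρ := by
  have : Invertible (Nat.card G : ℂ) := invertibleOfNonzero (by simp)
  have hG : (Nat.card G : ℂ) ≠ 0 := by simp
  have hpos : (0 : ℝ) < Fintype.card G := by exact_mod_cast Fintype.card_pos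
  refine ⟨?_, fun p hp => ?_⟩
  · by_contra hcon
    push Not at hcon
    have h0 : ∀ g, ρ.character g = 0 := fun g => by
      have : ρ g = 0 := LinearMap.ext fun x => by simp [hcon x]
      simp [Representation.character, this]
    simp only [h0, mul_zero, Finset.sum_const_zero] at h
    rw [← Nat.cast_zero, Nat.cast_inj] at h
    exact Fintype.card_ne_zero h.symm
  · by_contra! hcon
    obtain ⟨q, hq, hc⟩ := exists_stable_compl ρ p hp
    have hq0 : q ≠ ⊥ := fun h0 => hcon.2 (by simpa [h0] using hc.sup_eq_top)
    have ex : ∀ r : Submodule ℂ M, r ≠ ⊥ → ∃ x : r, x ≠ 0 := fun r hr => by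
      obtain ⟨x, hx, hx0⟩ := (Submodule.ne_bot_iff _).1 hr
      exact ⟨⟨x, hx⟩, fun h => hx0 (congrArg Subtype.val h)⟩
    have h1 := card_le_sum_char_mul_inv (subRep ρ p hp) (ex p hcon.1)
    have h2 := card_le_sum_char_mul_inv (subRep ρ q hq) (ex q hq0)
    have h3 := Representation.card_inv_mul_sum_char_mul_char_eq_finrank
      (subRep ρ p hp) (subRep ρ q hq)
    have h4 := Representation.card_inv_mul_sum_char_mul_char_eq_finrank
      (subRep ρ q hq) (subRep ρ p hp)
    rw [inv_mul_eq_iff_eq_mul₀ hG, ← Nat.cast_mul] at h3 h4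
    simp only [char_add_of_isCompl ρ hp hq hc, add_mul, mul_add, Finset.sum_add_distrib] at h
    rw [h3, h4] at h
    have h5 := congrArg Complex.re h
    simp only [Complex.add_re, Complex.natCast_re] at h5
    have h6 : ∀ n : ℕ, (0 : ℝ) ≤ n := fun n => n.cast_nonneg
    have := h6 (Nat.card G * Module.finrank ℂ ((subRep ρ p hp).IntertwiningMap (subRep ρ q hq)))
    have := h6 (Nat.card G * Module.finrank ℂ ((subRep ρ q hq).IntertwiningMap (subRep ρ p hp)))
    linarith

/-- The left regular representation on functions. -/
def funRep (G : Type*) [Group G] : Representation ℂ G (G → ℂ) where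
  toFun g := LinearMap.funLeft ℂ ℂ (fun x => g⁻¹ * x)
  map_one' := by ext; simp [LinearMap.funLeft]
  map_mul' a b := by
    refine LinearMap.ext fun f => funext fun x => ?_
    simp [LinearMap.funLeft, mul_assoc]

lemma char_funRep (G : Type*) [Group G] [Fintype G] (g : G) :
    (funRep G).character g = if g = 1 then (Fintype.card G : ℂ) else 0 := by
  rw [Representation.character, LinearMap.trace_eq_matrix_trace ℂ (Pi.basisFun ℂ G), Matrix.trace]
  have : ∀ x : G, (LinearMap.toMatrix (Pi.basisFun ℂ G) (Pi.basisFun ℂ G) (funRep G g)).diag x =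
      if g = 1 then 1 else 0 := fun x => by
    rw [Matrix.diag_apply, LinearMap.toMatrix_apply]
    simp [funRep, LinearMap.funLeft, Pi.single_apply]
  rw [Finset.sum_congr rfl fun x _ => this x]
  split_ifs <;> simp

variable {G : Type} [Group G] [Fintype G]

lemma sum_finrank_eq_card_involutions (hG : Good G) (hreal : ∀ g : G, ∃ t, t * g * t⁻¹ = g⁻¹)
    {ι : Type} [Fintype ι] (R : ι → FDRep ℂ G) (hsimple : ∀ i, Simple (R i))
    (hdistinct : ∀ i j : ι, Nonempty (R i ≅ R j) → i = j)
    (hcomplete : ∀ ρ : FDRep ℂ G, Simple ρ → ∃ i, Nonempty (ρ ≅ R i)) :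
    ∑ i, Module.finrank ℂ (R i) = Fintype.card {g : G // g * g = 1} := by
  have hinv : Invertible (Nat.card G : ℂ) := invertibleOfNonzero (by simp)
  have hG0 : (Nat.card G : ℂ) ≠ 0 := by simp
  have horth : ∀ i j, ∑ g, (R i).character g * (R j).character g⁻¹ =
      if i = j then (Fintype.card G : ℂ) else 0 := fun i j => by
    have := hsimple i
    have := hsimple j
    have h := FDRep.char_orthonormal (R i) (R j)
    rw [inv_mul_eq_iff_eq_mul₀ hG0] at h
    rw [h]
    by_cases hij : i = j
    · subst hij; simp [Nonempty.intro (Iso.refl (R i))]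
    · simp [hij, mt (hdistinct i j) hij]
  have hdec := char_induction (H := G)
    (fun χ => ∃ m : ι → ℂ, χ = fun g => ∑ i, m i * (R i).character g)
    ⟨0, by ext; simp⟩
    (by
      rintro a b ⟨m, rfl⟩ ⟨m', rfl⟩
      exact ⟨m + m', by ext g; simp [add_mul, Finset.sum_add_distrib]⟩)
    (fun N _ _ _ σ hσ => by
      have h1 : Simple (FDRep.of σ) := by
        rw [FDRep.simple_iff_char_is_norm_one, Nat.card_eq_fintype_card]
        exact hσ.sum_char_mul_inv
      obtain ⟨i, ⟨e⟩⟩ := hcomplete _ h1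
      refine ⟨Pi.single i 1, funext fun g => ?_⟩
      have := congrFun (FDRep.char_iso e) g
      simp only [Pi.single_apply, ite_mul, one_mul, zero_mul, Finset.sum_ite_eq',
        Finset.mem_univ, if_true]
      exact this) (G → ℂ) (funRep G)
  obtain ⟨m, hm⟩ := hdec
  have hmi : ∀ i, m i = Module.finrank ℂ (R i) := fun i => by
    have h1 : ∑ g, (funRep G).character g * (R i).character g⁻¹ =
        Fintype.card G * Module.finrank ℂ (R i) := by
      simp only [char_funRep, ite_mul, zero_mul, Finset.sum_ite_eq', Finset.mem_univ, if_true,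
        inv_one, FDRep.char_one]
    rw [hm] at h1
    simp only [Finset.sum_mul] at h1
    rw [Finset.sum_comm] at h1
    simp only [mul_assoc, ← Finset.mul_sum, horth, mul_ite, mul_zero, Finset.sum_ite_eq',
      Finset.mem_univ, if_true] at h1
    rw [mul_comm] at h1
    exact mul_left_cancel₀ (by simp) h1
  have hfs : ∀ i, ∑ g, (R i).character (g * g) = Fintype.card G := fun i => by
    have h0 := (FDRep.simple_iff_char_is_norm_one (R i)).1 (hsimple i)
    rw [Nat.card_eq_fintype_card] at h0
    refine hG.sum_sq_eq_card (irr_of_sum_char (R i).ρ h0) fun g => ?_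
    obtain ⟨t, ht⟩ := hreal g
    rw [← ht, Representation.char_conj]
  have key : ∑ g : G, (funRep G).character (g * g) =
      Fintype.card G * ∑ i, (Module.finrank ℂ (R i) : ℂ) := by
    rw [hm]
    simp only []
    rw [Finset.sum_comm]
    simp only [← Finset.mul_sum, hfs, hmi, ← Finset.sum_mul]
    ring
  simp only [char_funRep] at key
  rw [← Finset.sum_filter, Finset.sum_const, nsmul_eq_mul, mul_comm] at key
  have := mul_left_cancel₀ (by simp) key
  rw [Fintype.card_subtype]
  exact_mod_cast this.symm

end DimensionSum

section TwoGroup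

variable {T : Type*} [Group T] [Finite T]

/-- In a finite `p`-group a nontrivial normal subgroup contains a central element of order `p`. -/
lemma exists_central_of_normal {p : ℕ} [hp : Fact p.Prime] (hT : IsPGroup p T) (D : Subgroup T)
    [D.Normal] (hD : D ≠ ⊥) : ∃ g ∈ D, g ≠ 1 ∧ g ^ p = 1 ∧ ∀ t, t * g * t⁻¹ = g := by
  have hdvd : p ∣ Nat.card D := by
    obtain ⟨n, hn⟩ := (hT.to_subgroup D).exists_card_eq
    have hn0 : n ≠ 0 := by
      rintro rfl
      exact hD (Subgroup.card_eq_one.1 (by simpa using hn))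
    rw [hn]; exact dvd_pow_self _ hn0
  have hC : IsPGroup p (ConjAct T) := hT
  have h1 : (1 : D) ∈ MulAction.fixedPoints (ConjAct T) D := fun t => smul_one t
  obtain ⟨b, hb, hb1⟩ := hC.exists_fixed_point_of_prime_dvd_card_of_fixed_point D hdvd h1
  have hbc : ∀ t, t * (b : T) * t⁻¹ = b := fun t => congrArg Subtype.val (hb (ConjAct.toConjAct t))
  have hb1' : (b : T) ≠ 1 := fun h => hb1 (Subtype.ext h.symm)
  obtain ⟨k, hk⟩ := hT (b : T)
  have hk' : ∃ k, (b : T) ^ p ^ k = 1 := ⟨k, hk⟩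
  obtain ⟨m, hm⟩ : ∃ m, Nat.find hk' = m + 1 := Nat.exists_eq_succ_of_ne_zero fun h => by
    have := Nat.find_spec hk'
    rw [h] at this
    exact hb1' (by simpa using this)
  refine ⟨(b : T) ^ p ^ m, D.pow_mem b.2 _, Nat.find_min hk' (by omega), ?_, fun t => ?_⟩
  · rw [← pow_mul, ← pow_succ, ← hm]; exact Nat.find_spec hk'
  · rw [← conj_pow, hbc]

lemma card_le_two_mul_card {D S : Subgroup T}
    (h : ∀ a ∈ S, ∀ b ∈ S, a ∉ D → b ∉ D → a * b ∈ D) : Nat.card S ≤ 2 * Nat.card D := by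
  by_cases hS : S ≤ D
  · have := Nat.card_mono (Set.toFinite (D : Set T)) hS
    change Nat.card S ≤ Nat.card D at this
    omega
  obtain ⟨a, ha, haD⟩ := SetLike.not_le_iff_exists.1 hS
  let f : S → Bool × D := fun s => if hs : (s : T) ∈ D then (true, ⟨s, hs⟩) else
    (false, ⟨a * s, h a ha s s.2 haD hs⟩)
  have hf : Function.Injective f := by
    intro s s' hss
    simp only [f] at hss
    split_ifs at hss with h1 h2 h2
    · simpa using hss
    · simp at hss
    · simp at hss
    · simpa using hss
  have := Nat.card_le_card_of_injective f hf
  simpa [Nat.card_prod] using this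

lemma exists_cyclic_of_involutions (hT : IsPGroup 2 T) (T0 : Subgroup T) [T0.Normal] (z : T)
    (hz : z ∈ T0) (hz1 : z ≠ 1) (hzz : z * z = 1) (hzc : ∀ t, t * z * t⁻¹ = z)
    (h : ∀ e ∈ T0, e * e = 1 → (∀ t, t * e * t⁻¹ = e ∨ t * e * t⁻¹ = z * e) → e = 1 ∨ e = z) :
    ∃ c ∈ T0, Nat.card T0 ≤ 2 * orderOf c := by
  have hfin : (Set.univ.toFinite.toFinset.filter
      fun c : T => c ∈ T0 ∧ ∀ t, t * c * t⁻¹ ∈ Subgroup.zpowers c).Nonempty :=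
    ⟨z, by simp [hz, hzc, Subgroup.mem_zpowers]⟩
  obtain ⟨c, hc, hmax⟩ := Finset.exists_max_image _ orderOf hfin
  simp only [Finset.mem_filter, Set.Finite.mem_toFinset, Set.mem_univ,
    true_and] at hc hmax
  obtain ⟨hc0, hcn⟩ := hc
  have hord : 2 ≤ orderOf c := by
    refine le_trans (le_of_eq ?_) (hmax z ⟨hz, fun t => by rw [hzc]; exact Subgroup.mem_zpowers z⟩)
    exact (orderOf_eq_prime (by rw [sq, hzz]) hz1).symm
  obtain ⟨k, hk⟩ : ∃ k, orderOf c = 2 ^ k := (IsPGroup.iff_orderOf.1 hT) c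
  obtain ⟨k, rfl⟩ : ∃ l, k = l + 1 := Nat.exists_eq_succ_of_ne_zero (by rintro rfl; omega)
  have hone : ∀ s : ℤ, c ^ s = 1 ↔ (2 : ℤ) ^ (k + 1) ∣ s := fun s => by
    rw [← orderOf_dvd_iff_zpow_eq_one, hk]; norm_cast
  have hodd : ∀ a : ℤ, Odd a → ∃ b : ℤ, c ^ (a * b) = c := fun a ha => by
    have : IsCoprime ((2 : ℤ) ^ (k + 1)) a :=
      IsCoprime.pow_left (Int.isCoprime_iff_gcd_eq_one.2 (by
        obtain ⟨n, rfl⟩ := ha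
        simp))
    obtain ⟨u, v, huv⟩ := this
    refine ⟨v, ?_⟩
    have h1 : c ^ (a * v - 1) = 1 := (hone _).2 ⟨-u, by linear_combination huv⟩
    rw [_root_.zpow_sub_one, mul_inv_eq_one] at h1
    exact h1
  choose v hv using fun t => Subgroup.mem_zpowers_iff.1 (hcn t)
  set w := c ^ ((2 : ℤ) ^ k) with hw
  have hw1 : w ≠ 1 := by
    rw [hw, Ne, hone, pow_succ]
    rintro ⟨r, hr⟩
    have h2 : (2 : ℤ) ^ k ≠ 0 := by positivity
    have : (1 : ℤ) = 2 * r := mul_left_cancel₀ h2 (by linear_combination hr)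
    omega
  have hww : w * w = 1 := by
    rw [hw, ← _root_.zpow_add, hone]; exact ⟨1, by ring⟩
  have hwpow : ∀ s : ℤ, w ^ s = 1 ∨ w ^ s = w := fun s => by
    have hw2 : w ^ (2 : ℤ) = 1 := by rw [zpow_two, hww]
    obtain ⟨r, rfl | rfl⟩ := Int.even_or_odd' s
    · left; rw [_root_.zpow_mul, hw2, _root_.one_zpow]
    · right; rw [_root_.zpow_add_one, _root_.zpow_mul, hw2, _root_.one_zpow, one_mul]
  have hinvol : ∀ s : ℤ, c ^ (2 * s) = 1 → c ^ s = 1 ∨ c ^ s = w := fun s hs => by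
    rw [hone, pow_succ] at hs
    obtain ⟨r, hr⟩ := hs
    have : s = 2 ^ k * r := by linarith
    rw [this, _root_.zpow_mul]; exact hwpow r
  have hconj : ∀ t (s : ℤ), t * c ^ s * t⁻¹ = c ^ (v t * s) := fun t s => by
    rw [← conj_zpow, ← hv, ← _root_.zpow_mul]
  have hwz : w = z := by
    refine (h w (T0.zpow_mem hc0 _) hww fun t => Or.inl ?_).resolve_left hw1
    have h1 : t * w * t⁻¹ = w ^ v t := by rw [hw, hconj, mul_comm, _root_.zpow_mul]
    rw [h1]
    refine (hwpow _).resolve_left fun h2 => hw1 ?_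
    rw [h2] at h1
    calc w = t⁻¹ * (t * w * t⁻¹) * t := by group
      _ = 1 := by rw [h1]; group
  refine ⟨c, hc0, ?_⟩
  have hP : (Subgroup.zpowers (c ^ (4 : ℤ))).Normal := ⟨fun n hn t => by
    obtain ⟨s, rfl⟩ := Subgroup.mem_zpowers_iff.1 hn
    rw [← _root_.zpow_mul, hconj, mul_left_comm, _root_.zpow_mul]
    exact Subgroup.zpow_mem _ (Subgroup.mem_zpowers _) _⟩
  have hC : (Subgroup.zpowers c).Normal := ⟨fun n hn t => by
    obtain ⟨s, rfl⟩ := Subgroup.mem_zpowers_iff.1 hn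
    rw [hconj]
    exact Subgroup.zpow_mem _ (Subgroup.mem_zpowers _) _⟩
  let π := QuotientGroup.mk' (Subgroup.zpowers (c ^ (4 : ℤ)))
  let D : Subgroup T := T0 ⊓
    (Subgroup.centralizer ((Subgroup.zpowers c).map π : Set _)).comap π
  have hCπ : ((Subgroup.zpowers c).map π).Normal := hC.map _ (QuotientGroup.mk'_surjective _)
  have hDn : D.Normal := inferInstance
  have hπ : ∀ a b : T, π a = π b ↔ ∃ s : ℤ, b = a * c ^ (4 * s) := fun a b => by
    rw [QuotientGroup.mk'_eq_mk']
    constructor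
    · rintro ⟨y, hy, rfl⟩
      obtain ⟨s, rfl⟩ := Subgroup.mem_zpowers_iff.1 hy
      exact ⟨s, by rw [_root_.zpow_mul]⟩
    · rintro ⟨s, rfl⟩
      exact ⟨_, Subgroup.zpow_mem _ (Subgroup.mem_zpowers (c ^ (4 : ℤ))) s, by rw [_root_.zpow_mul]⟩
  have hD : ∀ g, g ∈ D ↔ g ∈ T0 ∧ π (g * c * g⁻¹) = π c := fun g => by
    simp only [D, Subgroup.mem_inf, Subgroup.mem_comap, Subgroup.mem_centralizer_iff]
    refine and_congr_right fun _ => ⟨fun h1 => ?_, fun h1 => ?_⟩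
    · have := h1 (π c) ⟨c, Subgroup.mem_zpowers c, rfl⟩
      rw [map_mul, map_mul, map_inv, ← this]; group
    · rintro _ ⟨y, hy, rfl⟩
      obtain ⟨s, rfl⟩ := Subgroup.mem_zpowers_iff.1 hy
      have h2 : π (g * c ^ s * g⁻¹) = π (c ^ s) := by
        rw [← conj_zpow, map_zpow, h1, map_zpow]
      rw [map_mul, map_mul, map_inv, mul_inv_eq_iff_eq_mul] at h2
      exact h2.symm
  have hvodd : ∀ t, Odd (v t) := fun t => by
    by_contra hcon
    obtain ⟨r, hr⟩ := Int.not_odd_iff_even.1 hcon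
    have h1 : c ^ (v t * 2 ^ k) = 1 := (hone _).2 ⟨r, by rw [hr]; ring⟩
    rw [← hconj] at h1
    exact hw1 (by
      calc w = t⁻¹ * (t * w * t⁻¹) * t := by group
        _ = 1 := by rw [hw, h1]; group)
  have hD2 : Nat.card T0 ≤ 2 * Nat.card D := by
    refine card_le_two_mul_card fun a ha b hb haD hbD => ?_
    have hneg : ∀ g ∈ T0, g ∉ D → π (g * c * g⁻¹) = π c⁻¹ := fun g hg hgD => by
      rw [hD, ← hv] at hgD
      obtain ⟨n, hn⟩ := hvodd g
      obtain ⟨r, hr | hr⟩ := Int.even_or_odd' n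
      · refine absurd ⟨hg, ?_⟩ hgD
        rw [eq_comm, hπ]
        exact ⟨r, by rw [hn, hr, ← _root_.zpow_one_add]; congr 1; ring⟩
      · rw [← hv, eq_comm, hπ]
        refine ⟨r + 1, ?_⟩
        rw [← _root_.zpow_neg_one, ← _root_.zpow_add]
        congr 1
        rw [hn, hr]; ring
    refine (hD _).2 ⟨mul_mem ha hb, ?_⟩
    have h1 : a * b * c * (a * b)⁻¹ = a * (b * c * b⁻¹) * a⁻¹ := by group
    rw [h1, map_mul, map_mul, hneg b hb hbD, ← map_mul, ← map_mul, ← inv_inv (a * c⁻¹ * a⁻¹),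
      map_inv, show (a * c⁻¹ * a⁻¹)⁻¹ = a * c * a⁻¹ by group, hneg a ha haD, map_inv, inv_inv]
  have hCD : Subgroup.zpowers c ≤ D := by
    rw [Subgroup.zpowers_le, hD]
    exact ⟨hc0, by group⟩
  by_cases hDC : D ≤ Subgroup.zpowers c
  · rw [le_antisymm hDC hCD, Nat.card_zpowers] at hD2
    exact hD2
  exfalso
  let κ := QuotientGroup.mk' (Subgroup.zpowers c)
  have hκ : ∀ a b : T, κ a = κ b ↔ ∃ s : ℤ, b = a * c ^ s := fun a b => by
    rw [QuotientGroup.mk'_eq_mk']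
    constructor
    · rintro ⟨y, hy, rfl⟩
      obtain ⟨s, rfl⟩ := Subgroup.mem_zpowers_iff.1 hy
      exact ⟨s, rfl⟩
    · rintro ⟨s, rfl⟩
      exact ⟨_, Subgroup.zpow_mem _ (Subgroup.mem_zpowers c) s, rfl⟩
  have hDκ : (D.map κ).Normal := hDn.map _ (QuotientGroup.mk'_surjective _)
  have hDκ0 : D.map κ ≠ ⊥ := fun h0 => hDC fun g hg => by
    have : κ g ∈ D.map κ := ⟨g, hg, rfl⟩
    rw [h0, Subgroup.mem_bot] at this
    exact (QuotientGroup.eq_one_iff g).1 this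
  obtain ⟨_, ⟨g, hg, rfl⟩, hg1, hg2, hgt⟩ := exists_central_of_normal
    (hT.to_quotient (Subgroup.zpowers c)) (D.map κ) hDκ0
  have hgC : g ∉ Subgroup.zpowers c := fun h0 => hg1 ((QuotientGroup.eq_one_iff g).2 h0)
  obtain ⟨hg0, hgc⟩ := (hD g).1 hg
  obtain ⟨i, hi⟩ := (hπ _ _).1 hgc.symm
  obtain ⟨j, hj⟩ : ∃ j : ℤ, g * g = c ^ j := by
    rw [← map_pow, ← map_one κ, eq_comm, hκ] at hg2
    simpa [sq] using hg2
  have hgt' : ∀ t, ∃ s : ℤ, t * g * t⁻¹ = g * c ^ s := fun t => by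
    have := hgt (κ t)
    rwa [← map_mul, ← map_inv, ← map_mul, eq_comm, hκ] at this
  have hgs : ∀ s : ℤ, g * c ^ s * g⁻¹ = c ^ ((1 + 4 * i) * s) := fun s => by
    rw [← conj_zpow, hi, ← _root_.zpow_one_add, ← _root_.zpow_mul]
  obtain ⟨a, rfl | rfl⟩ := Int.even_or_odd' j
  · obtain ⟨b, hb⟩ := hodd (1 + 2 * i) ⟨i, by ring⟩
    set l := -(b * a) with hl
    have hsq : ∀ s : ℤ, g * c ^ s * (g * c ^ s) = c ^ (2 * (s * (1 + 2 * i) + a)) := fun s => by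
      calc _ = g * c ^ s * g⁻¹ * (g * g) * c ^ s := by group
        _ = _ := by rw [hgs, hj, ← _root_.zpow_add, ← _root_.zpow_add]; congr 1; ring
    have hpow : ∀ s : ℤ, c ^ ((1 + 2 * i) * b * s) = c ^ s := fun s => by
      rw [_root_.zpow_mul, hb]
    have he : c ^ (l * (1 + 2 * i) + a) = 1 := by
      rw [hl, show -(b * a) * (1 + 2 * i) + a = -((1 + 2 * i) * b * a) + a by ring, _root_.zpow_add,
        _root_.zpow_neg, hpow]
      group
    have hee : g * c ^ l * (g * c ^ l) = 1 := by
      rw [hsq, mul_comm, _root_.zpow_mul, he, _root_.one_zpow]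
    have heC : ∀ s : ℤ, g * c ^ l ≠ c ^ s := fun s hs => hgC ⟨s - l, by
      change c ^ (s - l) = g
      rw [_root_.zpow_sub, ← hs]; group⟩
    refine (h (g * c ^ l) (mul_mem hg0 (T0.zpow_mem hc0 _)) hee fun t => ?_).elim
      (fun h0 => heC 0 (by simpa using h0)) fun h0 => heC (2 ^ k) (by rw [h0, ← hwz])
    obtain ⟨s, hs⟩ := hgt' t
    have ht : t * (g * c ^ l) * t⁻¹ = g * c ^ (s + v t * l) := by
      calc _ = t * g * t⁻¹ * (t * c ^ l * t⁻¹) := by group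
        _ = _ := by rw [hs, hconj, mul_assoc, ← _root_.zpow_add]
    set s' := s + v t * l
    have h1 : c ^ (2 * (s' * (1 + 2 * i) + a)) = 1 := by
      rw [← hsq, ← ht]
      calc _ = t * (g * c ^ l * (g * c ^ l)) * t⁻¹ := by group
        _ = 1 := by rw [hee]; group
    have h2 : c ^ (2 * (s' - l)) = 1 := by
      rw [← hpow]
      have : (1 + 2 * i) * b * (2 * (s' - l)) = (2 * (s' * (1 + 2 * i) + a) +
        (l * (1 + 2 * i) + a) * (-2)) * b := by ring
      rw [this, _root_.zpow_mul, _root_.zpow_add, h1, _root_.zpow_mul, he]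
      simp
    have h3 : g * c ^ s' = g * c ^ l * c ^ (s' - l) := by
      rw [mul_assoc, ← _root_.zpow_add]; congr 2; ring
    rw [ht, h3]
    rcases hinvol _ h2 with h4 | h4
    · left; rw [h4, mul_one]
    · right; rw [h4, hwz]
      have := hzc (g * c ^ l)
      rwa [mul_inv_eq_iff_eq_mul] at this
  · obtain ⟨b, hb⟩ := hodd (2 * a + 1) ⟨a, rfl⟩
    have hcg : c = g ^ (2 * b) := by
      rw [_root_.zpow_mul, zpow_two, hj, ← _root_.zpow_mul, hb]
    have hle : Subgroup.zpowers c ≤ Subgroup.zpowers g := by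
      rw [Subgroup.zpowers_le, hcg]
      exact Subgroup.zpow_mem _ (Subgroup.mem_zpowers g) _
    have h1 := hmax g ⟨hg0, fun t => by
      obtain ⟨s, hs⟩ := hgt' t
      rw [hs]
      exact mul_mem (Subgroup.mem_zpowers g) (hle (Subgroup.zpow_mem _ (Subgroup.mem_zpowers c) _))⟩
    rw [← Nat.card_zpowers, ← Nat.card_zpowers] at h1
    have h2 := Subgroup.eq_of_le_of_card_ge hle h1
    exact hgC (h2 ▸ Subgroup.mem_zpowers g)

end TwoGroup

section Parity

lemma sum_mem_of_orbit {Γ X : Type*} [Group Γ] [Fintype X] [MulAction Γ X] (I : AddSubgroup ℂ)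
    (f : X → ℂ) (hf : ∀ (g : Γ) x, f (g • x) = f x)
    (h : ∀ x, ((MulAction.orbit Γ x).ncard : ℂ) * f x ∈ I) : ∑ x, f x ∈ I := by
  rw [← Finset.sum_fiberwise Finset.univ (Quotient.mk (MulAction.orbitRel Γ X)) f]
  refine AddSubgroup.sum_mem _ fun ω _ => ?_
  induction ω using Quotient.inductionOn with
  | _ x =>
    have h1 : ∀ y, Quotient.mk (MulAction.orbitRel Γ X) y = Quotient.mk _ x ↔
        y ∈ MulAction.orbit Γ x := fun y => by
      rw [Quotient.eq]; rfl
    have h2 : ∑ y with Quotient.mk (MulAction.orbitRel Γ X) y = Quotient.mk _ x, f y =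
        ∑ y ∈ (MulAction.orbit Γ x).toFinset, f x := by
      refine Finset.sum_congr (by ext y; simp [h1]) fun y hy => ?_
      obtain ⟨g, rfl⟩ := Set.mem_toFinset.1 hy
      exact hf g x
    rw [h2, Finset.sum_const, ← Set.ncard_eq_toFinset_card', nsmul_eq_mul]
    exact h x

/-- The combinations of `a` and `b` with algebraic integer coefficients. -/
def intSpan (a b : ℂ) : AddSubgroup ℂ where
  carrier := {z | ∃ u v, IsIntegral ℤ u ∧ IsIntegral ℤ v ∧ z = a * u + b * v}
  zero_mem' := ⟨0, 0, isIntegral_zero, isIntegral_zero, by simp⟩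
  add_mem' := by
    rintro _ _ ⟨u, v, hu, hv, rfl⟩ ⟨u', v', hu', hv', rfl⟩
    exact ⟨u + u', v + v', hu.add hu', hv.add hv', by ring⟩
  neg_mem' := by
    rintro _ ⟨u, v, hu, hv, rfl⟩
    exact ⟨-u, -v, hu.neg, hv.neg, by ring⟩

variable {G : Type*} [Group G]

/-- The extended centralizer: elements fixing or inverting `x` by conjugation. -/
def extCentralizer (x : G) : Subgroup G where
  carrier := {g | g * x * g⁻¹ = x ∨ g * x * g⁻¹ = x⁻¹}
  one_mem' := Or.inl (by group)
  mul_mem' := by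
    intro a b ha hb
    have e : a * b * x * (a * b)⁻¹ = a * (b * x * b⁻¹) * a⁻¹ := by group
    have e' : a * x⁻¹ * a⁻¹ = (a * x * a⁻¹)⁻¹ := by group
    rcases ha with ha | ha <;> rcases hb with hb | hb <;>
      simp only [Set.mem_ofPred_eq, e, hb, e', ha, inv_inv, true_or, or_true]
  inv_mem' := by
    intro a ha
    have e : ∀ y, a * x * a⁻¹ = y → a⁻¹ * y * a⁻¹⁻¹ = x := fun y h => by rw [← h]; group
    rcases ha with ha | ha
    · exact Or.inl (e _ ha)
    · refine Or.inr ?_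
      calc a⁻¹ * x * a⁻¹⁻¹ = (a⁻¹ * x⁻¹ * a⁻¹⁻¹)⁻¹ := by group
        _ = x⁻¹ := by rw [e _ ha]

lemma mem_extCentralizer {x g : G} :
    g ∈ extCentralizer x ↔ g * x * g⁻¹ = x ∨ g * x * g⁻¹ = x⁻¹ := Iff.rfl

lemma mem_centralizer_iff_conj {x g : G} : g ∈ Subgroup.centralizer {x} ↔ g * x * g⁻¹ = x := by
  rw [Subgroup.mem_centralizer_singleton_iff, mul_inv_eq_iff_eq_mul]

lemma conj_mem_centralizer {x s g : G} (hs : s ∈ extCentralizer x)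
    (hg : g ∈ Subgroup.centralizer {x}) : s * g * s⁻¹ ∈ Subgroup.centralizer {x} := by
  rw [mem_centralizer_iff_conj] at hg ⊢
  have e : s * g * s⁻¹ * x * (s * g * s⁻¹)⁻¹ = s * (g * (s⁻¹ * x * s⁻¹⁻¹) * g⁻¹) * s⁻¹ := by group
  have e' : g * (s⁻¹ * x * s⁻¹⁻¹) * g⁻¹ = s⁻¹ * x * s⁻¹⁻¹ := by
    rcases (extCentralizer x).inv_mem hs with h | h
    · rw [h, hg]
    · rw [h, show g * x⁻¹ * g⁻¹ = (g * x * g⁻¹)⁻¹ by group, hg]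
  rw [e, e']; group

lemma card_inf_centralizer {x s : G} {S : Subgroup G} (hS : S ≤ extCentralizer x) (hs : s ∈ S)
    (hsx : s * x * s⁻¹ = x⁻¹) :
    Nat.card S = (if x = x⁻¹ then 1 else 2) * Nat.card (S ⊓ Subgroup.centralizer {x} : Subgroup G) := by
  split_ifs with hx
  · rw [one_mul, inf_of_le_left]
    intro g hg
    rw [mem_centralizer_iff_conj]
    rcases hS hg with h | h
    · exact h
    · rw [h, ← hx]
  · have hi : ((Subgroup.centralizer {x}).subgroupOf S).index = 2 := by
      rw [Subgroup.index_eq_two_iff]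
      refine ⟨⟨s, hs⟩, fun b => ?_⟩
      simp only [Subgroup.mem_subgroupOf, Subgroup.coe_mul, mem_centralizer_iff_conj]
      have e : (b : G) * s * x * ((b : G) * s)⁻¹ = ((b : G) * x * (b : G)⁻¹)⁻¹ := by
        calc _ = (b : G) * (s * x * s⁻¹) * (b : G)⁻¹ := by group
          _ = _ := by rw [hsx]; group
      rw [e]
      rcases hS b.2 with h | h
      · rw [h]
        exact Or.inr ⟨rfl, fun h' => hx h'.symm⟩
      · rw [h, inv_inv]
        exact Or.inl ⟨rfl, fun h' => hx h'.symm⟩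
    have h1 := Subgroup.index_mul_card ((Subgroup.centralizer {x}).subgroupOf S)
    rw [hi] at h1
    rw [← h1, ← Subgroup.inf_subgroupOf_left,
      Nat.card_congr (Subgroup.subgroupOfEquivOfLe inf_le_left).toEquiv]

variable {M : Type*} [AddCommGroup M] [Module ℂ M] [FiniteDimensional ℂ M]

lemma card_mul_sum_stabilizer [Fintype G] (ρ : Representation ℂ G M) {x : G} (hinv : ∃ t, t * x * t⁻¹ = x⁻¹)
    (S : Subgroup G) (hS : S ≤ extCentralizer x)
    (hsplit : Splits ρ.character (Subgroup.zpowers x ⊔ S)) :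
    ∃ a, IsIntegral ℤ a ∧ (Nat.card (extCentralizer x) : ℂ) *
      ∑ t : (S ⊓ Subgroup.centralizer {x} : Subgroup G), ρ.character (x * t) ^ 2 =
      Nat.card S * (2 * Nat.card (Subgroup.centralizer {x}) * a) := by
  obtain ⟨t₀, ht₀⟩ := hinv
  have hcard := card_inf_centralizer le_rfl (show t₀ ∈ extCentralizer x from Or.inr ht₀) ht₀
  have hle : Subgroup.centralizer {x} ≤ extCentralizer x := fun g hg =>
    Or.inl (mem_centralizer_iff_conj.1 hg)
  rw [inf_of_le_right hle] at hcard
  set R := S ⊓ Subgroup.centralizer {x}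
  have hRx : ∀ t : R, (t : G) * x = x * t := fun t =>
    Subgroup.mem_centralizer_singleton_iff.1 t.2.2
  have hR0 : (Fintype.card R : ℂ) ≠ 0 := by simp
  by_cases hs : ∃ s ∈ S, s * x * s⁻¹ = x⁻¹
  · obtain ⟨s, hsS, hsx⟩ := hs
    have hcS := card_inf_centralizer hS hsS hsx
    obtain ⟨N, _, _, _, φ, hφ⟩ := hsplit
    let H := Subgroup.zpowers x ⊔ S
    let y : H := ⟨x, (le_sup_left : _ ≤ H) (Subgroup.mem_zpowers x)⟩
    let j : R →* H := Subgroup.inclusion (inf_le_left.trans le_sup_right)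
    let s' : H := ⟨s, (le_sup_right : _ ≤ H) hsS⟩
    have hj : ∀ t, j t * y = y * j t := fun t => Subtype.ext (hRx t)
    have h1 := isIntegral_average_mul_inv φ j y hj
    have h2 := isIntegral_average_sq φ j y hj
    refine ⟨_, h1.add h2, ?_⟩
    have h3 : ∀ t : R, ρ.character (x * t) ^ 2 =
        2 * (φ.character (y * j t) * φ.character (y * j t)⁻¹) + φ.character (y * j t) ^ 2 +
          φ.character (y * j t)⁻¹ ^ 2 := fun t => by
      have := hφ (y * j t)
      rw [show ((y * j t : H) : G) = x * t from rfl] at this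
      rw [this]; ring
    have hsR : ∀ s ∈ S, ∀ t : R, s * (t : G)⁻¹ * s⁻¹ ∈ R := fun s hs t =>
      ⟨S.mul_mem (S.mul_mem hs (S.inv_mem t.2.1)) (S.inv_mem hs),
        conj_mem_centralizer (hS hs) (Subgroup.inv_mem _ t.2.2)⟩
    let σ : R ≃ R :=
      { toFun := fun t => ⟨s * (t : G)⁻¹ * s⁻¹, hsR s hsS t⟩
        invFun := fun t => ⟨s⁻¹ * (t : G)⁻¹ * s⁻¹⁻¹, hsR _ (S.inv_mem hsS) t⟩
        left_inv := fun t => Subtype.ext (by simp only; group)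
        right_inv := fun t => Subtype.ext (by simp only; group) }
    have h4 : ∑ t : R, φ.character (y * j t)⁻¹ ^ 2 = ∑ t : R, φ.character (y * j t) ^ 2 := by
      refine Fintype.sum_equiv σ _ _ fun t => ?_
      rw [← Representation.char_conj φ _ s']
      congr 2
      apply Subtype.ext
      change s * (x * (t : G))⁻¹ * s⁻¹ = x * (s * (t : G)⁻¹ * s⁻¹)
      rw [← hRx t]
      calc s * ((t : G) * x)⁻¹ * s⁻¹ = (s * x * s⁻¹)⁻¹ * (s * (t : G)⁻¹ * s⁻¹) := by group
        _ = _ := by rw [hsx, inv_inv]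
    simp only [h3, Finset.sum_add_distrib, h4, ← Finset.mul_sum]
    rw [hcard, hcS, Nat.card_eq_fintype_card (α := R)]
    push_cast
    field_simp
    ring
  · push Not at hs
    have hSR : S = R := by
      refine (inf_of_le_left fun g hg => ?_).symm
      exact mem_centralizer_iff_conj.2 ((hS hg).resolve_right (hs g hg))
    have hx : x ≠ x⁻¹ := fun h => hs 1 S.one_mem (by rw [← h]; group)
    rw [if_neg hx] at hcard
    refine ⟨_, isIntegral_average_sq ρ R.subtype x hRx, ?_⟩
    have hc : Nat.card S = Fintype.card R := by
      rw [← Nat.card_eq_fintype_card]; exact congrArg (fun H : Subgroup G => Nat.card H) hSR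
    rw [hcard, hc]
    push_cast
    field_simp
    rfl

lemma exists_pow_eq_one_of_smul_eq {Γ : Type*} [Group Γ] {p : ℕ} {T : Subgroup Γ}
    (hT : IsPGroup p T) {t : Γ} {y : Γ ⧸ T} (h : t • y = y) : ∃ k, t ^ p ^ k = 1 := by
  induction y using QuotientGroup.induction_on with
  | H g =>
    rw [MulAction.Quotient.smul_mk, QuotientGroup.eq] at h
    have h' : g⁻¹ * t * g ∈ T := by
      have := T.inv_mem h
      simpa [mul_assoc] using this
    obtain ⟨k, hk⟩ := hT ⟨_, h'⟩
    refine ⟨k, ?_⟩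
    have hk' : (g⁻¹ * t * g) ^ p ^ k = 1 := congrArg Subtype.val hk
    have h2 := conj_pow (i := p ^ k) (a := g⁻¹) (b := t)
    rw [inv_inv, hk'] at h2
    calc t ^ p ^ k = g * (g⁻¹ * t ^ p ^ k * g) * g⁻¹ := by group
      _ = 1 := by rw [← h2]; group

lemma odd_card_fixed {Γ : Type*} [Group Γ] [Finite Γ] (T : Sylow 2 Γ) {t : Γ} {k : ℕ}
    (ht : t ^ 2 ^ k = 1) : Odd (Nat.card {y : Γ ⧸ (T : Subgroup Γ) // t • y = y}) := by
  have hp : IsPGroup 2 (Subgroup.zpowers t) := by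
    rintro ⟨_, i, rfl⟩
    refine ⟨k, Subtype.ext ?_⟩
    change (t ^ i) ^ 2 ^ k = 1
    rw [← zpow_natCast, _root_.zpow_comm, zpow_natCast, ht, _root_.one_zpow]
  have h1 := hp.card_modEq_card_fixedPoints (Γ ⧸ (T : Subgroup Γ))
  have h2 : Odd (Nat.card (Γ ⧸ (T : Subgroup Γ))) :=
    Nat.not_even_iff_odd.1 fun h => T.not_dvd_index h.two_dvd
  have h3 : Nat.card (MulAction.fixedPoints (Subgroup.zpowers t) (Γ ⧸ (T : Subgroup Γ))) =
      Nat.card {y : Γ ⧸ (T : Subgroup Γ) // t • y = y} := by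
    refine Nat.card_congr (Equiv.subtypeEquivRight fun y => ?_)
    refine ⟨fun h => h ⟨t, Subgroup.mem_zpowers t⟩, fun h => ?_⟩
    rintro ⟨s, hs⟩
    have : Subgroup.zpowers t ≤ MulAction.stabilizer Γ y := by
      rw [Subgroup.zpowers_le]; exact h
    exact this hs
  rw [← h3]
  rw [Nat.odd_iff] at h2 ⊢
  unfold Nat.ModEq at h1
  omega

lemma exists_pow_totient {n L : ℕ} (hn : Odd n) :
    ∃ m : ℕ, n ^ Nat.totient (2 ^ L) = 1 + 2 ^ L * m := by
  have h := Nat.ModEq.pow_totient (Nat.Coprime.pow_right L (Nat.coprime_two_right.2 hn))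
  have h1 : 1 ≤ n ^ Nat.totient (2 ^ L) := Nat.one_le_pow _ _ hn.pos
  obtain ⟨m, hm⟩ := (Nat.modEq_iff_dvd' h1).1 h.symm
  exact ⟨m, by omega⟩

/-- The sum of the squares of `χ` over the elements with odd part `x`. -/
def blockSum [Fintype G] (χ : G → ℂ) (x : G) : ℂ :=
  ∑ t, if t * x = x * t ∧ ∃ k, t ^ 2 ^ k = 1 then χ (x * t) ^ 2 else 0

set_option maxHeartbeats 800000 in
lemma blockSum_mem [Fintype G] (ρ : Representation ℂ G M)
    (hreal : ∀ g : G, ρ.character g⁻¹ = ρ.character g) {x : G} (hinv : ∃ t, t * x * t⁻¹ = x⁻¹)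
    (hsplit : ∀ T : Subgroup G, IsPGroup 2 T → T ≤ extCentralizer x →
      Splits ρ.character (Subgroup.zpowers x ⊔ T)) (L : ℕ) :
    blockSum ρ.character x ∈ intSpan (2 * Nat.card (Subgroup.centralizer {x})) (2 ^ L) := by
  set χ := ρ.character with hχ
  let Γ := extCentralizer x
  let T : Sylow 2 Γ := default
  let Y := Γ ⧸ (T : Subgroup Γ)
  set N := Nat.totient (2 ^ L) with hN
  have hN0 : 0 < N := Nat.totient_pos.2 (by positivity)
  have : Fintype Y := Fintype.ofFinite _
  set I := intSpan (2 * Nat.card (Subgroup.centralizer {x})) (2 ^ L) with hI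
  let f : (Fin N → Y) → ℂ := fun p =>
    ∑ t : Γ, if (t : G) * x = x * t ∧ t • p = p then χ (x * t) ^ 2 else 0
  have hconj : ∀ (s t : Γ), (t : G) * x = x * t → ((s * t * s⁻¹ : Γ) : G) * x = x * (s * t * s⁻¹ : Γ) := by
    intro s t h
    exact Subgroup.mem_centralizer_singleton_iff.1
      (conj_mem_centralizer s.2 (Subgroup.mem_centralizer_singleton_iff.2 h))
  have hconj' : ∀ (s t : Γ), ((s * t * s⁻¹ : Γ) : G) * x = x * (s * t * s⁻¹ : Γ) ↔ (t : G) * x = x * t := by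
    intro s t
    refine ⟨fun h => ?_, hconj s t⟩
    have := hconj s⁻¹ _ h
    rwa [show s⁻¹ * (s * t * s⁻¹) * s⁻¹⁻¹ = t by group] at this
  have hfix : ∀ (s t : Γ) (p : Fin N → Y), (s * t * s⁻¹) • s • p = s • p ↔ t • p = p := by
    intro s t p
    rw [smul_smul, show s * t * s⁻¹ * s = s * t by group, ← smul_smul, smul_left_cancel_iff]
  have hf : ∀ (s : Γ) p, f (s • p) = f p := by
    intro s p
    rcases s.2 with hs | hs
    · refine (Fintype.sum_equiv (MulAut.conj s).toEquiv _ _ fun t => ?_).symm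
      change _ = if ((s * t * s⁻¹ : Γ) : G) * x = x * (s * t * s⁻¹ : Γ) ∧
        (s * t * s⁻¹) • s • p = s • p then χ (x * (s * t * s⁻¹ : Γ)) ^ 2 else 0
      refine if_ctx_congr (and_congr (hconj' s t).symm (hfix s t p).symm) (fun _ => ?_) fun _ => rfl
      congr 1
      rw [hχ, ← Representation.char_conj ρ (x * t) s]
      congr 1
      calc (s : G) * (x * t) * (s : G)⁻¹ = (s * x * (s : G)⁻¹) * (s * t * (s : G)⁻¹) := by group
        _ = _ := by rw [hs]; rfl
    · refine (Fintype.sum_equiv ((Equiv.inv Γ).trans (MulAut.conj s).toEquiv) _ _ fun t => ?_).symm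
      change _ = if ((s * t⁻¹ * s⁻¹ : Γ) : G) * x = x * (s * t⁻¹ * s⁻¹ : Γ) ∧
        (s * t⁻¹ * s⁻¹) • s • p = s • p then χ (x * (s * t⁻¹ * s⁻¹ : Γ)) ^ 2 else 0
      have e1 : ((t⁻¹ : Γ) : G) * x = x * (t⁻¹ : Γ) ↔ (t : G) * x = x * t := by
        rw [Subgroup.coe_inv, inv_mul_eq_iff_eq_mul, ← mul_assoc, eq_mul_inv_iff_mul_eq, eq_comm]
      have e2 : t⁻¹ • p = p ↔ t • p = p := by rw [inv_smul_eq_iff, eq_comm]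
      refine if_ctx_congr ?_ (fun h => ?_) fun _ => rfl
      · exact and_congr (e1.symm.trans (hconj' s _).symm) (e2.symm.trans (hfix s _ p).symm)
      replace h : (t : G) * x = x * t := e1.1 ((hconj' s _).1 h.1)
      rw [← h, ← hreal ((t : G) * x), hχ, ← Representation.char_conj ρ ((t : G) * x)⁻¹ s]
      congr 2
      calc (s : G) * ((t : G) * x)⁻¹ * (s : G)⁻¹
          = (s * x * (s : G)⁻¹)⁻¹ * (s * (t : G)⁻¹ * (s : G)⁻¹) := by group
        _ = _ := by rw [hs, inv_inv]; rfl
  have hmem : ∑ p, f p ∈ I := by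
    refine sum_mem_of_orbit I f hf fun p => ?_
    set S := (MulAction.stabilizer Γ p).map Γ.subtype with hSdef
    have hSle : S ≤ Γ := by
      rintro _ ⟨g, -, rfl⟩; exact g.2
    have hS2 : IsPGroup 2 S := by
      rintro ⟨_, g, hg, rfl⟩
      obtain ⟨k, hk⟩ := exists_pow_eq_one_of_smul_eq T.2 (congrFun hg ⟨0, hN0⟩)
      exact ⟨k, Subtype.ext (by simpa using congrArg Subtype.val hk)⟩
    obtain ⟨a, ha, h1⟩ := card_mul_sum_stabilizer ρ hinv S hSle (hsplit S hS2 hSle)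
    refine ⟨a, 0, ha, isIntegral_zero, ?_⟩
    have hcard : Nat.card Γ = (MulAction.orbit Γ p).ncard * Nat.card S := by
      rw [← MulAction.index_stabilizer, ← Subgroup.index_mul_card (MulAction.stabilizer Γ p)]
      congr 1
      exact Nat.card_congr ((MulAction.stabilizer Γ p).equivMapOfInjective _
        Γ.subtype_injective).toEquiv
    have hS0 : (Nat.card S : ℂ) ≠ 0 := by simp
    have hfS : f p = ∑ t : (S ⊓ Subgroup.centralizer {x} : Subgroup G), χ (x * t) ^ 2 := by
      change ∑ t : Γ, _ = _
      rw [← Finset.sum_filter]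
      refine Finset.sum_bij' (fun t ht => ⟨t, ?_⟩) (fun t _ => ⟨t, hSle t.2.1⟩) ?_ ?_ ?_ ?_ ?_
      · have := (Finset.mem_filter.1 ht).2
        exact ⟨⟨t, this.2, rfl⟩, Subgroup.mem_centralizer_singleton_iff.2 this.1⟩
      · intros; simp
      · rintro ⟨t, ⟨g, hg, rfl⟩, ht⟩ -
        exact Finset.mem_filter.2 ⟨Finset.mem_univ _, Subgroup.mem_centralizer_singleton_iff.1 ht, hg⟩
      · intros; rfl
      · intros; rfl
      · intros; rfl
    rw [← hfS, show Nat.card (extCentralizer x) = _ from hcard] at h1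
    apply mul_left_cancel₀ hS0
    push_cast at h1
    linear_combination h1
  have hcount : ∀ t : Γ, ∃ m : ℕ, (Fintype.card {p : Fin N → Y // t • p = p}) =
      (if ∃ k, t ^ 2 ^ k = 1 then 1 else 0) + 2 ^ L * m := by
    intro t
    have h1 : Fintype.card {p : Fin N → Y // t • p = p} = Nat.card {y : Y // t • y = y} ^ N := by
      have e : {p : Fin N → Y // t • p = p} ≃ (Fin N → {y : Y // t • y = y}) :=
        { toFun := fun p i => ⟨p.1 i, congrFun p.2 i⟩
          invFun := fun p => ⟨fun i => p i, funext fun i => (p i).2⟩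
          left_inv := fun _ => rfl
          right_inv := fun _ => rfl }
      rw [← Nat.card_eq_fintype_card, Nat.card_congr e]
      simp
    rw [h1]
    split_ifs with h
    · obtain ⟨k, hk⟩ := h
      exact exists_pow_totient (odd_card_fixed T hk)
    · refine ⟨0, ?_⟩
      have : IsEmpty {y : Y // t • y = y} := ⟨fun y => h (exists_pow_eq_one_of_smul_eq T.2 y.2)⟩
      simp [hN0.ne']
  choose m hm using hcount
  have hsum : ∑ p, f p = blockSum χ x +
      2 ^ L * ∑ t : Γ, (if (t : G) * x = x * t then (m t : ℂ) * χ (x * t) ^ 2 else 0) := by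
    change ∑ p, ∑ t : Γ, _ = _
    rw [Finset.sum_comm, Finset.mul_sum]
    have hb : blockSum χ x = ∑ t : Γ, if (t : G) * x = x * t then
        (if ∃ k, t ^ 2 ^ k = 1 then (1 : ℂ) else 0) * χ (x * t) ^ 2 else 0 := by
      have h0 : ∀ t : G, t * x = x * t → t ∈ Γ := fun t h =>
        Or.inl (mem_centralizer_iff_conj.1 (Subgroup.mem_centralizer_singleton_iff.2 h))
      rw [blockSum, ← Fintype.sum_subtype_add_sum_subtype (· ∈ Γ), add_eq_left.2]
      · refine Finset.sum_congr (by ext; simp) fun t _ => ?_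
        have : (∃ k, t ^ 2 ^ k = 1) ↔ ∃ k, (t : G) ^ 2 ^ k = 1 := by
          simp [Subtype.ext_iff]
        rw [← this]
        by_cases h1 : (t : G) * x = x * t <;> by_cases h2 : ∃ k, t ^ 2 ^ k = 1 <;>
          simp only [h1, h2, and_self, and_true, and_false, if_true, if_false, one_mul, zero_mul]
      · refine Finset.sum_eq_zero fun t _ => if_neg fun h => t.2 (h0 _ h.1)
    rw [hb, ← Finset.sum_add_distrib]
    refine Finset.sum_congr rfl fun t _ => ?_
    by_cases h : (t : G) * x = x * t
    · simp only [h, true_and, if_true]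
      rw [← Finset.sum_filter, Finset.sum_const, ← Fintype.card_subtype, hm t, nsmul_eq_mul]
      push_cast
      ring
    · simp [h]
  have hint : IsIntegral ℤ
      (∑ t : Γ, (if (t : G) * x = x * t then (m t : ℂ) * χ (x * t) ^ 2 else 0)) := by
    refine IsIntegral.sum _ fun t _ => ?_
    split_ifs
    · exact (isIntegral_algebraMap (R := ℤ) (x := (m t : ℤ))).mul ((isIntegral_char ρ _).pow 2)
    · exact isIntegral_zero
  have hres : blockSum χ x = ∑ p, f p - 2 ^ L *
      ∑ t : Γ, (if (t : G) * x = x * t then (m t : ℂ) * χ (x * t) ^ 2 else 0) := by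
    rw [hsum]; ring
  rw [hres]
  exact I.sub_mem hmem ⟨0, _, isIntegral_zero, hint, by ring⟩

lemma blockSum_conj [Fintype G] {χ : G → ℂ} (hχ : ∀ g h, χ (g * h * g⁻¹) = χ h) (g x : G) :
    blockSum χ (g * x * g⁻¹) = blockSum χ x := by
  refine (Fintype.sum_equiv (MulAut.conj g).toEquiv _ _ fun t => ?_).symm
  change _ = if (g * t * g⁻¹) * (g * x * g⁻¹) = (g * x * g⁻¹) * (g * t * g⁻¹) ∧
    ∃ k, (g * t * g⁻¹) ^ 2 ^ k = 1 then χ ((g * x * g⁻¹) * (g * t * g⁻¹)) ^ 2 else 0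
  have e : ∀ a b, (g * a * g⁻¹) * (g * b * g⁻¹) = g * (a * b) * g⁻¹ := fun a b => by group
  simp only [e, hχ, conj_pow, mul_right_cancel_iff, mul_left_cancel_iff, mul_inv_eq_one,
    mul_eq_left]

lemma sum_sq_eq_sum_blockSum [Fintype G] (χ : G → ℂ) :
    ∑ g, χ g ^ 2 = ∑ x, if Odd (orderOf x) then blockSum χ x else 0 := by
  obtain ⟨K, d, hd, hG⟩ := Nat.exists_eq_two_pow_mul_odd (Fintype.card_ne_zero (α := G))
  have hco : Nat.Coprime d (2 ^ K) := Nat.Coprime.pow_right K (Nat.coprime_two_right.2 hd)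
  obtain ⟨e, he1, he2⟩ := Nat.chineseRemainder hco 1 0
  obtain ⟨f, hf1, hf2⟩ := Nat.chineseRemainder hco 0 1
  have hodd : ∀ x : G, Odd (orderOf x) ↔ orderOf x ∣ d := fun x => by
    refine ⟨fun h => ?_, fun h => hd.of_dvd_nat h⟩
    have h1 : orderOf x ∣ 2 ^ K * d := hG ▸ orderOf_dvd_card
    exact (Nat.Coprime.pow_right K (Nat.coprime_two_right.2 h)).dvd_of_dvd_mul_left h1
  have htwo : ∀ x : G, (∃ k, x ^ 2 ^ k = 1) ↔ orderOf x ∣ 2 ^ K := fun x => by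
    refine ⟨fun ⟨k, h⟩ => ?_, fun h => ⟨K, orderOf_dvd_iff_pow_eq_one.1 h⟩⟩
    have h1 : orderOf x ∣ 2 ^ K * d := hG ▸ orderOf_dvd_card
    have h2 := orderOf_dvd_iff_pow_eq_one.2 h
    have h3 : Nat.Coprime (orderOf x) d :=
      Nat.Coprime.coprime_dvd_left h2 (Nat.Coprime.pow_left k (Nat.coprime_two_left.2 hd))
    exact h3.dvd_of_dvd_mul_right h1
  have hdvd : ∀ x : G, orderOf x ∣ d * 2 ^ K := fun x => by
    rw [mul_comm, ← hG]; exact orderOf_dvd_card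
  simp only [hodd, blockSum, htwo, ← Finset.sum_filter]
  rw [Finset.sum_sigma']
  refine (Finset.sum_bij' (fun p _ => p.1 * p.2) (fun g _ => ⟨g ^ e, g ^ f⟩) ?_ ?_ ?_ ?_ ?_).symm
  · intros; simp
  · intro g _
    simp only [Finset.mem_sigma, Finset.mem_filter, Finset.mem_univ, true_and]
    refine ⟨?_, ?_, ?_⟩
    · rw [orderOf_dvd_iff_pow_eq_one, ← pow_mul, ← orderOf_dvd_iff_pow_eq_one]
      refine (hdvd g).trans ?_
      rw [mul_comm]
      exact Nat.mul_dvd_mul_right ((Nat.modEq_zero_iff_dvd).1 he2) d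
    · rw [← pow_add, ← pow_add, add_comm]
    · rw [orderOf_dvd_iff_pow_eq_one, ← pow_mul, ← orderOf_dvd_iff_pow_eq_one]
      exact (hdvd g).trans (Nat.mul_dvd_mul_right ((Nat.modEq_zero_iff_dvd).1 hf1) _)
  · rintro ⟨x, t⟩ h
    simp only [Finset.mem_sigma, Finset.mem_filter, Finset.mem_univ, true_and] at h
    obtain ⟨hx, hc, ht⟩ := h
    have hc' : Commute x t := hc.symm
    have a1 : x ^ e = x := by
      simpa using (pow_eq_pow_iff_modEq (x := x) (n := e) (m := 1)).2 (he1.of_dvd hx)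
    have a2 : x ^ f = 1 := by
      simpa using (pow_eq_pow_iff_modEq (x := x) (n := f) (m := 0)).2 (hf1.of_dvd hx)
    have a3 : t ^ e = 1 := by
      simpa using (pow_eq_pow_iff_modEq (x := t) (n := e) (m := 0)).2 (he2.of_dvd ht)
    have a4 : t ^ f = t := by
      simpa using (pow_eq_pow_iff_modEq (x := t) (n := f) (m := 1)).2 (hf2.of_dvd ht)
    simp only [hc'.mul_pow, a1, a2, a3, a4, mul_one, one_mul]
  · intro g _
    have h1 : e + f ≡ 1 [MOD d * 2 ^ K] :=
      (Nat.modEq_and_modEq_iff_modEq_mul hco).1 ⟨he1.add hf1, he2.add hf2⟩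
    change g ^ e * g ^ f = g
    rw [← pow_add]
    simpa using (pow_eq_pow_iff_modEq (x := g) (n := e + f) (m := 1)).2 (h1.of_dvd (hdvd g))
  · intros; rfl

lemma not_irr_of_splits [Fintype G] (ρ : Representation ℂ G M) (hinv : ∀ x : G, ∃ t, t * x * t⁻¹ = x⁻¹)
    (hsplit : ∀ x : G, Odd (orderOf x) → ∀ T : Subgroup G, IsPGroup 2 T → T ≤ extCentralizer x →
      Splits ρ.character (Subgroup.zpowers x ⊔ T)) : ¬ Irr ρ := by
  intro hρ
  obtain ⟨K, d, hd, hG⟩ := Nat.exists_eq_two_pow_mul_odd (Fintype.card_ne_zero (α := G))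
  have hreal : ∀ g : G, ρ.character g⁻¹ = ρ.character g := fun g => by
    obtain ⟨t, ht⟩ := hinv g
    rw [← ht, Representation.char_conj]
  have h1 : ∑ g, ρ.character g ^ 2 = Fintype.card G := by
    rw [← hρ.sum_char_mul_inv]
    exact Finset.sum_congr rfl fun g _ => by rw [hreal, sq]
  set f : G → ℂ := fun x => if Odd (orderOf x) then blockSum ρ.character x else 0 with hf
  have h2 : ∑ x, f x ∈ intSpan (2 * Fintype.card G) (2 ^ (K + 1)) := by
    refine sum_mem_of_orbit (Γ := ConjAct G) _ f (fun g x => ?_) fun x => ?_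
    · simp only [hf]
      rw [ConjAct.smul_def, blockSum_conj (fun g h => Representation.char_conj ρ h g)]
      rw [show orderOf (ConjAct.ofConjAct g * x * (ConjAct.ofConjAct g)⁻¹) = orderOf x from
        (MulAut.conj (ConjAct.ofConjAct g)).orderOf_eq x]
    · simp only [hf]
      split_ifs with hx
      · obtain ⟨u, v, hu, hv, h⟩ := blockSum_mem ρ hreal (hinv x) (hsplit x hx) (K + 1)
        have hc : (MulAction.orbit (ConjAct G) x).ncard *
            Nat.card (Subgroup.centralizer {x}) = Fintype.card G := by
          rw [← MulAction.index_stabilizer, ← Nat.card_eq_fintype_card,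
            Nat.card_congr (ConjAct.toConjAct (G := G)).toEquiv,
            ← Subgroup.index_mul_card (MulAction.stabilizer (ConjAct G) x)]
          congr 1
          refine Nat.card_congr (Equiv.subtypeEquiv ConjAct.toConjAct.toEquiv fun g => ?_)
          rw [mem_centralizer_iff_conj, MulAction.mem_stabilizer_iff]
          rfl
        refine ⟨u, (MulAction.orbit (ConjAct G) x).ncard * v, hu,
          (isIntegral_algebraMap (R := ℤ) (x := ((MulAction.orbit (ConjAct G) x).ncard : ℤ))).mul hv, ?_⟩
        rw [h, ← hc]
        push_cast
        ring
      · rw [mul_zero]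
        exact AddSubgroup.zero_mem _
  rw [← sum_sq_eq_sum_blockSum, h1, hG] at h2
  obtain ⟨u, v, hu, hv, h⟩ := h2
  push_cast at h
  have h3 : (d : ℂ) = 2 * (d * u + v) := by
    apply mul_left_cancel₀ (pow_ne_zero K (two_ne_zero (α := ℂ)))
    rw [h]; ring
  have h4 : IsIntegral ℤ (d * u + v) :=
    ((isIntegral_algebraMap (R := ℤ) (x := (d : ℤ))).mul hu).add hv
  have h5 : IsIntegral ℤ ((d : ℚ) / 2) := by
    rw [← isIntegral_algebraMap_iff (B := ℂ) (algebraMap ℚ ℂ).injective]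
    convert h4 using 1
    rw [eq_div_of_mul_eq (two_ne_zero) ((mul_comm _ _).trans h3.symm)]
    simp
  obtain ⟨n, hn⟩ := IsIntegrallyClosed.isIntegral_iff.1 h5
  have h6 : (d : ℤ) = 2 * n := by
    have : ((d : ℤ) : ℚ) = ((2 * n : ℤ) : ℚ) := by
      push_cast
      simp only [algebraMap_int_eq, eq_intCast] at hn
      rw [hn]; ring
    exact_mod_cast this
  obtain ⟨k, hk⟩ := hd
  omega

end Parity

section Form

variable {F V : Type*} [Field F] [AddCommGroup V] [Module F V]

/-- A nondegenerate symmetric bilinear form. -/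
structure IsForm (B : LinearMap.BilinForm F V) : Prop where
  symm : ∀ x y, B x y = B y x
  nondeg : ∀ x, (∀ y, B x y = 0) → x = 0

lemma exists_comp_eq {P : Type*} [AddCommGroup P] [Module F P] {W : Type*} [AddCommGroup W]
    [Module F W] (Φ : P →ₗ[F] V) (Ψ : P →ₗ[F] W) (h : ∀ p, Φ p = 0 → Ψ p = 0) :
    ∃ t : V →ₗ[F] W, ∀ p, t (Φ p) = Ψ p := by
  have hk : LinearMap.ker Φ ≤ LinearMap.ker Ψ := h
  obtain ⟨l, hl⟩ := LinearMap.exists_leftInverse_of_injective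
    ((LinearMap.ker Φ).liftQ Φ le_rfl) (Submodule.ker_liftQ_eq_bot _ _ _ le_rfl)
  refine ⟨(LinearMap.ker Φ).liftQ Ψ hk ∘ₗ l, fun p => ?_⟩
  have := LinearMap.congr_fun hl (Submodule.Quotient.mk p)
  simp only [LinearMap.comp_apply, LinearMap.id_apply, Submodule.liftQ_apply] at this ⊢
  rw [this, Submodule.liftQ_apply]

variable {B : LinearMap.BilinForm F V}

namespace IsForm

lemma isRefl (hB : IsForm B) : B.IsRefl := fun x y h => by rw [hB.symm]; exact h

lemma restrict (hB : IsForm B) {U : Submodule F V}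
    (hU : ∀ u ∈ U, (∀ w ∈ U, B u w = 0) → u = 0) : IsForm (B.restrict U) where
  symm x y := hB.symm x y
  nondeg x h := Subtype.ext (hU x x.2 fun w hw => h ⟨w, hw⟩)

lemma isCompl [FiniteDimensional F V] (hB : IsForm B) {U : Submodule F V}
    (hU : ∀ u ∈ U, (∀ w ∈ U, B u w = 0) → u = 0) : IsCompl U (B.orthogonal U) := by
  rw [LinearMap.BilinForm.isCompl_orthogonal_iff_disjoint hB.isRefl, Submodule.disjoint_def]
  exact fun u hu h => hU u hu fun w hw => by rw [hB.symm]; exact h w hw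

lemma orthogonal_nondeg [FiniteDimensional F V] (hB : IsForm B) {U : Submodule F V}
    (hU : ∀ u ∈ U, (∀ w ∈ U, B u w = 0) → u = 0) :
    ∀ u ∈ B.orthogonal U, (∀ w ∈ B.orthogonal U, B u w = 0) → u = 0 := by
  refine fun u hu h => hB.nondeg u fun y => ?_
  have hy : y ∈ U ⊔ B.orthogonal U := (hB.isCompl hU).sup_eq_top ▸ Submodule.mem_top
  obtain ⟨a, ha, b, hb, rfl⟩ := Submodule.mem_sup.1 hy
  rw [map_add, h b hb, add_zero, hB.symm]
  exact hu a ha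

lemma exists_eq_left [FiniteDimensional F V] (hB : IsForm B) (f : V →ₗ[F] F) :
    ∃ w, ∀ x, B w x = f x := by
  have hi : Function.Injective B := (injective_iff_map_eq_zero _).2 fun x hx =>
    hB.nondeg x fun y => by rw [hx]; rfl
  have hs : Function.Surjective B :=
    (LinearMap.injective_iff_surjective_of_finrank_eq_finrank
      (Subspace.dual_finrank_eq (K := F) (V := V)).symm).1 hi
  obtain ⟨w, hw⟩ := hs f
  exact ⟨w, fun x => by rw [hw]⟩

end IsForm

lemma exists_map_of_gram {I : Type*} (e : I → V) (τ : I → I) (ε : I → F)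
    (hτ : ∀ i, τ (τ i) = i) (hε : ∀ i, ε i ≠ 0)
    (hg : ∀ i j, B (e i) (e j) = ε i * ε j * B (e (τ i)) (e (τ j)))
    (hnd : ∀ u ∈ Submodule.span F (Set.range e),
      (∀ w ∈ Submodule.span F (Set.range e), B u w = 0) → u = 0) :
    ∃ t : V →ₗ[F] V, ∀ i, t (e i) = ε i • e (τ i) := by
  set U := Submodule.span F (Set.range e)
  have hmem : ∀ i, e i ∈ U := fun i => Submodule.subset_span ⟨i, rfl⟩
  let Φ := Finsupp.linearCombination F e
  let Ψ := Finsupp.linearCombination F fun i => ε i • e (τ i)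
  have hΨU : ∀ p, Ψ p ∈ U := fun p => by
    rw [Finsupp.linearCombination_apply]
    exact Submodule.sum_mem _ fun i _ => U.smul_mem _ (U.smul_mem _ (hmem _))
  have hB : ∀ p q, B (Φ p) (Φ q) = B (Ψ p) (Ψ q) := by
    intro p q
    simp only [Φ, Ψ, Finsupp.linearCombination_apply, Finsupp.sum, map_sum, LinearMap.sum_apply,
      map_smul, LinearMap.smul_apply, smul_eq_mul]
    refine Finset.sum_congr rfl fun i _ => ?_
    simp only [Finset.mul_sum]
    exact Finset.sum_congr rfl fun j _ => by rw [hg j i]; ring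
  obtain ⟨t, ht⟩ := exists_comp_eq Φ Ψ fun p hp => by
    refine hnd _ (hΨU p) fun w hw => ?_
    refine Submodule.span_induction ?_ (by simp) (fun x y _ _ hx hy => by rw [map_add, hx, hy, add_zero])
      (fun c x _ hx => by rw [map_smul, hx, smul_zero]) hw
    rintro _ ⟨i, rfl⟩
    have h1 := hB p (Finsupp.single (τ i) 1)
    rw [hp, LinearMap.map_zero, LinearMap.zero_apply] at h1
    simp only [Ψ, Finsupp.linearCombination_single, hτ, one_smul, map_smul, smul_eq_mul] at h1
    exact (mul_eq_zero.1 h1.symm).resolve_left (hε _)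
  refine ⟨t, fun i => ?_⟩
  have := ht (Finsupp.single i 1)
  simpa [Φ, Ψ] using this

end Form

section Act

open Polynomial

variable {F V : Type*} [Field F] [AddCommGroup V] [Module F V]

/-- The action of a polynomial in the automorphism `g`. -/
def act (g : V ≃ₗ[F] V) (p : F[X]) : V →ₗ[F] V := aeval (g : V →ₗ[F] V) p

lemma act_mul (g : V ≃ₗ[F] V) (p q : F[X]) (v : V) : act g (p * q) v = act g p (act g q v) := by
  simp [act]

lemma act_comm (g : V ≃ₗ[F] V) (p q : F[X]) (v : V) : act g p (act g q v) = act g q (act g p v) := by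
  rw [← act_mul, mul_comm, act_mul]

lemma act_add (g : V ≃ₗ[F] V) (p q : F[X]) (v : V) : act g (p + q) v = act g p v + act g q v := by
  simp [act]

lemma act_sub (g : V ≃ₗ[F] V) (p q : F[X]) (v : V) : act g (p - q) v = act g p v - act g q v := by
  simp [act]

lemma act_one (g : V ≃ₗ[F] V) (v : V) : act g 1 v = v := by simp [act]

lemma act_C (g : V ≃ₗ[F] V) (c : F) (v : V) : act g (C c) v = c • v := by
  simp [act, Module.algebraMap_end_apply]

lemma act_X (g : V ≃ₗ[F] V) (v : V) : act g X v = g v := by simp [act]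

lemma act_X_pow (g : V ≃ₗ[F] V) (n : ℕ) (v : V) : act g (X ^ n) v = (g ^ n) v := by
  induction n with
  | zero => simp [act]
  | succ n ih => rw [pow_succ', act_mul, ih, act_X, pow_succ']; rfl

lemma act_pow_eq (g : V ≃ₗ[F] V) (n : ℕ) (p : F[X]) (v : V) :
    act (g ^ n) p v = act g (expand F n p) v := by
  have h : ((g ^ n : V ≃ₗ[F] V) : V →ₗ[F] V) = (g : V →ₗ[F] V) ^ n := by
    ext x
    induction n with
    | zero => rfl
    | succ n ih =>
      rw [pow_succ', pow_succ']
      exact congrArg g ih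
  rw [act, act, expand_aeval, h]

lemma exists_act_inv [Finite V] (g : V ≃ₗ[F] V) :
    ∃ n : ℕ, g⁻¹ = g ^ n ∧ g = g⁻¹ ^ n := by
  have : Finite (V ≃ₗ[F] V) := Finite.of_injective _ LinearEquiv.toEquiv_injective
  have h := pow_orderOf_eq_one g
  have h0 := orderOf_pos g
  obtain ⟨n, hn⟩ : ∃ n, orderOf g = n + 1 := ⟨orderOf g - 1, by omega⟩
  rw [hn, pow_succ] at h
  have h1 : g⁻¹ = g ^ n := (eq_inv_of_mul_eq_one_left h).symm
  exact ⟨n, h1, by rw [inv_pow, ← h1, inv_inv]⟩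

lemma act_socle (g : V ≃ₗ[F] V) {φ : F[X]} (hφ : Irreducible φ) {k : ℕ} {v : V}
    (hv : act g (φ ^ (k + 1)) v = 0) {p : F[X]} (hp : act g p v ≠ 0) :
    ∃ r, act g r (act g p v) = act g (φ ^ k) v := by
  have hp0 : p ≠ 0 := by rintro rfl; simp [act] at hp
  obtain ⟨j, s, hs, rfl⟩ := WfDvdMonoid.max_power_factor hp0 hφ
  have hj : j ≤ k := by
    by_contra h
    obtain ⟨i, rfl⟩ : ∃ i, j = k + 1 + i := ⟨j - (k + 1), by omega⟩
    rw [pow_add, mul_assoc, mul_comm, act_mul, hv, map_zero] at hp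
    exact hp rfl
  obtain ⟨a, b, hab⟩ := ((hφ.coprime_iff_not_dvd.2 hs).symm.pow_right (n := k + 1))
  refine ⟨φ ^ (k - j) * a, ?_⟩
  have e : φ ^ (k - j) * a * (φ ^ j * s) = φ ^ k - φ ^ k * b * φ ^ (k + 1) := by
    calc φ ^ (k - j) * a * (φ ^ j * s) = (φ ^ (k - j) * φ ^ j) * (a * s) := by ring
      _ = φ ^ k * (1 - b * φ ^ (k + 1)) := by
        rw [← pow_add, Nat.sub_add_cancel hj, ← hab]; ring
      _ = _ := by ring
  rw [← act_mul, e, act_sub, act_mul, hv, map_zero, sub_zero]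

lemma exists_primary [FiniteDimensional F V] [Nontrivial V] (g : V ≃ₗ[F] V) :
    ∃ (φ : F[X]) (k : ℕ) (e : F[X]) (v : V), Irreducible φ ∧ act g (φ ^ (k + 1)) v = 0 ∧
      act g (φ ^ k) v ≠ 0 ∧ (∀ x, act g (φ ^ (k + 1)) (act g e x) = 0) ∧
      ∀ x, act g (φ ^ (k + 1)) x = 0 → act g e x = x := by
  set μ := minpoly F (g : V →ₗ[F] V) with hμ
  have hint : IsIntegral F (g : V →ₗ[F] V) := Algebra.IsIntegral.isIntegral _
  have hμ0 : μ ≠ 0 := minpoly.ne_zero hint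
  have hμact : ∀ x, act g μ x = 0 := fun x => by simp [act, hμ]
  obtain ⟨φ, hφ, hdvd⟩ := WfDvdMonoid.exists_irreducible_factor (minpoly.not_isUnit F (g : V →ₗ[F] V)) hμ0
  obtain ⟨j, ψ, hψ, hj⟩ := WfDvdMonoid.max_power_factor hμ0 hφ
  obtain ⟨k, rfl⟩ : ∃ k, j = k + 1 := by
    refine Nat.exists_eq_succ_of_ne_zero fun h => hψ ?_
    rw [h, pow_zero, one_mul] at hj
    rwa [← hj]
  obtain ⟨c, d, hcd⟩ := ((hφ.coprime_iff_not_dvd.2 hψ).symm.pow_right (n := k + 1))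
  have hx : ∃ x, act g (φ ^ k * ψ) x ≠ 0 := by
    by_contra! h
    have h1 : μ ∣ φ ^ k * ψ := minpoly.dvd F _ (LinearMap.ext h)
    rw [hj, pow_succ, mul_assoc] at h1
    have h2 := (mul_dvd_mul_iff_left (pow_ne_zero k hφ.ne_zero)).1 h1
    have hψ0 : ψ ≠ 0 := fun h => hψ (h ▸ dvd_zero _)
    have h3 : φ * ψ ∣ 1 * ψ := by rwa [one_mul]
    exact hφ.not_isUnit (isUnit_of_dvd_one ((mul_dvd_mul_iff_right hψ0).1 h3))
  obtain ⟨x, hx⟩ := hx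
  refine ⟨φ, k, c * ψ, act g ψ x, hφ, ?_, ?_, fun y => ?_, fun y hy => ?_⟩
  · rw [← act_mul, ← hj, hμact]
  · rwa [← act_mul]
  · rw [← act_mul, show φ ^ (k + 1) * (c * ψ) = c * (φ ^ (k + 1) * ψ) by ring, act_mul, ← hj, hμact,
      map_zero]
  · rw [eq_sub_of_add_eq hcd, act_sub, act_mul, hy, map_zero, sub_zero, act_one]

variable {B : LinearMap.BilinForm F V}

lemma isometry_zpow {g : V ≃ₗ[F] V} (hg : ∀ x y, B (g x) (g y) = B x y) (n : ℤ) (x y : V) :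
    B ((g ^ n) x) y = B x ((g ^ (-n)) y) := by
  have h1 : ∀ n : ℕ, ∀ x y, B ((g ^ n) x) ((g ^ n) y) = B x y := by
    intro n
    induction n with
    | zero => intros; rfl
    | succ n ih =>
      intro x y
      rw [pow_succ]
      exact (ih _ _).trans (hg x y)
  have h2 : ∀ n : ℤ, ∀ x, (g ^ n) ((g ^ (-n)) x) = x := fun n x => by
    rw [← LinearEquiv.mul_apply, ← _root_.zpow_add, add_neg_cancel, zpow_zero]; rfl
  rcases Int.eq_nat_or_neg n with ⟨m, rfl | rfl⟩
  · conv_lhs => rw [← h2 m y, zpow_natCast, h1]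
  · conv_rhs => rw [neg_neg, zpow_natCast, ← h2 m x, zpow_natCast, h1]

lemma act_adjoint {g : V ≃ₗ[F] V} (hg : ∀ x y, B (g x) (g y) = B x y) (p : F[X]) (x y : V) :
    B (act g p x) y = B x (act g⁻¹ p y) := by
  induction p using Polynomial.induction_on' with
  | add p q hp hq => rw [act_add, act_add, map_add, LinearMap.add_apply, map_add, hp, hq]
  | monomial n a =>
    rw [← C_mul_X_pow_eq_monomial, act_mul, act_mul, act_C, act_C, act_X_pow, act_X_pow]
    have := isometry_zpow hg n x y
    rw [zpow_natCast, _root_.zpow_neg, zpow_natCast] at this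
    rw [map_smul, map_smul, LinearMap.smul_apply, this, inv_pow]

end Act

section Reversal

open Polynomial

variable {F V : Type*} [Field F] [AddCommGroup V] [Module F V] {B : LinearMap.BilinForm F V}

/-- `t` restricts to an isometric involution of `U` conjugating `g` to its inverse. -/
structure Reverses (B : LinearMap.BilinForm F V) (g t : V →ₗ[F] V) (U : Submodule F V) : Prop where
  map_mem : ∀ u ∈ U, t u ∈ U
  invol : ∀ u ∈ U, t (t u) = u
  conj : ∀ u ∈ U, t (g (t (g u))) = u
  isom : ∀ u ∈ U, ∀ w ∈ U, B (t u) (t w) = B u w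

lemma act_mem_span (g : V ≃ₗ[F] V) {J : Type*} (w : J → V) (j : J) (p : F[X]) :
    act g p (w j) ∈ Submodule.span F (Set.range fun i : ℤ × J => (g ^ i.1) (w i.2)) := by
  induction p using Polynomial.induction_on' with
  | add p q hp hq => rw [act_add]; exact Submodule.add_mem _ hp hq
  | monomial n a =>
    rw [← C_mul_X_pow_eq_monomial, act_mul, act_C, act_X_pow]
    exact Submodule.smul_mem _ _ (Submodule.subset_span ⟨(n, j), by simp⟩)

lemma exists_zpow_eq_pow [Finite V] (g : V ≃ₗ[F] V) (n : ℤ) : ∃ l : ℕ, g ^ n = g ^ l := by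
  obtain ⟨m, hm, -⟩ := exists_act_inv g
  rcases Int.eq_nat_or_neg n with ⟨l, rfl | rfl⟩
  · exact ⟨l, zpow_natCast _ _⟩
  · exact ⟨m * l, by rw [_root_.zpow_neg, zpow_natCast, ← inv_pow, hm, pow_mul]⟩

lemma exists_act_of_mem_span [Finite V] (g : V ≃ₗ[F] V) {J : Type*} [Fintype J] (w : J → V) {u : V}
    (hu : u ∈ Submodule.span F (Set.range fun i : ℤ × J => (g ^ i.1) (w i.2))) :
    ∃ c : J → F[X], u = ∑ j, act g (c j) (w j) := by
  refine Submodule.span_induction ?_ ⟨0, by simp [act]⟩ ?_ ?_ hu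
  · rintro _ ⟨⟨n, j⟩, rfl⟩
    obtain ⟨l, hl⟩ := exists_zpow_eq_pow g n
    refine ⟨Pi.single j (X ^ l), ?_⟩
    rw [Finset.sum_eq_single j]
    · simp only [Pi.single_eq_same, act_X_pow, hl]
    · intro i _ hi
      simp [Pi.single_eq_of_ne hi, act]
    · simp
  · rintro _ _ _ _ ⟨c, rfl⟩ ⟨d, rfl⟩
    exact ⟨c + d, by simp only [Pi.add_apply, act_add, Finset.sum_add_distrib]⟩
  · rintro a _ _ ⟨c, rfl⟩
    exact ⟨fun j => C a * c j, by simp only [act_mul, act_C, Finset.smul_sum]⟩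

lemma exists_reverses_of_family [Finite V] {g : V ≃ₗ[F] V} (hg : ∀ x y, B (g x) (g y) = B x y)
    {J : Type*} [Fintype J] (w : J → V) (τ : J → J) (δ : J → F) (hτ : ∀ j, τ (τ j) = j)
    (hδ : ∀ j, δ j * δ j = 1) (hδτ : ∀ j, δ (τ j) = δ j) (hw : ∃ j, w j ≠ 0)
    (hgram : ∀ i j, ∀ n : ℤ, B ((g ^ n) (w i)) (w j) =
      δ i * δ j * B ((g ^ (-n)) (w (τ i))) (w (τ j)))
    (hnd : ∀ c : J → F[X], (∀ j q, B (act g q (∑ i, act g (c i) (w i))) (w j) = 0) →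
      ∑ i, act g (c i) (w i) = 0) :
    ∃ U : Submodule F V, U ≠ ⊥ ∧ (∀ u ∈ U, g u ∈ U) ∧
      (∀ u ∈ U, (∀ w ∈ U, B u w = 0) → u = 0) ∧ ∃ t, Reverses B (g : V →ₗ[F] V) t U := by
  set e : ℤ × J → V := fun i => (g ^ i.1) (w i.2) with he
  have hge : ∀ i, g (e i) = e (i.1 + 1, i.2) := fun i => by
    simp only [he]; rw [add_comm, _root_.zpow_add, zpow_one]; rfl
  have hnd' : ∀ u ∈ Submodule.span F (Set.range e),
      (∀ x ∈ Submodule.span F (Set.range e), B u x = 0) → u = 0 := by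
    intro u hu h
    obtain ⟨m, hm, -⟩ := exists_act_inv g
    obtain ⟨c, rfl⟩ := exists_act_of_mem_span g w hu
    refine hnd c fun j q => ?_
    rw [act_adjoint hg, hm, act_pow_eq]
    exact h _ (act_mem_span g w j _)
  have hδ0 : ∀ j, δ j ≠ 0 := fun j h => by simpa [h] using hδ j
  have hsplit : ∀ (m n : ℤ) x y, B ((g ^ m) x) ((g ^ n) y) = B ((g ^ (m - n)) x) y := fun m n x y => by
    rw [isometry_zpow hg (m - n), isometry_zpow hg m, ← LinearEquiv.mul_apply, ← _root_.zpow_add]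
    rw [show -m + n = -(m - n) by ring]
  obtain ⟨t, ht⟩ := exists_map_of_gram (B := B) e (fun i => (-i.1, τ i.2)) (fun i => δ i.2)
    (fun i => by simp [hτ]) (fun i => hδ0 _) (fun i j => by
      simp only [he]
      rw [hsplit, hsplit, hgram, show -(i.1 - j.1) = -i.1 - -j.1 by ring]) hnd'
  have hmem : ∀ i, e i ∈ Submodule.span F (Set.range e) := fun i => Submodule.subset_span ⟨i, rfl⟩
  have key : ∀ f : V →ₗ[F] V, (∀ i, f (e i) = e i) →
      ∀ u ∈ Submodule.span F (Set.range e), f u = u := by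
    intro f hf u hu
    have : Set.EqOn f (LinearMap.id : V →ₗ[F] V) (Submodule.span F (Set.range e)) :=
      LinearMap.eqOn_span (by rintro _ ⟨i, rfl⟩; exact hf i)
    exact this hu
  have htt : ∀ i, t (t (e i)) = e i := fun i => by
    rw [ht, map_smul, ht, smul_smul]
    simp only [hδτ, hδ, neg_neg, hτ, one_smul]
  refine ⟨Submodule.span F (Set.range e), ?_, ?_, hnd', t, ?_, ?_, ?_, ?_⟩
  · obtain ⟨j, hj⟩ := hw
    refine fun h => hj ?_
    have := hmem (0, j)
    rw [h, Submodule.mem_bot] at this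
    simpa [he] using this
  · intro u hu
    suffices h : Submodule.span F (Set.range e) ≤
      (Submodule.span F (Set.range e)).comap (g : V →ₗ[F] V) from h hu
    rw [Submodule.span_le]
    rintro _ ⟨i, rfl⟩
    change g (e i) ∈ Submodule.span F (Set.range e)
    rw [hge]; exact hmem _
  · intro u hu
    suffices h : Submodule.span F (Set.range e) ≤ (Submodule.span F (Set.range e)).comap t from h hu
    rw [Submodule.span_le]
    rintro _ ⟨i, rfl⟩
    change t (e i) ∈ Submodule.span F (Set.range e)
    rw [ht]; exact Submodule.smul_mem _ _ (hmem _)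
  · exact key (t ∘ₗ t) htt
  · refine key (t ∘ₗ g ∘ₗ t ∘ₗ g) fun i => ?_
    change t (g (t (g (e i)))) = e i
    rw [hge, ht, map_smul, hge, map_smul, ht, smul_smul]
    simp only [hδτ, hδ, one_smul, hτ]
    congr 1
    ext <;> simp
  · have h1 : ∀ i j, B (t (e i)) (t (e j)) = B (e i) (e j) := fun i j => by
      rw [ht, ht]
      simp only [he, map_smul, LinearMap.smul_apply, smul_eq_mul]
      rw [hsplit i.1, hgram, hsplit, show -(i.1 - j.1) = -i.1 - -j.1 by ring]
      ring
    intro u hu x hx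
    refine Submodule.span_induction ?_ (by simp) (fun x y _ _ hx hy => by
      simp only [map_add, LinearMap.add_apply, hx, hy]) (fun c x _ hx => by
      simp only [map_smul, LinearMap.smul_apply, hx]) hu
    rintro _ ⟨i, rfl⟩
    refine Submodule.span_induction ?_ (by simp) (fun x y _ _ hx hy => by
      simp only [map_add, hx, hy]) (fun c x _ hx => by
      simp only [map_smul, hx]) hx
    rintro _ ⟨j, rfl⟩
    exact h1 i j

/-- Some nonzero nondegenerate invariant subspace carries an involution reversing `g`. -/
def HasReversal (B : LinearMap.BilinForm F V) (g : V ≃ₗ[F] V) : Prop :=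
  ∃ U : Submodule F V, U ≠ ⊥ ∧ (∀ u ∈ U, g u ∈ U) ∧
    (∀ u ∈ U, (∀ w ∈ U, B u w = 0) → u = 0) ∧ ∃ t, Reverses B (g : V →ₗ[F] V) t U

lemma dvd_of_act_eq_zero {g : V ≃ₗ[F] V} {φ : F[X]} (hφ : Irreducible φ) {k : ℕ} {v : V}
    (hv : act g (φ ^ (k + 1)) v = 0) (hv' : act g (φ ^ k) v ≠ 0) {p : F[X]} (hp : act g p v = 0) :
    φ ^ (k + 1) ∣ p := by
  have h1 : act g (gcd p (φ ^ (k + 1))) v = 0 := by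
    obtain ⟨a, b, hab⟩ := exists_gcd_eq_mul_add_mul p (φ ^ (k + 1))
    rw [hab, act_add, mul_comm, act_mul, hp, mul_comm, act_mul, hv, map_zero, map_zero, add_zero]
  obtain ⟨i, hi, h⟩ := (dvd_prime_pow hφ.prime _).1 (gcd_dvd_right p (φ ^ (k + 1)))
  rcases hi.lt_or_eq with hi | rfl
  · exfalso
    obtain ⟨c, hc⟩ := h.dvd.trans (pow_dvd_pow φ (Nat.lt_succ_iff.1 hi))
    rw [hc, mul_comm, act_mul, h1, map_zero] at hv'
    exact hv' rfl
  · exact h.symm.dvd.trans (gcd_dvd_left _ _)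

lemma hasReversal_cyclic [Finite V] {g : V ≃ₗ[F] V} (hg : ∀ x y, B (g x) (g y) = B x y)
    (hB : IsForm B) {φ : F[X]} (hφ : Irreducible φ) {k : ℕ} {v : V}
    (hv : act g (φ ^ (k + 1)) v = 0) {r : F[X]} (h : B (act g (φ ^ k * r) v) v ≠ 0) :
    HasReversal B g := by
  refine exists_reverses_of_family hg (fun _ : Unit => v) id 1 (fun _ => rfl) (by simp) (by simp)
    ⟨(), ?_⟩ ?_ ?_
  · rintro rfl; simp at h
  · intro i j n
    rw [isometry_zpow hg, hB.symm]; simp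
  · intro c hc
    by_contra hne
    simp only [Finset.univ_unique, Finset.sum_singleton] at hne hc
    obtain ⟨s, hs⟩ := act_socle g hφ hv hne
    apply h
    rw [mul_comm, act_mul, ← hs, ← act_mul]
    exact hc () (r * s)

lemma hasReversal_isotropic [Finite V] {g : V ≃ₗ[F] V} (hg : ∀ x y, B (g x) (g y) = B x y)
    (hB : IsForm B) {φ : F[X]} (hφ : Irreducible φ) {k : ℕ} {v w : V}
    (hv : act g (φ ^ (k + 1)) v = 0) (hw : act g⁻¹ (φ ^ (k + 1)) w = 0)
    (hvv : ∀ p, B (act g p v) v = 0) (hww : ∀ p, B (act g p w) w = 0)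
    (h : B (act g (φ ^ k) v) w ≠ 0) : HasReversal B g := by
  obtain ⟨m, hm, hm'⟩ := exists_act_inv g
  have hz : ∀ x, (∀ p, B (act g p x) x = 0) → ∀ n : ℤ, B ((g ^ n) x) x = 0 := fun x hx n => by
    obtain ⟨l, hl⟩ := exists_zpow_eq_pow g n
    rw [hl, ← act_X_pow]; exact hx _
  refine exists_reverses_of_family hg (fun b : Bool => cond b v w) not 1 (by simp) (by simp)
    (by simp) ⟨true, ?_⟩ ?_ ?_
  · rintro h0
    rw [show v = 0 from h0] at h
    simp at h
  · intro i j n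
    have h1 := hz v hvv
    have h2 := hz w hww
    have h3 : ∀ x y, B ((g ^ n) x) y = B ((g ^ (-n)) y) x := fun x y => by
      rw [isometry_zpow hg, hB.symm]
    cases i <;> cases j <;> simp [-_root_.zpow_neg, h1, h2, h3 v, h3 w]
  · intro c hc
    simp only [Fintype.sum_bool, cond_true, cond_false] at hc ⊢
    have hv0 : act g (c true) v = 0 := by
      by_contra hne
      obtain ⟨s, hs⟩ := act_socle g hφ hv hne
      apply h
      have := hc true
      have h1 := hc false s
      rwa [map_add, hs, ← act_mul, map_add, LinearMap.add_apply, cond_false, hww, add_zero] at h1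
    rw [hv0, zero_add] at hc ⊢
    by_contra hne
    have e : ∀ p x, act g p x = act g⁻¹ (expand F m p) x := fun p x => by
      conv_lhs => rw [hm', act_pow_eq]
    rw [e] at hne
    obtain ⟨s, hs⟩ := act_socle g⁻¹ hφ hw hne
    have h1 := hc true (expand F m s)
    rw [← act_pow_eq, ← hm, e (c false), hs, hB.symm, cond_true, ← act_adjoint hg] at h1
    exact h h1

lemma hasReversal_skew [Finite V] {g : V ≃ₗ[F] V} (hg : ∀ x y, B (g x) (g y) = B x y)
    (hB : IsForm B) {φ : F[X]} (hφ : Irreducible φ) {k : ℕ} {v w : V}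
    (hv : act g (φ ^ (k + 1)) v = 0) (hw : act g (φ ^ (k + 1)) w = 0)
    (hvv : ∀ p, B (act g (φ ^ k * p) v) v = 0) (hww : ∀ p, B (act g (φ ^ k * p) w) w = 0)
    (h : B (act g (φ ^ k) v) w ≠ 0) (h' : B (act g (φ ^ k) w) v ≠ 0)
    (hodd : ∀ n : ℤ, B ((g ^ n) v) w = - B ((g ^ (-n)) v) w) : HasReversal B g := by
  have h3 : ∀ (n : ℤ) x y, B ((g ^ n) x) y = B ((g ^ (-n)) y) x := fun n x y => by
    rw [isometry_zpow hg, hB.symm]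
  refine exists_reverses_of_family hg (fun b : Bool => cond b v w) id (fun b => cond b 1 (-1))
    (by simp) (by simp) (by simp) ⟨true, ?_⟩ ?_ ?_
  · rintro h0
    rw [show v = 0 from h0] at h
    simp at h
  · intro i j n
    cases i <;> cases j
    · simpa using h3 n w w
    · have := hodd (-n)
      rw [neg_neg] at this
      simp [-_root_.zpow_neg, h3 n w v, this, h3 (-n) w v]
    · simpa using hodd n
    · simpa using h3 n v v
  · intro c hc
    simp only [Fintype.sum_bool, cond_true, cond_false] at hc ⊢
    by_cases hd : φ ^ (k + 1) ∣ c true ∧ φ ^ (k + 1) ∣ c false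
    · obtain ⟨⟨a, ha⟩, b, hb⟩ := hd
      rw [ha, hb, mul_comm, act_mul, hv, mul_comm, act_mul, hw]; simp
    exfalso
    obtain ⟨j, hj, ⟨hj1, hj2⟩, hj3⟩ : ∃ j ≤ k, (φ ^ j ∣ c true ∧ φ ^ j ∣ c false) ∧
        ¬ (φ ^ (j + 1) ∣ c true ∧ φ ^ (j + 1) ∣ c false) := by
      by_contra! H
      have : ∀ j ≤ k + 1, φ ^ j ∣ c true ∧ φ ^ j ∣ c false := by
        intro j
        induction j with
        | zero => simp
        | succ j ih => exact fun hj => H j (by omega) (ih (by omega))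
      exact hd (this _ le_rfl)
    obtain ⟨a, ha⟩ := hj1
    obtain ⟨b, hb⟩ := hj2
    have hinv : ∀ s : F[X], ¬ φ ∣ s → ∃ r, ∀ x, act g (φ ^ (k + 1)) x = 0 →
        act g (φ ^ k * (r * s)) x = act g (φ ^ k) x := by
      intro s hs
      obtain ⟨r, d, hrd⟩ := (hφ.coprime_iff_not_dvd.2 hs).symm.pow_right (n := k + 1)
      refine ⟨r, fun x hx => ?_⟩
      rw [act_mul, eq_sub_of_add_eq hrd, act_sub, act_mul, hx, map_zero, sub_zero, act_one]
    have key : ∀ (r : F[X]) (y : V), y = v ∨ y = w →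
        B (act g (φ ^ k * (r * a)) v) y + B (act g (φ ^ k * (r * b)) w) y = 0 := by
      intro r y hy
      have h1 : ∀ (p : F[X]) x, act g (r * φ ^ (k - j)) (act g (φ ^ j * p) x) =
          act g (φ ^ k * (r * p)) x := fun p x => by
        rw [← act_mul]
        congr 2
        rw [← Nat.sub_add_cancel hj, pow_add, Nat.add_sub_cancel]; ring
      rw [← LinearMap.add_apply, ← map_add, ← h1, ← h1, ← ha, ← hb, ← map_add]
      rcases hy with rfl | rfl
      · exact hc true _
      · exact hc false _
    by_cases hφa : φ ∣ a
    · have hφb : ¬ φ ∣ b := fun hφb => hj3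
        ⟨ha ▸ pow_succ φ j ▸ mul_dvd_mul_left _ hφa, hb ▸ pow_succ φ j ▸ mul_dvd_mul_left _ hφb⟩
      obtain ⟨r, hr⟩ := hinv b hφb
      have h1 := key r v (Or.inl rfl)
      rw [hvv, hr w hw, zero_add] at h1
      exact h' h1
    · obtain ⟨r, hr⟩ := hinv a hφa
      have h1 := key r w (Or.inr rfl)
      rw [hww, hr v hv, add_zero] at h1
      exact h h1

lemma hasReversal [Finite V] [FiniteDimensional F V] [Nontrivial V] (h2 : (2 : F) ≠ 0)
    {g : V ≃ₗ[F] V} (hg : ∀ x y, B (g x) (g y) = B x y) (hB : IsForm B) : HasReversal B g := by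
  obtain ⟨m, hm, hm'⟩ := exists_act_inv g
  obtain ⟨φ, k, e, v, hφ, hv, hv', he1, he2⟩ := exists_primary g
  have e1 : ∀ p x, act g⁻¹ p x = act g (expand F m p) x := fun p x => by rw [hm, act_pow_eq]
  have e2 : ∀ p x, act g p x = act g⁻¹ (expand F m p) x := fun p x => by
    conv_lhs => rw [hm', act_pow_eq]
  have hproj : ∀ x y, act g (φ ^ (k + 1)) x = 0 → B x (act g⁻¹ e y) = B x y := fun x y hx => by
    rw [← act_adjoint hg, he2 x hx]
  have hker : ∀ y, act g⁻¹ (φ ^ (k + 1)) (act g⁻¹ e y) = 0 := fun y => by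
    refine hB.nondeg _ fun x => ?_
    rw [hB.symm, ← act_adjoint hg, ← act_adjoint hg, act_comm, he1, map_zero, LinearMap.zero_apply]
  have hNk : ∀ p x, act g (φ ^ (k + 1)) x = 0 → act g (φ ^ (k + 1)) (act g p x) = 0 :=
    fun p x hx => by rw [act_comm, hx, map_zero]
  have hw0 : ∃ w0, B (act g (φ ^ k) v) w0 ≠ 0 := by
    by_contra! H
    exact hv' (hB.nondeg _ H)
  obtain ⟨w0, hw0⟩ := hw0
  have hw1 : B (act g (φ ^ k) v) (act g⁻¹ e w0) ≠ 0 := by rwa [hproj _ _ (hNk _ _ hv)]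
  by_cases hd : φ ∣ expand F m φ
  · obtain ⟨c, hc⟩ := hd
    have hkk : ∀ x, act g⁻¹ (φ ^ (k + 1)) x = 0 → act g (φ ^ (k + 1)) x = 0 := fun x hx => by
      rw [e2, map_pow, hc, mul_pow, mul_comm, act_mul, hx, map_zero]
    have hkk' : ∀ x, act g (φ ^ (k + 1)) x = 0 → act g⁻¹ (φ ^ (k + 1)) x = 0 := fun x hx => by
      rw [e1, map_pow, hc, mul_pow, mul_comm, act_mul, hx, map_zero]
    by_cases hcyc : ∃ x r, act g (φ ^ (k + 1)) x = 0 ∧ B (act g (φ ^ k * r) x) x ≠ 0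
    · obtain ⟨x, r, hx, hr⟩ := hcyc
      exact hasReversal_cyclic hg hB hφ hx hr
    push Not at hcyc
    have hpol : ∀ x y, act g (φ ^ (k + 1)) x = 0 → act g (φ ^ (k + 1)) y = 0 →
        B (act g (φ ^ k) x) y = - B (act g (φ ^ k) y) x := fun x y hx hy => by
      have h1 := hcyc (x + y) 1 (by rw [map_add, hx, hy, add_zero])
      have h2 := hcyc x 1 hx
      have h3 := hcyc y 1 hy
      rw [mul_one] at h1 h2 h3
      rw [map_add, map_add, map_add, LinearMap.add_apply, LinearMap.add_apply, h2, h3] at h1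
      linear_combination h1
    set w1 := act g⁻¹ e w0 with hw1def
    have hNv : act g⁻¹ (φ ^ k) v = - act g (φ ^ k) v := by
      rw [← sub_eq_zero, sub_neg_eq_add]
      refine hB.nondeg _ fun y => ?_
      have hmem : act g (φ ^ (k + 1)) (act g⁻¹ (φ ^ k) v + act g (φ ^ k) v) = 0 := by
        rw [map_add, e1, hNk _ _ hv, hNk _ _ hv, add_zero]
      have hy := hkk _ (hker y)
      rw [← hproj _ _ hmem, hB.symm, map_add, ← act_adjoint hg, hpol _ _ hy hv, hB.symm]
      ring
    let P : F[X] →ₗ[F] V := LinearMap.applyₗ v ∘ₗ (aeval (g : V →ₗ[F] V)).toLinearMap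
    let Q : F[X] →ₗ[F] V := LinearMap.applyₗ v ∘ₗ (aeval ((g⁻¹ : V ≃ₗ[F] V) : V →ₗ[F] V)).toLinearMap
    have hP : ∀ p, P p = act g p v := fun p => rfl
    have hQ : ∀ p, Q p = act g⁻¹ p v := fun p => rfl
    obtain ⟨f, hf⟩ := exists_comp_eq P (B w1 ∘ₗ (P - Q)) fun p hp => by
      obtain ⟨s, rfl⟩ := dvd_of_act_eq_zero hφ hv hv' (hP p ▸ hp)
      rw [LinearMap.comp_apply, LinearMap.sub_apply, hp, hQ, mul_comm, act_mul, hkk' v hv]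
      simp
    obtain ⟨w', hw'⟩ := hB.exists_eq_left f
    have hwf : ∀ p, B (act g p v) (act g⁻¹ e w') = B (act g p v - act g⁻¹ p v) w1 := fun p => by
      rw [hproj _ _ (hNk _ _ hv), hB.symm, hw', ← hP, hf, hB.symm]; rfl
    have hmain : B (act g (φ ^ k) v) (act g⁻¹ e w') ≠ 0 := by
      rw [hwf, hNv, sub_neg_eq_add, ← two_smul F, map_smul, LinearMap.smul_apply]
      exact smul_ne_zero h2 hw1
    have hwk := hkk _ (hker w')
    refine hasReversal_skew hg hB hφ hv hwk (fun p => hcyc _ p hv) (fun p => hcyc _ p hwk) hmain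
      (fun h0 => hmain (by rw [hpol _ _ hv hwk, h0, neg_zero])) fun n => ?_
    have hn : ∀ n : ℤ, B ((g ^ n) v) (act g⁻¹ e w') = B ((g ^ n) v - (g ^ (-n)) v) w1 := fun n => by
      obtain ⟨l, hl⟩ := exists_zpow_eq_pow g n
      have := hwf (X ^ l)
      rwa [act_X_pow, act_X_pow, inv_pow, ← hl, ← _root_.zpow_neg] at this
    rw [hn, hn, neg_neg, ← LinearMap.neg_apply, ← map_neg, neg_sub]
  · have hco : IsCoprime (φ ^ (k + 1)) (expand F m φ ^ (k + 1)) :=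
      (hφ.coprime_iff_not_dvd.2 hd).pow
    obtain ⟨a, b, hab⟩ := hco
    refine hasReversal_isotropic hg hB hφ hv (hker w0) (fun p => ?_) (fun p => ?_) hw1
    · have h1 : v = act g (b * expand F m φ ^ (k + 1)) v := by
        rw [eq_sub_of_add_eq' hab, act_sub, act_mul, hv, map_zero, sub_zero, act_one]
      have h2 : act g p v = act g⁻¹ (φ ^ (k + 1)) (act g (p * b) v) := by
        conv_lhs => rw [h1]
        rw [e1, map_pow, ← act_mul, ← act_mul]
        congr 2; ring
      rw [h2, hB.symm, ← act_adjoint hg, hv, map_zero, LinearMap.zero_apply]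
    · have hw : act g (expand F m φ ^ (k + 1)) (act g⁻¹ e w0) = 0 := by
        rw [← map_pow, ← e1, hker]
      have h1 : act g⁻¹ e w0 = act g (a * φ ^ (k + 1)) (act g⁻¹ e w0) := by
        rw [eq_sub_of_add_eq hab, act_sub, act_mul, hw, map_zero, sub_zero, act_one]
      have h2 : act g p (act g⁻¹ e w0) = act g (φ ^ (k + 1)) (act g (p * a) (act g⁻¹ e w0)) := by
        conv_lhs => rw [h1]
        rw [← act_mul, ← act_mul]
        congr 2; ring
      rw [h2, act_adjoint hg, hker, map_zero]

end Reversal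

section Glue

variable {F V : Type*} [Field F] [AddCommGroup V] [Module F V]

/-- The isometry group of a bilinear form. -/
def orth (B : LinearMap.BilinForm F V) : Subgroup (V ≃ₗ[F] V) where
  carrier := {g | ∀ x y, B (g x) (g y) = B x y}
  one_mem' _ _ := rfl
  mul_mem' ha hb x y := (ha _ _).trans (hb x y)
  inv_mem' {g} hg x y := by
    have := hg (g⁻¹ x) (g⁻¹ y)
    rw [← LinearEquiv.mul_apply, ← LinearEquiv.mul_apply, mul_inv_cancel] at this
    exact this.symm

variable {U W : Submodule F V}

/-- Automorphisms of two complementary subspaces act on the whole space. -/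
def glue (h : IsCompl U W) : (U ≃ₗ[F] U) × (W ≃ₗ[F] W) →* (V ≃ₗ[F] V) where
  toFun p := (Submodule.prodEquivOfIsCompl U W h).symm ≪≫ₗ p.1.prodCongr p.2 ≪≫ₗ
    Submodule.prodEquivOfIsCompl U W h
  map_one' := by
    ext v
    obtain ⟨x, rfl⟩ := (Submodule.prodEquivOfIsCompl U W h).surjective v
    simp
  map_mul' p r := by
    ext v
    obtain ⟨x, rfl⟩ := (Submodule.prodEquivOfIsCompl U W h).surjective v
    simp

lemma glue_apply (h : IsCompl U W) (p : (U ≃ₗ[F] U) × (W ≃ₗ[F] W)) (u : U) (w : W) :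
    glue h p (u + w) = p.1 u + p.2 w := by
  have : (u + w : V) = Submodule.prodEquivOfIsCompl U W h (u, w) := by simp
  rw [this]
  simp [glue]

lemma exists_add_of_isCompl (h : IsCompl U W) (v : V) : ∃ (u : U) (w : W), v = u + w := by
  have hv : v ∈ U ⊔ W := h.sup_eq_top ▸ Submodule.mem_top
  obtain ⟨a, ha, b, hb, rfl⟩ := Submodule.mem_sup.1 hv
  exact ⟨⟨a, ha⟩, ⟨b, hb⟩, rfl⟩

lemma glue_injective (h : IsCompl U W) : Function.Injective (glue h) := by
  rw [injective_iff_map_eq_one]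
  intro p hp
  refine Prod.ext (LinearEquiv.ext fun u => Subtype.ext ?_) (LinearEquiv.ext fun w => Subtype.ext ?_)
  · have := glue_apply h p u 0
    simpa [hp] using this.symm
  · have := glue_apply h p 0 w
    simpa [hp] using this.symm

variable {B : LinearMap.BilinForm F V}

lemma glue_mem_orth (h : IsCompl U W) (hp : ∀ u ∈ U, ∀ w ∈ W, B u w = 0)
    (hp' : ∀ u ∈ U, ∀ w ∈ W, B w u = 0) {p : (U ≃ₗ[F] U) × (W ≃ₗ[F] W)} :
    glue h p ∈ orth B ↔ p.1 ∈ orth (B.restrict U) ∧ p.2 ∈ orth (B.restrict W) := by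
  constructor
  · refine fun hg => ⟨fun x y => ?_, fun x y => ?_⟩
    · have := hg (x + (0 : W)) (y + (0 : W))
      simp only [glue_apply, map_zero] at this
      simpa using this
    · have := hg ((0 : U) + x) ((0 : U) + y)
      simp only [glue_apply, map_zero] at this
      simpa using this
  · rintro ⟨h1, h2⟩ x y
    obtain ⟨a, b, rfl⟩ := exists_add_of_isCompl h x
    obtain ⟨c, d, rfl⟩ := exists_add_of_isCompl h y
    have e1 : B (p.1 a) (p.1 c) = B a c := h1 a c
    have e2 : B (p.2 b) (p.2 d) = B b d := h2 b d
    rw [glue_apply, glue_apply]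
    simp only [map_add, LinearMap.add_apply, e1, e2, hp _ (p.1 a).2 _ (p.2 d).2,
      hp' _ (p.1 c).2 _ (p.2 b).2, hp _ a.2 _ d.2, hp' _ c.2 _ b.2]

/-- The restriction of an automorphism to an invariant subspace. -/
def resEquiv [FiniteDimensional F V] (g : V ≃ₗ[F] V) (h : ∀ u ∈ U, g u ∈ U) : U ≃ₗ[F] U :=
  LinearEquiv.ofInjectiveEndo ((g : V →ₗ[F] V).restrict h) fun _ _ hxy =>
    Subtype.ext (g.injective (congrArg Subtype.val hxy))

lemma resEquiv_apply [FiniteDimensional F V] (g : V ≃ₗ[F] V) (h : ∀ u ∈ U, g u ∈ U) (u : U) :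
    (resEquiv g h u : V) = g u := rfl

lemma glue_resEquiv [FiniteDimensional F V] (h : IsCompl U W) (g : V ≃ₗ[F] V)
    (hU : ∀ u ∈ U, g u ∈ U) (hW : ∀ w ∈ W, g w ∈ W) : glue h (resEquiv g hU, resEquiv g hW) = g := by
  ext v
  obtain ⟨u, w, rfl⟩ := exists_add_of_isCompl h v
  rw [glue_apply, resEquiv_apply, resEquiv_apply, map_add]

lemma orthogonal_map_mem [FiniteDimensional F V] {g : V ≃ₗ[F] V} (hg : g ∈ orth B)
    (hU : ∀ u ∈ U, g u ∈ U) : ∀ w ∈ B.orthogonal U, g w ∈ B.orthogonal U := by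
  intro w hw u hu
  obtain ⟨u', hu'⟩ := (resEquiv g hU).surjective ⟨u, hu⟩
  have : u = g u' := by rw [← resEquiv_apply g hU, hu']
  rw [this]
  exact (hg _ _).trans (hw _ u'.2)

end Glue

universe u in
theorem exists_involution_conj {F : Type*} [Field F] (h2 : (2 : F) ≠ 0) {V : Type u}
    [AddCommGroup V] [Module F V] [Finite V] {B : LinearMap.BilinForm F V} (hB : IsForm B)
    {g : V ≃ₗ[F] V} (hg : g ∈ orth B) : ∃ t ∈ orth B, t * t = 1 ∧ t * g * t⁻¹ = g⁻¹ := by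
  have hfin : ∀ (V : Type u) [AddCommGroup V] [Module F V] [Finite V], FiniteDimensional F V :=
    fun V _ _ _ => Module.Finite.of_finite
  obtain ⟨n, hn⟩ : ∃ n, Module.finrank F V = n := ⟨_, rfl⟩
  induction n using Nat.strong_induction_on generalizing V with
  | _ n ih =>
    have := hfin V
    rcases subsingleton_or_nontrivial V with hV | hV
    · exact ⟨1, one_mem _, one_mul _, LinearEquiv.ext fun x => Subsingleton.elim _ _⟩
    obtain ⟨U, hU0, hgU, hU, t, ht⟩ := hasReversal h2 hg hB
    have hc := hB.isCompl hU
    have hgW := orthogonal_map_mem hg hgU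
    have hp : ∀ u ∈ U, ∀ w ∈ B.orthogonal U, B u w = 0 := fun u hu w hw => hw u hu
    have hp' : ∀ u ∈ U, ∀ w ∈ B.orthogonal U, B w u = 0 := fun u hu w hw =>
      (hB.symm _ _).trans (hw u hu)
    have hgl := glue_resEquiv hc g hgU hgW
    obtain ⟨h1, h2⟩ := (glue_mem_orth hc hp hp').1 (hgl.symm ▸ hg)
    obtain ⟨t2, ht2, ht2', hc2⟩ := ih (Module.finrank F (B.orthogonal U)) (by
      have h3 := Submodule.finrank_add_eq_of_isCompl hc
      have h4 : 0 < Module.finrank F U := Nat.pos_of_ne_zero fun h =>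
        hU0 (Submodule.finrank_eq_zero.1 h)
      omega) (hB.restrict (hB.orthogonal_nondeg hU)) h2 rfl
    let t1 : U ≃ₗ[F] U := LinearEquiv.ofInvolutive (t.restrict ht.map_mem) fun u =>
      Subtype.ext (ht.invol u u.2)
    have ht1 : t1 * t1 = 1 := LinearEquiv.ext fun u => Subtype.ext (ht.invol u u.2)
    have hc1 : t1 * resEquiv g hgU * t1⁻¹ = (resEquiv g hgU)⁻¹ := by
      rw [eq_inv_iff_mul_eq_one, inv_eq_of_mul_eq_one_right ht1]
      exact LinearEquiv.ext fun u => Subtype.ext (ht.conj u u.2)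
    refine ⟨glue hc (t1, t2), (glue_mem_orth hc hp hp').2
      ⟨fun x y => ht.isom x x.2 y y.2, ht2⟩, ?_, ?_⟩
    · rw [← map_mul, Prod.mk_mul_mk, ht1, ht2', ← Prod.one_eq_mk, map_one]
    · rw [← hgl, ← map_mul, ← map_inv, ← map_mul, ← map_inv, Prod.inv_mk, Prod.mk_mul_mk,
        Prod.mk_mul_mk, hc1, hc2, Prod.inv_mk]

section Twisted

variable {K : Type*} [Group K]

/-- The elements conjugating `e` to `e` or to `z * e`, for a central involution `z`. -/
def twistCentralizer (z e : K) (hz : ∀ g, g * z = z * g) (hzz : z * z = 1) : Subgroup K where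
  carrier := {g | g * e * g⁻¹ = e ∨ g * e * g⁻¹ = z * e}
  one_mem' := Or.inl (by group)
  mul_mem' := by
    intro a b ha hb
    have h1 : a * b * e * (a * b)⁻¹ = a * (b * e * b⁻¹) * a⁻¹ := by group
    have h2 : a * (z * e) * a⁻¹ = z * (a * e * a⁻¹) := by rw [← mul_assoc, hz]; group
    have h3 : z * (z * e) = e := by rw [← mul_assoc, hzz, one_mul]
    rcases ha with ha | ha <;> rcases hb with hb | hb <;>
      simp only [Set.mem_ofPred_eq, h1, hb, h2, ha, h3, true_or, or_true]
  inv_mem' := by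
    intro a ha
    have h : ∀ y, a * e * a⁻¹ = y → a⁻¹ * y * a⁻¹⁻¹ = e := fun y h => by rw [← h]; group
    rcases ha with ha | ha
    · exact Or.inl (h _ ha)
    · have h1 : z * (a⁻¹ * (z * e) * a⁻¹⁻¹) = z * z * (a⁻¹ * e * a⁻¹⁻¹) := by
        rw [← mul_assoc a⁻¹, hz]; group
      rw [h _ ha, hzz, one_mul] at h1
      exact Or.inr h1.symm

lemma mem_twistCentralizer {z e : K} (hz : ∀ g, g * z = z * g) (hzz : z * z = 1) {g : K} :
    g ∈ twistCentralizer z e hz hzz ↔ g * e * g⁻¹ = e ∨ g * e * g⁻¹ = z * e := Iff.rfl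

/-- The subgroup generated by `y` and an involution inverting it. -/
def dihedral (y t : K) (ht : t * t = 1) (hty : t * y * t⁻¹ = y⁻¹) : Subgroup K :=
  have h : ∀ i : ℤ, t * y ^ i = (y ^ i)⁻¹ * t := fun i => by
    rw [← _root_.inv_zpow, ← hty, conj_zpow, inv_mul_cancel_right]
  have ht' : t⁻¹ = t := inv_eq_of_mul_eq_one_right ht
  { carrier := {d | ∃ i : ℤ, d = y ^ i ∨ d = y ^ i * t}
    one_mem' := ⟨0, by simp⟩
    mul_mem' := by
      rintro _ _ ⟨i, rfl | rfl⟩ ⟨j, rfl | rfl⟩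
      · exact ⟨i + j, Or.inl (_root_.zpow_add y i j).symm⟩
      · exact ⟨i + j, Or.inr (by rw [_root_.zpow_add, mul_assoc])⟩
      · exact ⟨i - j, Or.inr (by rw [mul_assoc, h, _root_.zpow_sub, mul_assoc])⟩
      · refine ⟨i - j, Or.inl ?_⟩
        rw [mul_assoc, ← mul_assoc t, h, mul_assoc _ t, ht, mul_one, _root_.zpow_sub]
    inv_mem' := by
      rintro _ ⟨i, rfl | rfl⟩
      · exact ⟨-i, Or.inl (_root_.zpow_neg y i).symm⟩
      · exact ⟨i, Or.inr (by rw [_root_.mul_inv_rev, ht', ← _root_.zpow_neg, h, _root_.zpow_neg,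
          inv_inv])⟩ }

lemma isPGroup_zpowers {p : ℕ} [Fact p.Prime] {c : K} {k : ℕ} (h : orderOf c ∣ p ^ k) :
    IsPGroup p (Subgroup.zpowers c) := by
  obtain ⟨j, -, hj⟩ := (Nat.dvd_prime_pow Fact.out).1 h
  exact IsPGroup.of_card (n := j) (by rw [Nat.card_zpowers, hj])

lemma conj_mem_zpowers {g c d : K} (h : g * c * g⁻¹ ∈ Subgroup.zpowers c)
    (hd : d ∈ Subgroup.zpowers c) : g * d * g⁻¹ ∈ Subgroup.zpowers c := by
  obtain ⟨i, rfl⟩ := hd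
  dsimp only
  rw [← conj_zpow]
  exact zpow_mem h i

variable [Finite K]

lemma two_mul_orderOf_le_card {D : Subgroup K} {y t : K} (hy : y ∈ D) (ht : t ∈ D)
    (hty : t ∉ Subgroup.zpowers y) : 2 * orderOf y ≤ Nat.card D := by
  have hle : Subgroup.zpowers y ≤ D := (Subgroup.zpowers_le).2 hy
  obtain ⟨k, hk⟩ := Subgroup.card_dvd_of_le hle
  rw [Nat.card_zpowers] at hk
  have h0 : 0 < Nat.card D := Nat.card_pos
  have h1 : k ≠ 0 := by rintro rfl; omega
  have h2 : k ≠ 1 := by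
    rintro rfl
    rw [mul_one, ← Nat.card_zpowers] at hk
    exact hty (Subgroup.eq_of_le_of_card_ge hle hk.le ▸ ht)
  rw [hk, mul_comm]
  exact Nat.mul_le_mul_left _ (by omega)

lemma Good.of_equiv {G H : Type*} [Group G] [Group H] (h : Good G) (f : G ≃* H) : Good H :=
  h.of_surjective f.toMonoidHom f.surjective

/-- Sylow step: a group inverting or fixing `x` by conjugation, whose 2-elements commuting with
`x` are inverted together with `x` by involutions. -/
lemma exists_twist_or_good {x z : K} (hx : Odd (orderOf x))
    (hK : ∀ g, g * x * g⁻¹ = x ∨ g * x * g⁻¹ = x⁻¹) (hz : ∀ g, g * z = z * g) (hz1 : z ≠ 1)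
    (hzz : z * z = 1)
    (hinv : ∀ c, c * x * c⁻¹ = x → (orderOf x).Coprime (orderOf c) →
      ∃ t, t * t = 1 ∧ t * x * t⁻¹ = x⁻¹ ∧ t * c * t⁻¹ = c⁻¹) (P : Sylow 2 K) :
    (∃ e, e * e = 1 ∧ e ≠ 1 ∧ e ≠ z ∧
      Subgroup.zpowers x ⊔ P ≤ twistCentralizer z e hz hzz) ∨
    Good ↥(Subgroup.zpowers x ⊔ (P : Subgroup K)) := by
  have hP : IsPGroup 2 P := P.2
  have h2 : ∀ g : K, g * g = 1 → orderOf g ∣ 2 ^ 1 := fun g hg =>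
    orderOf_dvd_of_pow_eq_one (by rw [pow_one, pow_two, hg])
  have hzx : (Subgroup.zpowers x).Normal := by
    refine ⟨fun n hn g => conj_mem_zpowers ?_ hn⟩
    rcases hK g with h | h <;> rw [h]
    · exact Subgroup.mem_zpowers x
    · exact inv_mem (Subgroup.mem_zpowers x)
  have hzP : z ∈ P := by
    have hn : (Subgroup.zpowers z).Normal :=
      ⟨fun n hn g => conj_mem_zpowers (by rw [hz, mul_inv_cancel_right]; exact Subgroup.mem_zpowers z) hn⟩
    exact (isPGroup_zpowers (h2 z hzz)).le_sylow_of_normal P (Subgroup.mem_zpowers z)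
  let T0 : Subgroup P := (Subgroup.centralizer {x}).subgroupOf P
  have hT0 : ∀ p : P, p ∈ T0 ↔ (p : K) * x * (p : K)⁻¹ = x := fun p => by
    rw [Subgroup.mem_subgroupOf, mem_centralizer_iff_conj]
  have hT0n : T0.Normal := by
    refine ⟨fun n hn g => ?_⟩
    rw [Subgroup.mem_subgroupOf] at hn ⊢
    exact conj_mem_centralizer (mem_extCentralizer.2 (hK g)) hn
  by_cases hcase : ∀ e ∈ T0, e * e = 1 → (∀ t : P, t * e * t⁻¹ = e ∨ t * e * t⁻¹ = ⟨z, hzP⟩ * e) →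
      e = 1 ∨ e = ⟨z, hzP⟩
  swap
  · push Not at hcase
    obtain ⟨e, he, hee, het, he1, hez⟩ := hcase
    refine Or.inl ⟨e, congrArg Subtype.val hee, fun h => he1 (Subtype.ext h),
      fun h => hez (Subtype.ext h), sup_le ((Subgroup.zpowers_le).2 (Or.inl ?_)) fun t ht => ?_⟩
    · rw [hT0] at he
      rw [mul_inv_eq_iff_eq_mul] at he ⊢
      exact he.symm
    · exact (het ⟨t, ht⟩).imp (congrArg Subtype.val) (congrArg Subtype.val)
  right
  obtain ⟨c, hcT, hcard⟩ := exists_cyclic_of_involutions hP T0 ⟨z, hzP⟩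
    ((hT0 _).2 (by rw [← hz, mul_inv_cancel_right])) (fun h => hz1 (congrArg Subtype.val h))
    (Subtype.ext hzz) (fun t => Subtype.ext (by simp [hz])) hcase
  rw [hT0] at hcT
  have hcop : ∀ p : P, (orderOf x).Coprime (orderOf (p : K)) := fun p => by
    obtain ⟨k, hk⟩ := IsPGroup.iff_orderOf.1 hP p
    rw [Subgroup.orderOf_coe, hk]
    exact (Nat.coprime_two_right.2 hx).pow_right k
  obtain ⟨t, htt, htx, htc⟩ := hinv c hcT (hcop c)
  obtain ⟨g, hgc, hgt⟩ : ∃ g : K, g * c * g⁻¹ ∈ P ∧ g * t * g⁻¹ ∈ P := by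
    have h1 : IsPGroup 2 (Subgroup.zpowers (c : K)) := hP.to_le ((Subgroup.zpowers_le).2 c.2)
    have h3 : Subgroup.zpowers t ≤ Subgroup.normalizer (Subgroup.zpowers (c : K)) :=
      (Subgroup.zpowers_le).2 (Subgroup.mem_normalizer_fintype fun n hn => conj_mem_zpowers
        (by rw [htc]; exact inv_mem (Subgroup.mem_zpowers _)) hn)
    obtain ⟨Q, hQ⟩ := ((isPGroup_zpowers (h2 t htt)).to_sup_of_normal_right' h1 h3).exists_le_sylow
    obtain ⟨g, hg⟩ := MulAction.exists_smul_eq K Q P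
    have hQP : ∀ a ∈ Q, g * a * g⁻¹ ∈ P := fun a ha => by
      rw [← hg]
      exact Subgroup.smul_mem_pointwise_smul a (MulAut.conj g) Q ha
    exact ⟨g, hQP _ (hQ (le_sup_right (a := Subgroup.zpowers t) (Subgroup.mem_zpowers _))),
      hQP _ (hQ (le_sup_left (a := Subgroup.zpowers t) (Subgroup.mem_zpowers _)))⟩
  have conj_mul : ∀ a b : K, g * a * g⁻¹ * (g * b * g⁻¹) = g * (a * b) * g⁻¹ := fun a b => by group
  have conj_inv : ∀ a : K, g * a⁻¹ * g⁻¹ = (g * a * g⁻¹)⁻¹ := fun a => by group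
  have conj_conj : ∀ a : K, g * a * g⁻¹ * x * (g * a * g⁻¹)⁻¹ =
      g * (a * (g⁻¹ * x * g⁻¹⁻¹) * a⁻¹) * g⁻¹ := fun a => by group
  have hginv : g * (g⁻¹ * x * g⁻¹⁻¹) * g⁻¹ = x := by group
  have hcx' : g * c * g⁻¹ * x * (g * c * g⁻¹)⁻¹ = x := by
    rw [conj_conj]
    rcases hK g⁻¹ with h | h <;> rw [h] at hginv ⊢
    · rw [hcT, hginv]
    · have e : (c : K) * x⁻¹ * (c : K)⁻¹ = (c * x * (c : K)⁻¹)⁻¹ := by group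
      rw [e, hcT, hginv]
  have htx' : g * t * g⁻¹ * x * (g * t * g⁻¹)⁻¹ = x⁻¹ := by
    rw [conj_conj]
    rcases hK g⁻¹ with h | h <;> rw [h] at hginv ⊢
    · rw [htx, conj_inv, hginv]
    · have e : t * x⁻¹ * t⁻¹ = (t * x * t⁻¹)⁻¹ := by group
      rw [e, htx, inv_inv]
      rw [conj_inv] at hginv
      exact inv_eq_iff_eq_inv.1 hginv
  have hco : orderOf (g * c * g⁻¹) = orderOf c := by
    rw [← MulAut.conj_apply, ← Subgroup.orderOf_coe]
    exact (MulAut.conj g).orderOf_eq _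
  set c' := g * c * g⁻¹
  set t' := g * t * g⁻¹
  have htt' : t' * t' = 1 := by rw [conj_mul, htt]; group
  have htc' : t' * c' * t'⁻¹ = c'⁻¹ := by rw [← conj_inv, ← conj_inv, conj_mul, conj_mul, htc]
  clear_value c' t'
  have hcc : Commute x c' := (mul_inv_eq_iff_eq_mul.1 hcx').symm
  set S := Subgroup.zpowers x ⊔ (P : Subgroup K)
  have hxS : x ∈ S := le_sup_left (a := Subgroup.zpowers x) (Subgroup.mem_zpowers x)
  have hPS : ∀ p ∈ P, p ∈ S := fun p hp => le_sup_right (a := Subgroup.zpowers x) hp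
  let y : S := ⟨x * c', mul_mem hxS (hPS _ hgc)⟩
  let s : S := ⟨t', hPS _ hgt⟩
  have hyo : orderOf y = orderOf x * orderOf c := by
    rw [← hco, ← Subgroup.orderOf_coe]
    exact hcc.orderOf_mul_eq_mul_orderOf_of_coprime (hcop ⟨c', hgc⟩)
  have hsy : s * y * s⁻¹ = y⁻¹ := by
    refine Subtype.ext ?_
    show t' * (x * c') * t'⁻¹ = (x * c')⁻¹
    have : t' * (x * c') * t'⁻¹ = t' * x * t'⁻¹ * (t' * c' * t'⁻¹) := by group
    rw [this, htx', htc', hcc.eq, _root_.mul_inv_rev]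
  have hss : s * s = 1 := Subtype.ext htt'
  have hyD : y ∈ dihedral y s hss hsy := ⟨1, Or.inl (zpow_one y).symm⟩
  have hsD : s ∈ dihedral y s hss hsy := ⟨0, Or.inr (by simp)⟩
  have hSP : Nat.card S ≤ orderOf x * Nat.card P := by
    have h1 := Set.natCard_mul_le (s := (Subgroup.zpowers x : Set K)) (t := ((P : Subgroup K) : Set K))
    rw [← Subgroup.normal_mul] at h1
    rw [← Nat.card_zpowers]
    exact h1
  have hPT : Nat.card P ≤ 2 * Nat.card T0 := by
    rw [← Subgroup.card_top (G := P)]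
    refine card_le_two_mul_card fun a _ b _ ha hb => ?_
    rw [hT0] at ha hb ⊢
    have e : (a * b : K) * x * (a * b : K)⁻¹ = a * (b * x * (b : K)⁻¹) * (a : K)⁻¹ := by group
    have e' : (a : K) * x⁻¹ * (a : K)⁻¹ = (a * x * (a : K)⁻¹)⁻¹ := by group
    rw [Subgroup.coe_mul, e, (hK b).resolve_left hb, e', (hK a).resolve_left ha, inv_inv]
  refine good_of_dihedral (dihedral y s hss hsy) ?_ y s hss hsy hyD hsD fun _ h => h
  · by_cases hx1 : x = 1
    · have h1 : orderOf y ≤ Nat.card (dihedral y s hss hsy) := by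
        rw [← Nat.card_zpowers]
        exact Subgroup.card_le_of_le ((Subgroup.zpowers_le).2 hyD)
      have h2 : Nat.card T0 = Nat.card P := by
        rw [show T0 = ⊤ from eq_top_iff.2 fun p _ => (hT0 p).2 (by simp [hx1]), Subgroup.card_top]
      rw [hx1, orderOf_one, one_mul] at hyo hSP
      have := Subgroup.orderOf_coe c
      omega
    · have h1 := two_mul_orderOf_le_card hyD hsD fun h => hx1 <| by
        obtain ⟨i, hi⟩ := h
        have h3 : Commute t' x := by
          rw [show t' = (x * c') ^ i from (congrArg Subtype.val hi).symm]
          exact ((Commute.refl x).mul_left hcc.symm).zpow_left i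
        rw [h3.eq, mul_inv_cancel_right] at htx'
        have h4 := h2 x (by nth_rw 1 [htx', inv_mul_cancel])
        rw [← orderOf_eq_one_iff]
        exact Nat.Coprime.eq_one_of_dvd ((Nat.coprime_two_right.2 hx).pow_right 1) h4
      rw [hyo] at h1
      have h2 := Nat.mul_le_mul_left (orderOf x) (hPT.trans (Nat.mul_le_mul_left 2 hcard))
      rw [← Subgroup.orderOf_coe] at h2
      nlinarith

end Twisted

section Eigen

variable {F V : Type*} [Field F] [AddCommGroup V] [Module F V] {B : LinearMap.BilinForm F V}

/-- The fixed space of `e`. -/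
def fixSub (e : V ≃ₗ[F] V) : Submodule F V := LinearMap.ker ((e : V →ₗ[F] V) - LinearMap.id)

/-- The `(-1)`-eigenspace of `e`. -/
def negSub (e : V ≃ₗ[F] V) : Submodule F V := LinearMap.ker ((e : V →ₗ[F] V) + LinearMap.id)

lemma mem_fixSub {e : V ≃ₗ[F] V} {v : V} : v ∈ fixSub e ↔ e v = v := by
  rw [fixSub, LinearMap.mem_ker, LinearMap.sub_apply, sub_eq_zero]; rfl

lemma mem_negSub {e : V ≃ₗ[F] V} {v : V} : v ∈ negSub e ↔ e v = -v := by
  rw [negSub, LinearMap.mem_ker, LinearMap.add_apply, add_eq_zero_iff_eq_neg]; rfl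

lemma isCompl_fixSub_negSub (h2 : (2 : F) ≠ 0) {e : V ≃ₗ[F] V} (hee : e * e = 1) :
    IsCompl (fixSub e) (negSub e) := by
  have he : ∀ v, e (e v) = v := LinearEquiv.congr_fun hee
  refine IsCompl.of_eq (eq_bot_iff.2 fun v hv => ?_) (eq_top_iff.2 fun v _ => ?_)
  · have h := (mem_fixSub.1 hv.1).symm.trans (mem_negSub.1 hv.2)
    rw [← add_eq_zero_iff_eq_neg, ← two_smul F, smul_eq_zero] at h
    exact h.resolve_left h2
  · have h : v = (2 : F)⁻¹ • (v + e v) + (2 : F)⁻¹ • (v - e v) := by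
      rw [← smul_add, add_add_sub_cancel, ← two_smul F v, inv_smul_smul₀ h2]
    rw [h]
    refine Submodule.add_mem_sup (mem_fixSub.2 ?_) (mem_negSub.2 ?_)
    · rw [map_smul, map_add, he, add_comm]
    · rw [map_smul, map_sub, he, ← smul_neg, neg_sub]

lemma fixSub_negSub_ortho (h2 : (2 : F) ≠ 0) {e : V ≃ₗ[F] V} (he : e ∈ orth B) :
    ∀ u ∈ fixSub e, ∀ w ∈ negSub e, B u w = 0 := by
  intro u hu w hw
  have h := he u w
  rw [mem_fixSub.1 hu, mem_negSub.1 hw, map_neg, neg_eq_iff_add_eq_zero, ← two_mul] at h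
  exact (mul_eq_zero.1 h).resolve_left h2

lemma IsForm.nondeg_of_isCompl (hB : IsForm B) {U W : Submodule F V} (hc : IsCompl U W)
    (h : ∀ u ∈ U, ∀ w ∈ W, B u w = 0) : ∀ u ∈ U, (∀ w ∈ U, B u w = 0) → u = 0 := by
  refine fun u hu h0 => hB.nondeg u fun y => ?_
  obtain ⟨a, b, rfl⟩ := exists_add_of_isCompl hc y
  rw [map_add, h0 a a.2, h u hu b b.2, add_zero]

lemma map_mem_fixSub {e g : V ≃ₗ[F] V} (h : ∀ v, g (e v) = e (g v)) :
    ∀ u ∈ fixSub e, g u ∈ fixSub e := fun u hu => by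
  rw [mem_fixSub] at *; rw [← h, hu]

lemma map_mem_negSub {e g : V ≃ₗ[F] V} (h : ∀ v, g (e v) = e (g v)) :
    ∀ u ∈ negSub e, g u ∈ negSub e := fun u hu => by
  rw [mem_negSub] at *; rw [← h, hu, map_neg]

/-- Conjugation by an isometry. -/
def orthCongr {V' : Type*} [AddCommGroup V'] [Module F V'] {B' : LinearMap.BilinForm F V'}
    (φ : V ≃ₗ[F] V') (h : ∀ x y, B' (φ x) (φ y) = B x y) : orth B ≃* orth B' where
  toFun g := ⟨φ.symm ≪≫ₗ g.1 ≪≫ₗ φ, fun x y => by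
    have := g.2 (φ.symm x) (φ.symm y)
    rw [← h, ← h] at this
    simpa using this⟩
  invFun g := ⟨φ ≪≫ₗ g.1 ≪≫ₗ φ.symm, fun x y => by
    rw [← h]
    have := g.2 (φ x) (φ y)
    simpa [h] using this⟩
  left_inv g := by ext; simp
  right_inv g := by ext; simp
  map_mul' a b := by ext; simp

/-- The isometry `-1`. -/
def negOrth (B : LinearMap.BilinForm F V) : orth B :=
  ⟨LinearEquiv.neg F, fun x y => by simp⟩

lemma negOrth_comm (g : orth B) : g * negOrth B = negOrth B * g :=
  Subtype.ext (LinearEquiv.ext fun v => map_neg g.1 v)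

lemma negOrth_mul_self : negOrth B * negOrth B = 1 :=
  Subtype.ext (LinearEquiv.ext fun v => neg_neg v)

lemma mem_twistCentralizer_negOrth {e g : orth B} :
    g ∈ twistCentralizer (negOrth B) e negOrth_comm negOrth_mul_self ↔
      (∀ v, g.1 (e.1 v) = e.1 (g.1 v)) ∨ ∀ v, g.1 (e.1 v) = -e.1 (g.1 v) := by
  rw [mem_twistCentralizer, mul_inv_eq_iff_eq_mul, mul_inv_eq_iff_eq_mul]
  refine or_congr ?_ ?_ <;> rw [Subtype.ext_iff, LinearEquiv.ext_iff] <;> rfl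

lemma glue_eigen_comm {e : V ≃ₗ[F] V} (hc : IsCompl (fixSub e) (negSub e))
    (p : (fixSub e ≃ₗ[F] fixSub e) × (negSub e ≃ₗ[F] negSub e)) (v : V) :
    glue hc p (e v) = e (glue hc p v) := by
  obtain ⟨u, w, rfl⟩ := exists_add_of_isCompl hc v
  have h1 : e (u + w) = u + (-w : negSub e) := by
    rw [map_add, mem_fixSub.1 u.2, mem_negSub.1 w.2, Submodule.coe_neg]
  rw [h1, glue_apply, glue_apply, map_add e, map_neg, mem_fixSub.1 (p.1 u).2,
    mem_negSub.1 (p.2 w).2, Submodule.coe_neg]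

/-- Isometries of the two eigenspaces give isometries centralising `e`. -/
def glueOrth (h2 : (2 : F) ≠ 0) (hB : IsForm B) (e : orth B) (hee : e * e = 1) :
    orth (B.restrict (fixSub e.1)) × orth (B.restrict (negSub e.1)) →*
      twistCentralizer (negOrth B) e negOrth_comm negOrth_mul_self :=
  have hc := isCompl_fixSub_negSub h2 (congrArg Subtype.val hee)
  have ho := fixSub_negSub_ortho h2 e.2
  MonoidHom.codRestrict (MonoidHom.codRestrict ((glue hc).comp
    ((orth (B.restrict (fixSub e.1))).subtype.prodMap (orth (B.restrict (negSub e.1))).subtype))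
    (orth B) fun p => (glue_mem_orth hc ho fun u hu w hw => (hB.symm _ _).trans (ho u hu w hw)).2
      ⟨p.1.2, p.2.2⟩) _ fun p => mem_twistCentralizer_negOrth.2 <| Or.inl fun v =>
    glue_eigen_comm hc (p.1.1, p.2.1) v

variable (h2 : (2 : F) ≠ 0) (hB : IsForm B) {e : orth B} (hee : e * e = 1)

lemma glueOrth_apply (p : orth (B.restrict (fixSub e.1)) × orth (B.restrict (negSub e.1)))
    (u : fixSub e.1) (w : negSub e.1) :
    (glueOrth h2 hB e hee p).1.1 (u + w) = p.1.1 u + p.2.1 w :=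
  glue_apply (isCompl_fixSub_negSub h2 (congrArg Subtype.val hee)) (p.1.1, p.2.1) u w

lemma glueOrth_apply_left (p : orth (B.restrict (fixSub e.1)) × orth (B.restrict (negSub e.1)))
    (u : fixSub e.1) : (glueOrth h2 hB e hee p).1.1 u = p.1.1 u := by
  simpa using glueOrth_apply h2 hB hee p u 0

lemma glueOrth_apply_right (p : orth (B.restrict (fixSub e.1)) × orth (B.restrict (negSub e.1)))
    (w : negSub e.1) : (glueOrth h2 hB e hee p).1.1 w = p.2.1 w := by
  simpa using glueOrth_apply h2 hB hee p 0 w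

lemma glueOrth_injective : Function.Injective (glueOrth h2 hB e hee) := fun p r h => by
  have := glue_injective (isCompl_fixSub_negSub h2 (congrArg Subtype.val hee))
    (congrArg (fun g => g.1.1) h)
  exact Prod.ext (Subtype.ext (congrArg Prod.fst this)) (Subtype.ext (congrArg Prod.snd this))

lemma exists_glueOrth_eq [FiniteDimensional F V]
    (g : twistCentralizer (negOrth B) e negOrth_comm negOrth_mul_self)
    (hg : ∀ v, g.1.1 (e.1 v) = e.1 (g.1.1 v)) : ∃ p, glueOrth h2 hB e hee p = g := by
  have hc := isCompl_fixSub_negSub h2 (congrArg Subtype.val hee)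
  refine ⟨⟨⟨resEquiv g.1.1 (map_mem_fixSub hg), fun x y => g.1.2 x y⟩,
    ⟨resEquiv g.1.1 (map_mem_negSub hg), fun x y => g.1.2 x y⟩⟩, ?_⟩
  exact Subtype.ext (Subtype.ext (glue_resEquiv hc g.1.1 _ _))

instance finite_linearEquiv [Finite V] : Finite (V ≃ₗ[F] V) := DFunLike.finite _

lemma twistCentralizer_ext (h2 : (2 : F) ≠ 0) {e : orth B} (hee : e * e = 1)
    {g g' : twistCentralizer (negOrth B) e negOrth_comm negOrth_mul_self}
    (hU : ∀ u : fixSub e.1, g.1.1 u = g'.1.1 u) (hW : ∀ w : negSub e.1, g.1.1 w = g'.1.1 w) :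
    g = g' := by
  refine Subtype.ext (Subtype.ext (LinearEquiv.ext fun v => ?_))
  obtain ⟨u, w, rfl⟩ := exists_add_of_isCompl
    (isCompl_fixSub_negSub h2 (congrArg Subtype.val hee)) v
  rw [map_add g.1.1, map_add g'.1.1, hU, hW]

lemma good_twistCentralizer [Finite V] (h2 : (2 : F) ≠ 0) (hB : IsForm B) {e : orth B}
    (hee : e * e = 1) (he1 : e ≠ 1) (hez : e ≠ negOrth B)
    (ih : ∀ U : Submodule F V, U ≠ ⊤ → IsForm (B.restrict U) → Good (orth (B.restrict U))) :
    Good (twistCentralizer (negOrth B) e negOrth_comm negOrth_mul_self) := by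
  have : FiniteDimensional F V := Module.Finite.of_finite
  have hc := isCompl_fixSub_negSub h2 (congrArg Subtype.val hee)
  have ho := fixSub_negSub_ortho h2 e.2
  have hU : fixSub e.1 ≠ ⊤ := fun h => he1 (Subtype.ext (LinearEquiv.ext fun v =>
    mem_fixSub.1 (h ▸ Submodule.mem_top)))
  have hW : negSub e.1 ≠ ⊤ := fun h => hez (Subtype.ext (LinearEquiv.ext fun v =>
    mem_negSub.1 (h ▸ Submodule.mem_top)))
  have hgU := ih _ hU (hB.restrict (hB.nondeg_of_isCompl hc ho))
  have hgW := ih _ hW (hB.restrict (hB.nondeg_of_isCompl hc.symm fun u hu w hw =>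
    (hB.symm _ _).trans (ho w hw u hu)))
  by_cases hsw : ∃ s : twistCentralizer (negOrth B) e negOrth_comm negOrth_mul_self,
      ∀ v, s.1.1 (e.1 v) = - e.1 (s.1.1 v)
  swap
  · refine (hgU.prod hgW).of_surjective (glueOrth h2 hB e hee) fun g => ?_
    rcases mem_twistCentralizer_negOrth.1 g.2 with h | h
    · exact exists_glueOrth_eq h2 hB hee g h
    · exact absurd ⟨g, h⟩ hsw
  obtain ⟨r, hr⟩ := hsw
  obtain ⟨p₀, hp₀⟩ := exists_glueOrth_eq h2 hB hee (r * r) fun v => by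
    show r.1.1 (r.1.1 (e.1 v)) = e.1 (r.1.1 (r.1.1 v))
    rw [hr, map_neg r.1.1, hr, neg_neg]
  have hrU : ∀ u ∈ fixSub e.1, r.1.1 u ∈ negSub e.1 := fun u hu => by
    have := hr u
    rw [mem_fixSub.1 hu] at this
    rw [mem_negSub]
    exact (neg_eq_iff_eq_neg.2 this).symm
  have hrW : ∀ w ∈ negSub e.1, r.1.1 w ∈ fixSub e.1 := fun w hw => by
    have := hr w
    rw [mem_negSub.1 hw, map_neg r.1.1, neg_inj] at this
    rw [mem_fixSub, ← this]
  obtain ⟨s, hs⟩ : ∃ s, s = r * glueOrth h2 hB e hee (1, p₀.2⁻¹) := ⟨_, rfl⟩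
  have hsu : ∀ u : fixSub e.1, s.1.1 u = r.1.1 u := fun u => by
    rw [hs]
    exact congrArg r.1.1 (glueOrth_apply_left h2 hB hee _ u)
  have hsw' : ∀ w : negSub e.1, s.1.1 w = r.1.1 (p₀.2⁻¹.1 w : negSub e.1) := fun w => by
    rw [hs]
    exact congrArg r.1.1 (glueOrth_apply_right h2 hB hee _ w)
  have hsU : ∀ u ∈ fixSub e.1, s.1.1 u ∈ negSub e.1 := fun u hu => by
    rw [hsu ⟨u, hu⟩]
    exact hrU u hu
  have hsW : ∀ w ∈ negSub e.1, s.1.1 w ∈ fixSub e.1 := fun w hw => by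
    rw [hsw' ⟨w, hw⟩]
    exact hrW _ (Subtype.prop _)
  have hrs : ∀ w ∈ negSub e.1, r.1.1 (s.1.1 w) = w := fun w hw => by
    rw [hsw' ⟨w, hw⟩]
    have h1 := glueOrth_apply_right h2 hB hee p₀ (p₀.2⁻¹.1 ⟨w, hw⟩)
    rw [hp₀] at h1
    refine h1.trans ?_
    exact congrArg Subtype.val (LinearEquiv.congr_fun
      (congrArg Subtype.val (mul_inv_cancel p₀.2)) (⟨w, hw⟩ : negSub e.1))
  have hssU : ∀ u ∈ fixSub e.1, s.1.1 (s.1.1 u) = u := fun u hu => r.1.1.injective (by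
    rw [hrs _ (hsU u hu), hsu ⟨u, hu⟩])
  have hssW : ∀ w ∈ negSub e.1, s.1.1 (s.1.1 w) = w := fun w hw => by
    rw [hsu ⟨_, hsW w hw⟩, hrs w hw]
  let φ : fixSub e.1 ≃ₗ[F] negSub e.1 := LinearEquiv.ofLinearMap
    ((s.1.1 : V →ₗ[F] V).restrict hsU) ((s.1.1 : V →ₗ[F] V).restrict hsW)
    (LinearMap.ext fun w => Subtype.ext (hssW w w.2))
    (LinearMap.ext fun u => Subtype.ext (hssU u u.2))
  let c := orthCongr (B := B.restrict (fixSub e.1)) (B' := B.restrict (negSub e.1)) φ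
    fun x y => s.1.2 x y
  have hc1 : ∀ b (w : negSub e.1), ((c b).1 w : V) = s.1.1 (b.1 ⟨s.1.1 w, hsW w w.2⟩) :=
    fun b w => rfl
  let f := (glueOrth h2 hB e hee).comp
    ((MonoidHom.id (orth (B.restrict (fixSub e.1)))).prodMap c.toMonoidHom)
  have hfU : ∀ p (u : fixSub e.1), (f p).1.1 u = p.1.1 u := fun p u =>
    glueOrth_apply_left h2 hB hee _ u
  have hfW : ∀ p (w : negSub e.1), (f p).1.1 w = s.1.1 (p.2.1 ⟨s.1.1 w, hsW w w.2⟩) := fun p w =>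
    (glueOrth_apply_right h2 hB hee _ w).trans (hc1 p.2 w)
  have hss : s * s = 1 := twistCentralizer_ext h2 hee (fun u => hssU u u.2) fun w => hssW w w.2
  have hsurj : ∀ γ : twistCentralizer (negOrth B) e negOrth_comm negOrth_mul_self,
      (∀ v, γ.1.1 (e.1 v) = e.1 (γ.1.1 v)) → ∃ p, γ = f p := fun γ hγ => by
    obtain ⟨p, hp⟩ := exists_glueOrth_eq h2 hB hee γ hγ
    exact ⟨(p.1, c.symm p.2), by simp [f, hp]⟩
  have hse : ∀ v, s.1.1 (e.1 v) = - e.1 (s.1.1 v) := fun v => by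
    obtain ⟨u, w, rfl⟩ := exists_add_of_isCompl hc v
    rw [map_add e.1, map_add s.1.1, map_add s.1.1, map_add e.1, mem_fixSub.1 u.2, mem_negSub.1 w.2,
      mem_negSub.1 (hsU u u.2), mem_fixSub.1 (hsW w w.2), map_neg s.1.1, neg_add, neg_neg]
  refine hgU.wreath f ?_ s ?_ ?_ ?_
  · exact (glueOrth_injective h2 hB hee).comp
      (Function.injective_id.prodMap c.injective)
  · refine fun a b => twistCentralizer_ext h2 hee (fun u => ?_) fun w => ?_
    · show s.1.1 ((f (a, b)).1.1 (s.1.1 u)) = _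
      rw [hfU, hfW (a, b) ⟨s.1.1 u, hsU u u.2⟩, hssU _ (Subtype.prop _)]
      congr 2
      exact Subtype.ext (hssU u u.2)
    · show s.1.1 ((f (a, b)).1.1 (s.1.1 w)) = _
      rw [hfW, hfU (a, b) ⟨s.1.1 w, hsW w w.2⟩]
  · intro p hp
    refine hez (Subtype.ext (LinearEquiv.ext fun v => ?_))
    obtain ⟨u, w, rfl⟩ := exists_add_of_isCompl hc v
    have h1 : s.1.1 u ∈ fixSub e.1 := by rw [← hp, hfU]; exact Subtype.prop _
    have h2 : s.1.1 u = 0 := (Submodule.disjoint_def.1 hc.disjoint) _ h1 (hsU u u.2)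
    rw [map_eq_zero_iff _ s.1.1.injective] at h2
    rw [h2, zero_add, mem_negSub.1 w.2]
    rfl
  · intro γ
    rcases mem_twistCentralizer_negOrth.1 γ.2 with h | h
    · obtain ⟨p, hp⟩ := hsurj γ h
      exact ⟨p, Or.inl hp⟩
    · obtain ⟨p, hp⟩ := hsurj (γ * s) fun v => by
        show γ.1.1 (s.1.1 (e.1 v)) = e.1 (γ.1.1 (s.1.1 v))
        rw [hse, map_neg γ.1.1, h, neg_neg]
      exact ⟨p, Or.inr (by rw [← hp, mul_assoc, hss, mul_one])⟩

lemma good_of_subsingleton {G : Type*} [Group G] [Subsingleton G] : Good G :=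
  good_of_dihedral ⊤ (by rw [Subgroup.card_top]; omega) 1 1 (Subsingleton.elim _ _)
    (Subsingleton.elim _ _) trivial trivial fun _ _ => ⟨0, Or.inl (Subsingleton.elim _ _)⟩

lemma conj_eq_inv_of_coprime {G : Type*} [Group G] {x c t : G} (hc : Commute x c)
    (hco : (orderOf x).Coprime (orderOf c)) (ht : t * (x * c) * t⁻¹ = (x * c)⁻¹) :
    t * x * t⁻¹ = x⁻¹ := by
  obtain ⟨k, hk1, hk2⟩ := Nat.chineseRemainder hco 1 0
  have h : (x * c) ^ k = x := by
    rw [hc.mul_pow, (pow_eq_pow_iff_modEq (x := x) (m := 1)).2 hk1, pow_one,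
      (pow_eq_pow_iff_modEq (x := c) (m := 0)).2 hk2, pow_zero, mul_one]
  rw [← h, ← conj_pow, ht, inv_pow]

lemma exists_twist_or_good_of_le {G : Type*} [Group G] [Finite G] {x z : G} (hx : Odd (orderOf x))
    (hz : ∀ g, g * z = z * g) (hz1 : z ≠ 1) (hzz : z * z = 1)
    (hinv : ∀ g : G, ∃ t, t * t = 1 ∧ t * g * t⁻¹ = g⁻¹) {T : Subgroup G} (hT : IsPGroup 2 T)
    (hTx : T ≤ extCentralizer x) : ∃ S : Subgroup G, Subgroup.zpowers x ⊔ T ≤ S ∧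
      ((∃ e, e * e = 1 ∧ e ≠ 1 ∧ e ≠ z ∧ S ≤ twistCentralizer z e hz hzz) ∨ Good S) := by
  let x' : extCentralizer x := ⟨x, Or.inl (mul_inv_cancel_right x x)⟩
  let z' : extCentralizer x := ⟨z, Or.inl (by rw [← hz, mul_inv_cancel_right])⟩
  have hz' : ∀ g, g * z' = z' * g := fun g => Subtype.ext (hz g.1)
  have hzz' : z' * z' = 1 := Subtype.ext hzz
  obtain ⟨P, hP⟩ := (hT.comap_subtype (K := extCentralizer x)).exists_le_sylow
  refine ⟨(Subgroup.zpowers x' ⊔ (P : Subgroup _)).map (extCentralizer x).subtype,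
    sup_le ((Subgroup.zpowers_le).2 ⟨x', le_sup_left (a := Subgroup.zpowers x')
      (Subgroup.mem_zpowers _), rfl⟩) fun t ht => ⟨⟨t, hTx ht⟩,
        le_sup_right (a := Subgroup.zpowers x') (hP ht), rfl⟩, ?_⟩
  have hinv' : ∀ c : extCentralizer x, c * x' * c⁻¹ = x' → (orderOf x').Coprime (orderOf c) →
      ∃ t, t * t = 1 ∧ t * x' * t⁻¹ = x'⁻¹ ∧ t * c * t⁻¹ = c⁻¹ := fun c hc hco => by
    obtain ⟨t, htt, ht⟩ := hinv (x * c)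
    have hcx : Commute x c := (mul_inv_eq_iff_eq_mul.1 (congrArg Subtype.val hc)).symm
    rw [← Subgroup.orderOf_coe, ← Subgroup.orderOf_coe] at hco
    have htx := conj_eq_inv_of_coprime hcx hco ht
    rw [hcx.eq] at ht
    exact ⟨⟨t, Or.inr htx⟩, Subtype.ext htt, Subtype.ext htx,
      Subtype.ext (conj_eq_inv_of_coprime hcx.symm hco.symm ht)⟩
  rcases exists_twist_or_good (x := x') (z := z') (by rwa [← Subgroup.orderOf_coe])
    (fun g => g.2.imp Subtype.ext Subtype.ext) hz' (fun h => hz1 (congrArg Subtype.val h)) hzz'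
    hinv' P with ⟨e, hee, he1, hez, hS⟩ | hG
  · refine Or.inl ⟨e.1, congrArg Subtype.val hee, fun h => he1 (Subtype.ext h),
      fun h => hez (Subtype.ext h), ?_⟩
    rintro _ ⟨g, hg, rfl⟩
    exact (hS hg).imp (congrArg Subtype.val) (congrArg Subtype.val)
  · exact Or.inr (hG.of_equiv (Subgroup.equivMapOfInjective _
      (extCentralizer x).subtype Subtype.coe_injective))

theorem good_orth {F : Type*} [Field F] (h2 : (2 : F) ≠ 0) {V : Type*} [AddCommGroup V]
    [Module F V] [Finite V] {B : LinearMap.BilinForm F V} (hB : IsForm B) : Good (orth B) := by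
  obtain ⟨n, hn⟩ : ∃ n, Module.finrank F V = n := ⟨_, rfl⟩
  induction n using Nat.strong_induction_on generalizing V with
  | _ n ih =>
    have : FiniteDimensional F V := Module.Finite.of_finite
    rcases subsingleton_or_nontrivial V with hV | hV
    · have : Subsingleton (orth B) :=
        ⟨fun a b => Subtype.ext (LinearEquiv.ext fun x => Subsingleton.elim _ _)⟩
      exact good_of_subsingleton
    have ih' : ∀ U : Submodule F V, U ≠ ⊤ → IsForm (B.restrict U) → Good (orth (B.restrict U)) :=
      fun U hU hBU => ih _ (hn ▸ Submodule.finrank_lt hU) hBU rfl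
    have := Fintype.ofFinite (orth B)
    have hinv : ∀ g : orth B, ∃ t, t * t = 1 ∧ t * g * t⁻¹ = g⁻¹ := fun g => by
      obtain ⟨t, ht, h, h'⟩ := exists_involution_conj h2 hB g.2
      exact ⟨⟨t, ht⟩, Subtype.ext h, Subtype.ext h'⟩
    have hz1 : negOrth B ≠ 1 := fun h => by
      obtain ⟨v, hv⟩ := exists_ne (0 : V)
      have h1 : -v = v := LinearEquiv.congr_fun (congrArg Subtype.val h) v
      rw [neg_eq_iff_add_eq_zero, ← two_smul F, smul_eq_zero] at h1
      exact h1.elim h2 hv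
    intro M _ _ _ ρ hρ A hA ha
    by_contra hA0
    refine not_irr_of_splits ρ (fun x => (hinv x).imp fun t ht => ht.2) (fun x hx T hT hTx => ?_) hρ
    obtain ⟨S, hle, ⟨e, hee, he1, hez, hS⟩ | hG⟩ :=
      exists_twist_or_good_of_le hx negOrth_comm hz1 negOrth_mul_self hinv hT hTx
    · exact ((good_twistCentralizer h2 hB hee he1 hez ih').splits ρ hA ha
        (hρ.nondeg hA hA0)).mono (hle.trans hS)
    · exact (hG.splits ρ hA ha (hρ.nondeg hA hA0)).mono hle

end Eigen

section Hyperbolic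

variable {F V : Type*} [Field F] [AddCommGroup V] [Module F V] {B : LinearMap.BilinForm F V}

/-- A hyperbolic pair of vectors. -/
structure IsHyperbolic (B : LinearMap.BilinForm F V) (v w : V) : Prop where
  left : B v v = 0
  pair : B v w = 1
  right : B w w = 0

lemma IsForm.exists_isHyperbolic (h2 : (2 : F) ≠ 0) (hB : IsForm B) {v : V} (hv : v ≠ 0)
    (hvv : B v v = 0) : ∃ w, IsHyperbolic B v w := by
  obtain ⟨y, hy⟩ : ∃ y, B v y ≠ 0 := by
    by_contra! h
    exact hv (hB.nondeg v h)
  obtain ⟨z, hz⟩ : ∃ z, B v z = 1 :=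
    ⟨(B v y)⁻¹ • y, by rw [map_smul, smul_eq_mul, inv_mul_cancel₀ hy]⟩
  refine ⟨z - (B z z / 2) • v, hvv, ?_, ?_⟩
  · rw [map_sub, map_smul, hvv, hz, smul_zero, sub_zero]
  · simp only [map_sub, map_smul, LinearMap.sub_apply, LinearMap.smul_apply, smul_eq_mul, hvv, hz,
      hB.symm z v]
    field_simp
    ring

/-- The orthogonal complement of a pair of vectors. -/
def hypPerp (B : LinearMap.BilinForm F V) (v w : V) : Submodule F V :=
  LinearMap.ker (B v) ⊓ LinearMap.ker (B w)

variable {v w : V}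

lemma mem_hypPerp {x : V} : x ∈ hypPerp B v w ↔ B v x = 0 ∧ B w x = 0 := by
  rw [hypPerp, Submodule.mem_inf, LinearMap.mem_ker, LinearMap.mem_ker]

/-- The projection onto the orthogonal complement of a hyperbolic pair. -/
def hypProj (hB : IsForm B) (h : IsHyperbolic B v w) : V →ₗ[F] hypPerp B v w :=
  LinearMap.codRestrict _ (LinearMap.id - (B w).smulRight v - (B v).smulRight w) fun x => by
    rw [mem_hypPerp]
    simp [h.left, h.right, h.pair, hB.symm w v]

lemma hypProj_apply (hB : IsForm B) (h : IsHyperbolic B v w) (x : V) :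
    (hypProj hB h x : V) = x - B w x • v - B v x • w := rfl

lemma hypProj_add_smul (hB : IsForm B) (h : IsHyperbolic B v w) (x : hypPerp B v w) (a : F) :
    hypProj hB h (x + a • v) = x := by
  obtain ⟨h1, h2⟩ := mem_hypPerp.1 x.2
  ext
  simp [hypProj_apply, h1, h2, h.left, hB.symm w v, h.pair]

/-- The decomposition of the space along a hyperbolic pair. -/
def hypEquiv (hB : IsForm B) (h : IsHyperbolic B v w) : (F × F × hypPerp B v w) ≃ₗ[F] V where
  toFun p := p.1 • v + p.2.1 • w + p.2.2
  invFun x := (B w x, B v x, hypProj hB h x)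
  map_add' p p' := by simp only [Prod.fst_add, Prod.snd_add, Submodule.coe_add]; module
  map_smul' c p := by
    simp only [Prod.smul_fst, Prod.smul_snd, Submodule.coe_smul, RingHom.id_apply, smul_eq_mul]
    module
  left_inv p := by
    obtain ⟨a, b, x⟩ := p
    obtain ⟨h1, h2⟩ := mem_hypPerp.1 x.2
    have hwv : B w v = 1 := (hB.symm w v).trans h.pair
    refine Prod.ext ?_ (Prod.ext ?_ (Subtype.ext ?_))
    · simp [h2, h.right, hwv]
    · simp [h1, h.left, h.pair]
    · rw [hypProj_apply]
      simp [h1, h2, h.left, h.right, hwv, h.pair]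
      abel
  right_inv x := by
    change B w x • v + B v x • w + (hypProj hB h x : V) = x
    rw [hypProj_apply]
    module

lemma hypEquiv_apply (hB : IsForm B) (h : IsHyperbolic B v w) (p : F × F × hypPerp B v w) :
    hypEquiv hB h p = p.1 • v + p.2.1 • w + p.2.2 := rfl

lemma form_hypEquiv (hB : IsForm B) (h : IsHyperbolic B v w) (p p' : F × F × hypPerp B v w) :
    B (hypEquiv hB h p) (hypEquiv hB h p') =
      p.1 * p'.2.1 + p.2.1 * p'.1 + B p.2.2 p'.2.2 := by
  obtain ⟨h1, h2⟩ := mem_hypPerp.1 p.2.2.2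
  obtain ⟨h3, h4⟩ := mem_hypPerp.1 p'.2.2.2
  rw [hB.symm] at h1 h2
  simp [hypEquiv_apply, h1, h2, h3, h4, h.left, h.right, h.pair, hB.symm w v]

lemma IsForm.restrict_hypPerp (hB : IsForm B) (h : IsHyperbolic B v w) :
    IsForm (B.restrict (hypPerp B v w)) := by
  refine hB.restrict fun u hu h0 => hB.nondeg u fun y => ?_
  obtain ⟨p, rfl⟩ := (hypEquiv hB h).surjective y
  obtain ⟨h1, h2⟩ := mem_hypPerp.1 hu
  rw [hB.symm] at h1 h2
  simp [hypEquiv_apply, h1, h2, h0 p.2.2 p.2.2.2]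

lemma finrank_hypPerp [FiniteDimensional F V] (hB : IsForm B) (h : IsHyperbolic B v w) :
    Module.finrank F V = Module.finrank F (hypPerp B v w) + 2 := by
  rw [← (hypEquiv hB h).finrank_eq, Module.finrank_prod, Module.finrank_prod, Module.finrank_self]
  ring

end Hyperbolic

section Isotropic

universe u

variable {F : Type*} [Field F]

lemma IsForm.exists_isotropic {V : Type*} [Finite F] (h2 : (2 : F) ≠ 0) [AddCommGroup V]
    [Module F V] [FiniteDimensional F V] {B : LinearMap.BilinForm F V} (hB : IsForm B)
    (hd : 3 ≤ Module.finrank F V) : ∃ v, v ≠ 0 ∧ B v v = 0 := by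
  have := Fintype.ofFinite F
  by_contra! hani
  have hpos : 0 < Module.finrank F V := by omega
  have := Module.nontrivial_of_finrank_pos hpos
  obtain ⟨e₁, he₁⟩ := exists_ne (0 : V)
  obtain ⟨e₂, he₂, hn₂⟩ := (Submodule.ne_bot_iff _).1
    (LinearMap.ker_ne_bot_of_finrank_lt (f := B e₁) (by rw [Module.finrank_self]; omega))
  obtain ⟨e₃, he₃, hn₃⟩ := (Submodule.ne_bot_iff _).1
    (LinearMap.ker_ne_bot_of_finrank_lt (f := (B e₁).prod (B e₂))
      (by rw [Module.finrank_prod, Module.finrank_self]; omega))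
  rw [LinearMap.mem_ker] at he₂ he₃
  obtain ⟨h13, h23⟩ := Prod.mk.inj he₃
  have hodd : Fintype.card F % 2 = 1 := by
    refine FiniteField.odd_card_of_char_ne_two fun hc => h2 ?_
    have := ringChar.of_eq hc
    exact CharTwo.two_eq_zero
  obtain ⟨a, b, hab⟩ := FiniteField.exists_root_sum_quadratic
    (f := Polynomial.C (B e₁ e₁) * Polynomial.X ^ 2)
    (g := Polynomial.C (B e₂ e₂) * Polynomial.X ^ 2 + Polynomial.C (B e₃ e₃))
    (by rw [Polynomial.degree_C_mul_X_pow _ (hani e₁ he₁)]; rfl)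
    (by
      rw [Polynomial.degree_add_C, Polynomial.degree_C_mul_X_pow _ (hani e₂ hn₂)]
      · rfl
      · rw [Polynomial.degree_C_mul_X_pow _ (hani e₂ hn₂)]; norm_num) hodd
  simp only [Polynomial.eval_mul, Polynomial.eval_C, Polynomial.eval_pow, Polynomial.eval_X,
    Polynomial.eval_add] at hab
  have hx : B e₃ (a • e₁ + b • e₂ + e₃) = B e₃ e₃ := by
    simp [hB.symm e₃ e₁, hB.symm e₃ e₂, h13, h23]
  refine hani (a • e₁ + b • e₂ + e₃) (fun h0 => hani e₃ hn₃ ?_) ?_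
  · rw [← hx, h0, map_zero]
  · simp only [map_add, LinearMap.add_apply, map_smul, LinearMap.smul_apply, smul_eq_mul,
      hB.symm e₃ e₁, hB.symm e₃ e₂, hB.symm e₂ e₁, h13, h23, he₂]
    linear_combination hab

/-- Isotropic vectors along a hyperbolic decomposition. -/
def isotropicParam {V : Type*} [AddCommGroup V] [Module F V] {B : LinearMap.BilinForm F V}
    (hB : IsForm B) {v w : V} (h : IsHyperbolic B v w) :
    (Fˣ × hypPerp B v w) ⊕ (F × {x : hypPerp B v w // B.restrict (hypPerp B v w) x x = 0}) → V
  | .inl p => hypEquiv hB h (p.1, -(B p.2 p.2) / (2 * p.1), p.2)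
  | .inr p => hypEquiv hB h (0, p.1, p.2)

lemma isotropicParam_injective {V : Type*} [AddCommGroup V] [Module F V]
    {B : LinearMap.BilinForm F V} (hB : IsForm B) {v w : V} (h : IsHyperbolic B v w) :
    Function.Injective (isotropicParam hB h) := by
  rintro (⟨a, x⟩ | ⟨a, x⟩) (⟨b, y⟩ | ⟨b, y⟩) hxy <;>
    have hxy := (hypEquiv hB h).injective hxy <;>
    simp only [Prod.mk.injEq] at hxy
  · rw [Units.ext hxy.1, hxy.2.2]
  · exact absurd hxy.1 a.ne_zero
  · exact absurd hxy.1.symm b.ne_zero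
  · rw [hxy.2.1, Subtype.ext hxy.2.2]

lemma range_isotropicParam {V : Type*} [AddCommGroup V] [Module F V] (h2 : (2 : F) ≠ 0)
    {B : LinearMap.BilinForm F V} (hB : IsForm B) {v w : V} (h : IsHyperbolic B v w) :
    Set.range (isotropicParam hB h) = {x | B x x = 0} := by
  ext x
  rw [Set.mem_range, Set.mem_ofPred_eq]
  constructor
  · rintro ⟨⟨a, x⟩ | ⟨a, x⟩, rfl⟩
    · rw [isotropicParam, form_hypEquiv]
      have := a.ne_zero
      field_simp
      ring
    · rw [isotropicParam, form_hypEquiv]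
      have := x.2
      rw [LinearMap.BilinForm.restrict_apply] at this
      simpa using this
  · intro hx
    obtain ⟨⟨a, b, y⟩, rfl⟩ := (hypEquiv hB h).surjective x
    rw [form_hypEquiv] at hx
    by_cases ha : a = 0
    · subst ha
      exact ⟨.inr ⟨b, y, by simpa using hx⟩, rfl⟩
    · refine ⟨.inl ⟨Units.mk0 a ha, y⟩, ?_⟩
      rw [isotropicParam]
      have : -(B y y) / (2 * (Units.mk0 a ha : Fˣ)) = b := by
        rw [Units.val_mk0]
        field_simp
        linear_combination -hx
      rw [this]
      rfl

lemma natCard_isotropic [Finite F] (h2 : (2 : F) ≠ 0) (m : ℕ) :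
    ∀ {V : Type u} [AddCommGroup V] [Module F V] [Finite V] {B : LinearMap.BilinForm F V},
      IsForm B → Module.finrank F V = 2 * m + 1 →
      Nat.card {v : V // B v v = 0} = Nat.card F ^ (2 * m) := by
  induction m with
  | zero =>
    intro V _ _ _ B hB hV
    have : Module.Finite F V := Module.Finite.of_finite
    obtain ⟨v₀, hv₀, hspan⟩ := finrank_eq_one_iff'.1 hV
    have hne : B v₀ v₀ ≠ 0 := fun h => hv₀ <| hB.nondeg v₀ fun y => by
      obtain ⟨c, rfl⟩ := hspan y
      rw [map_smul, h, smul_zero]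
    rw [mul_zero, pow_zero, Nat.card_eq_one_iff_unique]
    refine ⟨⟨fun x y => ?_⟩, ⟨0, by simp⟩⟩
    have key : ∀ x : V, B x x = 0 → x = 0 := fun x hx => by
      obtain ⟨c, rfl⟩ := hspan x
      simp only [map_smul, LinearMap.smul_apply, smul_eq_mul, mul_eq_zero, hne, or_false,
        or_self] at hx
      rw [hx, zero_smul]
    exact Subtype.ext ((key x x.2).trans (key y y.2).symm)
  | succ m ih =>
    intro V _ _ _ B hB hV
    have : Module.Finite F V := Module.Finite.of_finite
    obtain ⟨v, hv, hvv⟩ := hB.exists_isotropic h2 (by omega)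
    obtain ⟨w, h⟩ := hB.exists_isHyperbolic h2 hv hvv
    have hW : Module.finrank F (hypPerp B v w) = 2 * m + 1 := by
      have := finrank_hypPerp hB h
      omega
    have hcard : Nat.card {v : V // B v v = 0} = Nat.card ((Fˣ × hypPerp B v w) ⊕
        (F × {x : hypPerp B v w // B.restrict (hypPerp B v w) x x = 0})) := by
      rw [← Nat.card_range_of_injective (isotropicParam_injective hB h),
        range_isotropicParam h2 hB h]
      rfl
    rw [hcard, Nat.card_sum, Nat.card_prod, Nat.card_prod, ih (hB.restrict_hypPerp h) hW,
      Module.natCard_eq_pow_finrank (K := F) (V := hypPerp B v w), hW, Nat.card_units]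
    have : 0 < Nat.card F := Nat.card_pos
    obtain ⟨r, hr⟩ := Nat.exists_eq_succ_of_ne_zero this.ne'
    rw [hr, Nat.succ_sub_one]
    simp only [Nat.succ_eq_add_one]
    ring

end Isotropic

section Graph

variable {F V : Type*} [Field F] [AddCommGroup V] [Module F V] {B : LinearMap.BilinForm F V}

/-- The form `B` is nondegenerate on `A`. -/
def IsNondegSub (B : LinearMap.BilinForm F V) (A : Submodule F V) : Prop :=
  ∀ a ∈ A, (∀ w ∈ A, B a w = 0) → a = 0

/-- The nondegenerate subspaces of dimension `d`. -/
abbrev NondegSub (B : LinearMap.BilinForm F V) (d : ℕ) : Type _ :=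
  {A : Submodule F V // IsNondegSub B A ∧ Module.finrank F A = d}

variable {v w : V}

/-- The embedding of a subspace of the perp of a hyperbolic pair as a graph over it. -/
def graphMap (v w : V) (A : Submodule F (hypPerp B v w)) (f : Module.Dual F A) : A →ₗ[F] V :=
  (hypPerp B v w).subtype ∘ₗ A.subtype + f.smulRight v

lemma graphMap_apply (A : Submodule F (hypPerp B v w)) (f : Module.Dual F A) (a : A) :
    graphMap v w A f a = ((a : hypPerp B v w) : V) + f a • v := rfl

lemma hypProj_graphMap (hB : IsForm B) (h : IsHyperbolic B v w) (A : Submodule F (hypPerp B v w))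
    (f : Module.Dual F A) (a : A) : hypProj hB h (graphMap v w A f a) = a :=
  hypProj_add_smul hB h a (f a)

lemma graphMap_injective (hB : IsForm B) (h : IsHyperbolic B v w)
    (A : Submodule F (hypPerp B v w)) (f : Module.Dual F A) :
    Function.Injective (graphMap v w A f) := fun a b hab => by
  have := congrArg (hypProj hB h) hab
  rw [hypProj_graphMap, hypProj_graphMap] at this
  exact Subtype.ext this

lemma form_graphMap (hB : IsForm B) (h : IsHyperbolic B v w) (A : Submodule F (hypPerp B v w))
    (f : Module.Dual F A) (a b : A) :
    B (graphMap v w A f a) (graphMap v w A f b) = B (a : hypPerp B v w) (b : hypPerp B v w) := by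
  have ha := (mem_hypPerp.1 (a : hypPerp B v w).2).1
  have hb := (mem_hypPerp.1 (b : hypPerp B v w).2).1
  rw [hB.symm] at ha
  simp [graphMap_apply, ha, hb, h.left]

lemma isNondegSub_range_graphMap (hB : IsForm B) (h : IsHyperbolic B v w)
    (A : Submodule F (hypPerp B v w)) (f : Module.Dual F A) :
    IsNondegSub B (LinearMap.range (graphMap v w A f)) ↔
      IsNondegSub (B.restrict (hypPerp B v w)) A := by
  constructor
  · intro hn a ha h0
    have := hn _ (LinearMap.mem_range_self (graphMap v w A f) ⟨a, ha⟩) (by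
      rintro _ ⟨b, rfl⟩
      rw [form_graphMap hB h]
      exact h0 b b.2)
    exact congrArg Subtype.val ((map_eq_zero_iff _ (graphMap_injective hB h A f)).1 this)
  · rintro hn _ ⟨a, rfl⟩ h0
    have : a = 0 := Subtype.ext (hn a a.2 fun b hb => by
      have := h0 _ (LinearMap.mem_range_self (graphMap v w A f) ⟨b, hb⟩)
      rwa [form_graphMap hB h] at this)
    rw [this, map_zero]

lemma map_hypProj_range_graphMap (hB : IsForm B) (h : IsHyperbolic B v w)
    (A : Submodule F (hypPerp B v w)) (f : Module.Dual F A) :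
    (LinearMap.range (graphMap v w A f)).map (hypProj hB h) = A := by
  ext x
  constructor
  · rintro ⟨_, ⟨a, rfl⟩, rfl⟩
    rw [hypProj_graphMap]
    exact a.2
  · intro hx
    exact ⟨_, ⟨⟨x, hx⟩, rfl⟩, hypProj_graphMap hB h A f ⟨x, hx⟩⟩

lemma graphMap_range_inj (hB : IsForm B) (h : IsHyperbolic B v w) (hv : v ≠ 0)
    {A : Submodule F (hypPerp B v w)} {f f' : Module.Dual F A}
    (hr : LinearMap.range (graphMap v w A f) = LinearMap.range (graphMap v w A f')) : f = f' := by
  ext a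
  obtain ⟨b, hb⟩ := hr ▸ LinearMap.mem_range_self (graphMap v w A f) a
  have hba : b = a := by
    have := congrArg (hypProj hB h) hb
    rw [hypProj_graphMap, hypProj_graphMap] at this
    exact Subtype.ext this
  subst hba
  rw [graphMap_apply, graphMap_apply] at hb
  exact (smul_left_injective F hv (add_left_cancel hb)).symm

lemma exists_graphMap (hB : IsForm B) (h : IsHyperbolic B v w) {A : Submodule F V}
    (hA : IsNondegSub B A) (hAv : ∀ a ∈ A, B v a = 0) :
    ∃ (A' : Submodule F (hypPerp B v w)) (f : Module.Dual F A'),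
      LinearMap.range (graphMap v w A' f) = A := by
  have hdec : ∀ a ∈ A, (hypProj hB h a : V) + B w a • v = a := fun a ha => by
    rw [hypProj_apply, hAv a ha]
    simp
  set φ : A →ₗ[F] hypPerp B v w := (hypProj hB h).domRestrict A with hφ
  have hinj : Function.Injective φ := by
    rw [← LinearMap.ker_eq_bot, LinearMap.ker_eq_bot']
    intro a ha
    have h1 := hdec a a.2
    have h2 : hypProj hB h a = 0 := ha
    rw [h2, Submodule.coe_zero, zero_add] at h1
    exact Subtype.ext (hA a a.2 fun y hy => by
      rw [← h1, map_smul, LinearMap.smul_apply, hAv y hy, smul_zero])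
  let e := LinearEquiv.ofInjective φ hinj
  have he : ∀ a : A, graphMap v w (LinearMap.range φ)
      (((B w).domRestrict A) ∘ₗ (e.symm : LinearMap.range φ →ₗ[F] A)) (e a) = a := fun a => by
    rw [graphMap_apply]
    simp only [LinearMap.comp_apply, LinearEquiv.coe_coe, LinearEquiv.symm_apply_apply]
    exact hdec a a.2
  refine ⟨LinearMap.range φ, ((B w).domRestrict A) ∘ₗ (e.symm : LinearMap.range φ →ₗ[F] A), ?_⟩
  ext x
  constructor
  · rintro ⟨b, rfl⟩
    obtain ⟨a, rfl⟩ := e.surjective b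
    rw [he]
    exact a.2
  · intro hx
    exact ⟨e ⟨x, hx⟩, he ⟨x, hx⟩⟩

/-- Nondegenerate subspaces orthogonal to an isotropic vector, as graphs. -/
lemma natCard_nondegSub_perp [Finite F] [Finite V] (hB : IsForm B) (h : IsHyperbolic B v w)
    (hv : v ≠ 0) (d : ℕ) :
    Nat.card {A : NondegSub B d // ∀ a ∈ A.1, B v a = 0} =
      Nat.card (NondegSub (B.restrict (hypPerp B v w)) d) * Nat.card F ^ d := by
  have : Module.Finite F V := Module.Finite.of_finite
  let Φ : (Σ A : NondegSub (B.restrict (hypPerp B v w)) d, Module.Dual F A.1) →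
      {A : NondegSub B d // ∀ a ∈ A.1, B v a = 0} := fun p =>
    ⟨⟨LinearMap.range (graphMap v w p.1.1 p.2),
      (isNondegSub_range_graphMap hB h _ _).2 p.1.2.1,
      (LinearMap.finrank_range_of_inj (graphMap_injective hB h _ _)).trans p.1.2.2⟩, by
      rintro _ ⟨a, rfl⟩
      rw [graphMap_apply, map_add, map_smul, (mem_hypPerp.1 (a : hypPerp B v w).2).1, h.left,
        smul_zero, add_zero]⟩
  have hΦ : Function.Bijective Φ := by
    constructor
    · rintro ⟨⟨A, hA⟩, f⟩ ⟨⟨A', hA'⟩, f'⟩ hpp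
      have hr : LinearMap.range (graphMap v w A f) = LinearMap.range (graphMap v w A' f') :=
        congrArg (fun A => A.1.1) hpp
      have hAA : A = A' := by
        rw [← map_hypProj_range_graphMap hB h A f, hr, map_hypProj_range_graphMap]
      subst hAA
      rw [graphMap_range_inj hB h hv hr]
    · rintro ⟨⟨A, hA, hd⟩, hAv⟩
      obtain ⟨A', f, rfl⟩ := exists_graphMap hB h hA hAv
      exact ⟨⟨⟨A', (isNondegSub_range_graphMap hB h _ _).1 hA,
        (LinearMap.finrank_range_of_inj (graphMap_injective hB h _ _)).symm.trans hd⟩, f⟩, rfl⟩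
  have := Fintype.ofFinite (NondegSub (B.restrict (hypPerp B v w)) d)
  have hdual (A : NondegSub (B.restrict (hypPerp B v w)) d) :
      Nat.card (Module.Dual F A.1) = Nat.card F ^ d := by
    rw [Module.natCard_eq_pow_finrank (K := F), Subspace.dual_finrank_eq, A.2.2]
  have hfin (A : NondegSub (B.restrict (hypPerp B v w)) d) : Finite (Module.Dual F A.1) :=
    Module.finite_of_finite F
  rw [← Nat.card_eq_of_bijective Φ hΦ, Nat.card_sigma, Finset.sum_congr rfl fun A _ => hdual A,
    Finset.sum_const, smul_eq_mul, Finset.card_univ, ← Nat.card_eq_fintype_card]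

end Graph

section Count

universe u

lemma natCard_mul_eq_natCard_mul {α β : Type*} [Finite α] [Finite β] (r : α → β → Prop) {s t : ℕ}
    (hs : ∀ a, Nat.card {b // r a b} = s) (ht : ∀ b, Nat.card {a // r a b} = t) :
    Nat.card α * s = Nat.card β * t := by
  have := Fintype.ofFinite α
  have := Fintype.ofFinite β
  rw [Nat.card_eq_fintype_card, Nat.card_eq_fintype_card]
  refine Finset.card_mul_eq_card_mul r (fun a _ => ?_) fun b _ => ?_
  · rw [← hs a, Finset.bipartiteAbove, Nat.card_eq_fintype_card, Fintype.card_subtype]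
  · rw [← ht b, Finset.bipartiteBelow, Nat.card_eq_fintype_card, Fintype.card_subtype]

variable {F : Type*} [Field F]

lemma natCard_isotropic_ne_zero [Finite F] (h2 : (2 : F) ≠ 0) {m : ℕ} {V : Type u}
    [AddCommGroup V] [Module F V] [Finite V] {B : LinearMap.BilinForm F V} (hB : IsForm B)
    (hV : Module.finrank F V = 2 * m + 1) :
    Nat.card {v : V // v ≠ 0 ∧ B v v = 0} = Nat.card F ^ (2 * m) - 1 := by
  rw [← natCard_isotropic h2 m hB hV]
  have h := Set.ncard_sdiff_singleton_of_mem (s := {v : V | B v v = 0}) (a := 0) (by simp)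
  rw [← Nat.card_coe_set_eq, ← Nat.card_coe_set_eq] at h
  exact (Nat.card_congr (Equiv.subtypeEquivRight fun x => and_comm)).trans h

lemma natCard_anisotropic [Finite F] (h2 : (2 : F) ≠ 0) {m : ℕ} {V : Type u}
    [AddCommGroup V] [Module F V] [Finite V] {B : LinearMap.BilinForm F V} (hB : IsForm B)
    (hV : Module.finrank F V = 2 * m + 1) :
    Nat.card {v : V // B v v ≠ 0} = Nat.card F ^ (2 * m + 1) - Nat.card F ^ (2 * m) := by
  have : Module.Finite F V := Module.Finite.of_finite
  rw [← natCard_isotropic h2 m hB hV, ← hV, ← Module.natCard_eq_pow_finrank (K := F)]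
  have h := Set.ncard_compl {v : V | B v v = 0}
  rw [← Nat.card_coe_set_eq, ← Nat.card_coe_set_eq] at h
  exact h

lemma finrank_orthogonal_nondegSub {V : Type u} [AddCommGroup V] [Module F V]
    [FiniteDimensional F V] {B : LinearMap.BilinForm F V} (hB : IsForm B) {d : ℕ}
    (A : NondegSub B d) :
    Module.finrank F (B.orthogonal A.1) + d = Module.finrank F V := by
  have := Submodule.finrank_add_eq_of_isCompl (hB.isCompl A.2.1)
  rw [A.2.2] at this
  omega

lemma natCard_nondegSub_mul [Finite F] (h2 : (2 : F) ≠ 0) {m k N : ℕ} (hkm : k ≤ m) {V : Type u}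
    [AddCommGroup V] [Module F V] [Finite V] {B : LinearMap.BilinForm F V} (hB : IsForm B)
    (hV : Module.finrank F V = 2 * (m + 1) + 1)
    (hN : ∀ {W : Type u} [AddCommGroup W] [Module F W] [Finite W] {C : LinearMap.BilinForm F W},
      IsForm C → Module.finrank F W = 2 * m + 1 → Nat.card (NondegSub C (2 * k)) = N) :
    Nat.card (NondegSub B (2 * k)) * (Nat.card F ^ (2 * (m + 1 - k)) - 1) =
      (Nat.card F ^ (2 * (m + 1)) - 1) * (N * Nat.card F ^ (2 * k)) := by
  have : Module.Finite F V := Module.Finite.of_finite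
  rw [← natCard_isotropic_ne_zero h2 hB hV]
  refine natCard_mul_eq_natCard_mul (fun A v => ∀ a ∈ A.1, B v.1 a = 0) (fun A => ?_) fun v => ?_
  · have hd := finrank_orthogonal_nondegSub hB A
    rw [← natCard_isotropic_ne_zero (m := m + 1 - k) h2
      (hB.restrict (hB.orthogonal_nondeg A.2.1)) (by omega)]
    refine Nat.card_congr
      { toFun := fun v => ⟨⟨v.1.1, fun a ha => (hB.symm _ _).trans (v.2 a ha)⟩,
          fun h0 => v.1.2.1 (congrArg Subtype.val h0), v.1.2.2⟩
        invFun := fun v => ⟨⟨v.1.1, fun h0 => v.2.1 (Subtype.ext h0), v.2.2⟩,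
          fun a ha => (hB.symm _ _).trans (v.1.2 a ha)⟩
        left_inv := fun v => rfl
        right_inv := fun v => rfl }
  · obtain ⟨w, h⟩ := hB.exists_isHyperbolic h2 v.2.1 v.2.2
    rw [natCard_nondegSub_perp hB h v.2.1, hN (hB.restrict_hypPerp h)]
    have := finrank_hypPerp hB h
    omega

lemma natCard_nondegSub_hyperplane [Finite F] (h2 : (2 : F) ≠ 0) {m : ℕ} {V : Type u}
    [AddCommGroup V] [Module F V] [Finite V] {B : LinearMap.BilinForm F V} (hB : IsForm B)
    (hV : Module.finrank F V = 2 * m + 1) :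
    Nat.card (NondegSub B (2 * m)) = Nat.card F ^ (2 * m) := by
  have : Module.Finite F V := Module.Finite.of_finite
  have key : Nat.card (NondegSub B (2 * m)) * (Nat.card F - 1) =
      (Nat.card F ^ (2 * m + 1) - Nat.card F ^ (2 * m)) * 1 := by
    rw [← natCard_anisotropic h2 hB hV]
    refine natCard_mul_eq_natCard_mul (fun A v => ∀ a ∈ A.1, B v.1 a = 0) (fun A => ?_)
      fun v => ?_
    · have hd := finrank_orthogonal_nondegSub hB A
      have h1 := natCard_anisotropic (m := 0) h2
        (hB.restrict (hB.orthogonal_nondeg A.2.1)) (by omega)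
      rw [mul_zero, zero_add, pow_one, pow_zero] at h1
      rw [← h1]
      exact Nat.card_congr
        { toFun := fun v => ⟨⟨v.1.1, fun a ha => (hB.symm _ _).trans (v.2 a ha)⟩, v.1.2⟩
          invFun := fun v => ⟨⟨v.1.1, v.2⟩, fun a ha => (hB.symm _ _).trans (v.1.2 a ha)⟩
          left_inv := fun v => rfl
          right_inv := fun v => rfl }
    · have hker : Module.finrank F (LinearMap.ker (B v.1)) = 2 * m := by
        have h1 := LinearMap.finrank_range_add_finrank_ker (B v.1)
        have h2 : LinearMap.range (B v.1) = ⊤ := LinearMap.range_eq_top.2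
          (LinearMap.surjective fun h => v.2 (by rw [h, LinearMap.zero_apply]))
        rw [h2, finrank_top, Module.finrank_self] at h1
        omega
      rw [Nat.card_eq_one_iff_unique]
      refine ⟨⟨fun A A' => ?_⟩, ⟨⟨⟨LinearMap.ker (B v.1), fun a ha h0 => ?_, hker⟩,
        fun a ha => ha⟩⟩⟩
      · have h (A : {A : NondegSub B (2 * m) // ∀ a ∈ A.1, B v.1 a = 0}) :
            A.1.1 = LinearMap.ker (B v.1) :=
          Submodule.eq_of_le_of_finrank_eq A.2 (A.1.2.2.trans hker.symm)
        exact Subtype.ext (Subtype.ext ((h A).trans (h A').symm))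
      · refine hB.nondeg a fun y => ?_
        have h3 := h0 (y - (B v.1 y / B v.1 v.1) • v.1) (by
          rw [LinearMap.mem_ker, map_sub, map_smul, smul_eq_mul, div_mul_cancel₀ _ v.2, sub_self])
        rwa [map_sub, map_smul, hB.symm a v.1, LinearMap.mem_ker.1 ha, smul_zero, sub_zero] at h3
  have hq : 1 < Nat.card F := Finite.one_lt_card
  obtain ⟨r, hr⟩ := Nat.exists_eq_add_of_lt hq
  refine Nat.eq_of_mul_eq_mul_right (Nat.sub_pos_of_lt hq) (key.trans ?_)
  rw [mul_one, pow_succ, Nat.mul_sub, mul_one]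

lemma prod_gbinom_succ {Q : ℝ} (c k : ℕ) :
    (∏ i ∈ Finset.Icc 1 k, (Q ^ (c + 1 + i) - 1) / (Q ^ i - 1)) * (Q ^ (c + 1) - 1) =
      (Q ^ (c + 1 + k) - 1) * ∏ i ∈ Finset.Icc 1 k, (Q ^ (c + i) - 1) / (Q ^ i - 1) := by
  induction k with
  | zero => simp
  | succ k ih =>
    rw [Finset.prod_Icc_succ_top (by omega), Finset.prod_Icc_succ_top (by omega), mul_right_comm,
      ih, show c + (k + 1) = c + 1 + k by ring, show c + 1 + (k + 1) = c + 1 + k + 1 by ring]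
    ring

lemma gbinom_succ_mul {Q : ℝ} {n k : ℕ} (h : k ≤ n) :
    gbinom (n + 1) k Q * (Q ^ (n + 1 - k) - 1) = (Q ^ (n + 1) - 1) * gbinom n k Q := by
  obtain ⟨c, rfl⟩ := Nat.exists_eq_add_of_le' h
  rw [gbinom, gbinom, show c + k + 1 - k = c + 1 by omega, show c + k - k = c by omega,
    prod_gbinom_succ, add_right_comm]

lemma gbinom_self {Q : ℝ} (hQ : 1 < Q) (m : ℕ) : gbinom m m Q = 1 := by
  rw [gbinom]
  refine Finset.prod_eq_one fun i hi => ?_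
  rw [Nat.sub_self, zero_add]
  exact div_self (sub_ne_zero.2 (one_lt_pow₀ hQ (by have := (Finset.mem_Icc.1 hi).1; omega)).ne')

lemma natCard_nondegSub [Finite F] (h2 : (2 : F) ≠ 0) (m : ℕ) :
    ∀ {k : ℕ}, k ≤ m → ∀ {V : Type u} [AddCommGroup V] [Module F V] [Finite V]
      {B : LinearMap.BilinForm F V}, IsForm B → Module.finrank F V = 2 * m + 1 →
      (Nat.card (NondegSub B (2 * k)) : ℝ) =
        (Nat.card F : ℝ) ^ (2 * k * (m - k + 1)) * gbinom m k ((Nat.card F : ℝ) ^ 2) := by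
  have hq : (1 : ℝ) < Nat.card F := by exact_mod_cast Finite.one_lt_card (α := F)
  have hq' : (1 : ℝ) < (Nat.card F : ℝ) ^ 2 := one_lt_pow₀ hq two_ne_zero
  have hself (m : ℕ) {V : Type u} [AddCommGroup V] [Module F V] [Finite V]
      {B : LinearMap.BilinForm F V} (hB : IsForm B) (hV : Module.finrank F V = 2 * m + 1) :
      (Nat.card (NondegSub B (2 * m)) : ℝ) =
        (Nat.card F : ℝ) ^ (2 * m * (m - m + 1)) * gbinom m m ((Nat.card F : ℝ) ^ 2) := by
    rw [natCard_nondegSub_hyperplane h2 hB hV, gbinom_self hq', Nat.sub_self, zero_add, mul_one,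
      mul_one, Nat.cast_pow]
  induction m with
  | zero =>
    intro k hk V _ _ _ B hB hV
    obtain rfl := Nat.le_zero.1 hk
    exact hself 0 hB hV
  | succ m ih =>
    intro k hk V _ _ _ B hB hV
    obtain rfl | hlt := eq_or_lt_of_le hk
    · exact hself _ hB hV
    have hkm : k ≤ m := Nat.lt_succ_iff.1 hlt
    have hne : ((Nat.card F : ℝ) ^ 2) ^ (m + 1 - k) - 1 ≠ 0 :=
      sub_ne_zero.2 (one_lt_pow₀ hq' (by omega)).ne'
    obtain ⟨v, hv, hvv⟩ := hB.exists_isotropic h2 (by omega)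
    obtain ⟨w, h⟩ := hB.exists_isHyperbolic h2 hv hvv
    have hW : Module.finrank F (hypPerp B v w) = 2 * m + 1 := by
      have : Module.Finite F V := Module.Finite.of_finite
      have := finrank_hypPerp hB h
      omega
    set N := Nat.card (NondegSub (B.restrict (hypPerp B v w)) (2 * k)) with hNdef
    have hN : (N : ℝ) =
        (Nat.card F : ℝ) ^ (2 * k * (m - k + 1)) * gbinom m k ((Nat.card F : ℝ) ^ 2) :=
      ih hkm (hB.restrict_hypPerp h) hW
    have key := natCard_nondegSub_mul h2 (N := N) hkm hB hV (fun hC hW' => by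
      exact_mod_cast (ih hkm hC hW').trans hN.symm)
    have hone (e : ℕ) : 1 ≤ Nat.card F ^ e := Nat.one_le_pow _ _ Nat.card_pos
    have key' := congrArg (Nat.cast : ℕ → ℝ) key
    rw [Nat.cast_mul, Nat.cast_mul, Nat.cast_mul, Nat.cast_sub (hone _), Nat.cast_sub (hone _),
      Nat.cast_pow, Nat.cast_pow, Nat.cast_pow, Nat.cast_one, hN, pow_mul, pow_mul _ 2 (m + 1)]
      at key'
    refine mul_right_cancel₀ hne (key'.trans ?_)
    rw [mul_assoc _ (gbinom (m + 1) k _), gbinom_succ_mul hkm,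
      show 2 * k * (m + 1 - k + 1) = 2 * k * (m - k + 1) + 2 * k by
        rw [show m + 1 - k + 1 = (m - k + 1) + 1 by omega]; ring, pow_add]
    ring

end Count

section Reflections

variable {F V : Type*} [Field F] [AddCommGroup V] [Module F V]
  {B : LinearMap.BilinForm F V}

lemma isNondegSub_negSub (h2 : (2 : F) ≠ 0) (hB : IsForm B) {g : V ≃ₗ[F] V} (hg : g ∈ orth B)
    (hgg : g * g = 1) : IsNondegSub B (negSub g) :=
  hB.nondeg_of_isCompl (isCompl_fixSub_negSub h2 hgg).symm fun u hu w hw =>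
    (hB.symm _ _).trans (fixSub_negSub_ortho h2 hg w hw u hu)

variable [FiniteDimensional F V]

lemma det_glue {U W : Submodule F V} (h : IsCompl U W) (p : (U ≃ₗ[F] U) × (W ≃ₗ[F] W)) :
    LinearMap.det (glue h p : V →ₗ[F] V) =
      LinearMap.det (p.1 : U →ₗ[F] U) * LinearMap.det (p.2 : W →ₗ[F] W) := by
  rw [← LinearMap.det_prodMap, ← LinearMap.det_conj _ (Submodule.prodEquivOfIsCompl U W h)]
  rfl

/-- The isometry which is `-1` on a nondegenerate subspace and `1` on its complement. -/
def nondegReflection (hB : IsForm B) {A : Submodule F V} (hA : IsNondegSub B A) : V ≃ₗ[F] V :=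
  glue (hB.isCompl hA) (LinearEquiv.neg F, 1)

variable {A : Submodule F V}

lemma nondegReflection_apply (hB : IsForm B) (hA : IsNondegSub B A) (a : A)
    (b : B.orthogonal A) : nondegReflection hB hA (a + b) = -a + b := by
  rw [nondegReflection, glue_apply]
  rfl

lemma nondegReflection_mem_orth (hB : IsForm B) (hA : IsNondegSub B A) :
    nondegReflection hB hA ∈ orth B := by
  have h : ∀ u ∈ A, ∀ w ∈ B.orthogonal A, B u w = 0 := fun u hu w hw => hw u hu
  exact (glue_mem_orth _ h fun u hu w hw => (hB.symm _ _).trans (h u hu w hw)).2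
    ⟨(negOrth (B.restrict A)).2, one_mem _⟩

lemma nondegReflection_mul_self (hB : IsForm B) (hA : IsNondegSub B A) :
    nondegReflection hB hA * nondegReflection hB hA = 1 := by
  rw [nondegReflection, ← map_mul, ← map_one (glue (hB.isCompl hA))]
  congr 1
  refine Prod.ext ?_ (one_mul _)
  ext
  simp

lemma det_nondegReflection (hB : IsForm B) (hA : IsNondegSub B A) :
    LinearMap.det (nondegReflection hB hA : V →ₗ[F] V) = (-1) ^ Module.finrank F A := by
  have h : ((LinearEquiv.neg F : A ≃ₗ[F] A) : A →ₗ[F] A) = (-1 : F) • LinearMap.id := by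
    ext
    simp
  rw [nondegReflection, det_glue, h, LinearMap.det_smul, LinearMap.det_id, mul_one]
  exact (congrArg _ LinearMap.det_id).trans (mul_one _)

lemma negSub_nondegReflection (h2 : (2 : F) ≠ 0) (hB : IsForm B) (hA : IsNondegSub B A) :
    negSub (nondegReflection hB hA) = A := by
  ext x
  obtain ⟨a, b, rfl⟩ := exists_add_of_isCompl (hB.isCompl hA) x
  rw [mem_negSub, nondegReflection_apply, neg_add, add_right_inj, eq_neg_iff_add_eq_zero,
    ← two_smul F, smul_eq_zero, or_iff_right h2, Submodule.coe_eq_zero]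
  constructor
  · rintro rfl
    simp
  · intro h
    have hb : (b : V) ∈ A := (Submodule.add_mem_iff_right A a.2).1 h
    exact Subtype.ext (Submodule.disjoint_def.1 (hB.isCompl hA).disjoint _ hb b.2)

lemma nondegReflection_negSub (h2 : (2 : F) ≠ 0) (hB : IsForm B) {g : V ≃ₗ[F] V}
    (hg : g ∈ orth B) (hgg : g * g = 1) :
    nondegReflection hB (isNondegSub_negSub h2 hB hg hgg) = g := by
  ext x
  obtain ⟨a, b, rfl⟩ := exists_add_of_isCompl (isCompl_fixSub_negSub h2 hgg) x
  have ha : (a : V) ∈ B.orthogonal (negSub g) := fun n hn =>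
    (hB.symm _ _).trans (fixSub_negSub_ortho h2 hg a a.2 n hn)
  rw [map_add g, mem_fixSub.1 a.2, mem_negSub.1 b.2, add_comm]
  exact (nondegReflection_apply hB _ b ⟨a, ha⟩).trans (add_comm _ _)

lemma natCard_involutions [Finite V] (h2 : (2 : F) ≠ 0) (hB : IsForm B) {m : ℕ}
    (hV : Module.finrank F V = 2 * m + 1) :
    Nat.card {g : V ≃ₗ[F] V // g ∈ orth B ∧ LinearMap.det (g : V →ₗ[F] V) = 1 ∧ g * g = 1} =
      ∑ k ∈ Finset.range (m + 1), Nat.card (NondegSub B (2 * k)) := by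
  have hneg : (-1 : F) ≠ 1 := fun h => h2 (by linear_combination -h)
  let Ψ : (Σ k : Fin (m + 1), NondegSub B (2 * k)) →
      {g : V ≃ₗ[F] V // g ∈ orth B ∧ LinearMap.det (g : V →ₗ[F] V) = 1 ∧ g * g = 1} := fun p =>
    ⟨nondegReflection hB p.2.2.1, nondegReflection_mem_orth hB _, by
      rw [det_nondegReflection, p.2.2.2, pow_mul, neg_one_sq, one_pow],
      nondegReflection_mul_self hB _⟩
  have hΨ : Function.Bijective Ψ := by
    constructor
    · rintro ⟨k, A, hA, hk⟩ ⟨k', A', hA', hk'⟩ h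
      have h1 : nondegReflection hB hA = nondegReflection hB hA' := congrArg Subtype.val h
      have hAA : A = A' := by
        rw [← negSub_nondegReflection h2 hB hA, h1, negSub_nondegReflection h2]
      subst hAA
      obtain rfl : k = k' := Fin.ext (by omega)
      rfl
    · rintro ⟨g, hg, hdet, hgg⟩
      have hA := isNondegSub_negSub h2 hB hg hgg
      have hgr := nondegReflection_negSub h2 hB hg hgg
      have hev : Even (Module.finrank F (negSub g)) := by
        by_contra hodd
        rw [← hgr, det_nondegReflection, (Nat.not_even_iff_odd.1 hodd).neg_one_pow] at hdet
        exact hneg hdet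
      obtain ⟨k, hk⟩ := even_iff_exists_two_mul.1 hev
      have hle := Submodule.finrank_le (negSub g)
      exact ⟨⟨⟨k, by omega⟩, negSub g, hA, hk⟩, Subtype.ext hgr⟩
  rw [← Nat.card_eq_of_bijective Ψ hΨ, Nat.card_sigma,
    Fin.sum_univ_eq_sum_range (fun k => Nat.card (NondegSub B (2 * k)))]

end Reflections

section Special

variable {F V : Type*} [Field F] [AddCommGroup V] [Module F V] {B : LinearMap.BilinForm F V}

lemma det_mul_self_of_mem_orth (h2 : (2 : F) ≠ 0) [Finite V] (hB : IsForm B) {g : V ≃ₗ[F] V}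
    (hg : g ∈ orth B) : LinearEquiv.det g * LinearEquiv.det g = 1 := by
  obtain ⟨t, -, -, ht⟩ := exists_involution_conj h2 hB hg
  have := congrArg LinearEquiv.det ht
  rw [map_mul, map_mul, map_inv, map_inv, mul_inv_cancel_comm] at this
  exact eq_inv_iff_mul_eq_one.1 this

/-- Scaling an automorphism by its determinant. -/
def detScale (F V : Type*) [Field F] [AddCommGroup V] [Module F V] :
    (V ≃ₗ[F] V) →* (V ≃ₗ[F] V) where
  toFun g := DistribMulAction.toModuleAut F V (LinearEquiv.det g) * g
  map_one' := by rw [map_one, map_one, mul_one]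
  map_mul' g h := by
    ext v
    simp [Units.smul_def, smul_smul, mul_comm]

lemma detScale_apply (g : V ≃ₗ[F] V) (v : V) :
    detScale F V g v = LinearMap.det (g : V →ₗ[F] V) • g v := by
  rw [← LinearEquiv.coe_det]
  rfl

lemma detScale_mem_orth (h2 : (2 : F) ≠ 0) [Finite V] (hB : IsForm B) {g : V ≃ₗ[F] V}
    (hg : g ∈ orth B) : detScale F V g ∈ orth B := fun x y => by
  have h := congrArg Units.val (det_mul_self_of_mem_orth h2 hB hg)
  rw [Units.val_mul, LinearEquiv.coe_det, Units.val_one] at h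
  rw [detScale_apply, detScale_apply, map_smul, map_smul, LinearMap.smul_apply, smul_smul, h,
    one_smul, hg]

lemma det_detScale (h2 : (2 : F) ≠ 0) [Finite V] (hB : IsForm B) {m : ℕ}
    (hV : Module.finrank F V = 2 * m + 1) {g : V ≃ₗ[F] V} (hg : g ∈ orth B) :
    LinearMap.det (detScale F V g : V →ₗ[F] V) = 1 := by
  have h := congrArg Units.val (det_mul_self_of_mem_orth h2 hB hg)
  rw [Units.val_mul, LinearEquiv.coe_det, Units.val_one] at h
  have : (detScale F V g : V →ₗ[F] V) = LinearMap.det (g : V →ₗ[F] V) • (g : V →ₗ[F] V) :=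
    LinearMap.ext (detScale_apply g)
  rw [this, LinearMap.det_smul, hV, pow_succ, pow_mul, pow_two, h, one_pow, one_mul, h]

lemma detScale_of_det_eq_one {g : V ≃ₗ[F] V} (hg : LinearMap.det (g : V →ₗ[F] V) = 1) :
    detScale F V g = g := by
  ext v
  rw [detScale_apply, hg, one_smul]

variable {n : Type*} [Fintype n] [DecidableEq n]

/-- Invertible matrices as automorphisms of the space of vectors. -/
def glEquiv (F n : Type*) [Field F] [Fintype n] [DecidableEq n] :
    GL n F ≃* ((n → F) ≃ₗ[F] (n → F)) :=
  Matrix.GeneralLinearGroup.toLin.trans (LinearMap.GeneralLinearGroup.generalLinearEquiv F (n → F))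

lemma glEquiv_apply (g : GL n F) (v : n → F) : glEquiv F n g v = (g : Matrix n n F) *ᵥ v := rfl

lemma det_glEquiv (g : GL n F) :
    LinearMap.det (glEquiv F n g : (n → F) →ₗ[F] (n → F)) = (g : Matrix n n F).det := by
  rw [← LinearMap.det_toLin']
  rfl

lemma glEquiv_mem_orth (J : Matrix n n F) (g : GL n F) :
    glEquiv F n g ∈ orth (Matrix.toBilin' J) ↔
      (g : Matrix n n F)ᵀ * J * (g : Matrix n n F) = J := by
  have key (x y : n → F) : Matrix.toBilin' J (glEquiv F n g x) (glEquiv F n g y) =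
      Matrix.toBilin' ((g : Matrix n n F)ᵀ * J * (g : Matrix n n F)) x y := by
    rw [Matrix.toBilin'_apply', Matrix.toBilin'_apply', glEquiv_apply, glEquiv_apply,
      ← Matrix.mulVec_mulVec, ← Matrix.mulVec_mulVec, Matrix.dotProduct_mulVec x,
      Matrix.vecMul_transpose]
  constructor
  · intro h
    refine Matrix.toBilin'.injective (LinearMap.ext₂ fun x y => ?_)
    rw [← key, h x y]
  · intro h x y
    rw [key, h]

lemma isForm_toBilin' {J : Matrix n n F} (hJ : IsUnit J) (hJs : Jᵀ = J) :
    IsForm (Matrix.toBilin' J) := by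
  refine ⟨fun x y => ?_, fun x hx => ?_⟩
  · rw [Matrix.toBilin'_apply', Matrix.toBilin'_apply', Matrix.dotProduct_mulVec,
      dotProduct_comm, ← Matrix.mulVec_transpose, hJs]
  · have h : x ᵥ* J = 0 := dotProduct_eq_zero _ fun y => by
      rw [← Matrix.dotProduct_mulVec, ← Matrix.toBilin'_apply', hx]
    exact Matrix.vecMul_injective_of_isUnit hJ (h.trans (Matrix.zero_vecMul J).symm)

lemma mem_specialFixGroup {J : Matrix n n F} {g : GL n F} : g ∈ specialFixGroup J ↔
    glEquiv F n g ∈ orth (Matrix.toBilin' J) ∧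
      LinearMap.det (glEquiv F n g : (n → F) →ₗ[F] (n → F)) = 1 := by
  rw [glEquiv_mem_orth, det_glEquiv]
  rfl

lemma exists_orth_hom_surjective [Finite F] (h2 : (2 : F) ≠ 0) {m : ℕ}
    (hn : Fintype.card n = 2 * m + 1) {J : Matrix n n F} (hJ : IsForm (Matrix.toBilin' J)) :
    ∃ f : orth (Matrix.toBilin' J) →* specialFixGroup J, Function.Surjective f := by
  have hV : Module.finrank F (n → F) = 2 * m + 1 := by rw [Module.finrank_fintype_fun_eq_card, hn]
  let f₀ : orth (Matrix.toBilin' J) →* GL n F :=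
    ((glEquiv F n).symm.toMonoidHom.comp (detScale F (n → F))).comp (Subgroup.subtype _)
  have hf₀ (g : orth (Matrix.toBilin' J)) : glEquiv F n (f₀ g) = detScale F (n → F) g :=
    (glEquiv F n).apply_symm_apply _
  refine ⟨f₀.codRestrict _ fun g => ?_, ?_⟩
  · rw [mem_specialFixGroup, hf₀]
    exact ⟨detScale_mem_orth h2 hJ g.2, det_detScale h2 hJ hV g.2⟩
  · rintro ⟨g, hg⟩
    obtain ⟨h1, h3⟩ := mem_specialFixGroup.1 hg
    refine ⟨⟨glEquiv F n g, h1⟩, Subtype.ext ((glEquiv F n).injective ?_)⟩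
    exact (hf₀ _).trans (detScale_of_det_eq_one h3)

lemma natCard_involutions_specialFixGroup (J : Matrix n n F) :
    Nat.card {g : specialFixGroup J // g * g = 1} =
      Nat.card {g : (n → F) ≃ₗ[F] (n → F) // g ∈ orth (Matrix.toBilin' J) ∧
        LinearMap.det (g : (n → F) →ₗ[F] (n → F)) = 1 ∧ g * g = 1} := by
  refine Nat.card_eq_of_bijective (fun g => ⟨glEquiv F n g.1.1, (mem_specialFixGroup.1 g.1.2).1,
    (mem_specialFixGroup.1 g.1.2).2, ?_⟩) ⟨fun g h hgh => ?_, ?_⟩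
  · rw [← map_mul, ← Subgroup.coe_mul, g.2, Subgroup.coe_one, map_one]
  · exact Subtype.ext (Subtype.ext ((glEquiv F n).injective (congrArg Subtype.val hgh)))
  · rintro ⟨g, h1, h3, hgg⟩
    obtain ⟨g, rfl⟩ := (glEquiv F n).surjective g
    refine ⟨⟨⟨g, mem_specialFixGroup.2 ⟨h1, h3⟩⟩, Subtype.ext ((glEquiv F n).injective ?_)⟩, rfl⟩
    rw [Subgroup.coe_mul, map_mul, hgg, Subgroup.coe_one, map_one]

end Special

end OrthModel

open OrthModel in
theorem stmt_13 (m : ℕ) (q : ℕ) (hq : ∃ p r : ℕ, p.Prime ∧ Odd p ∧ 0 < r ∧ q = p ^ r)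
    (F : Type) [Field F] [Fintype F] [DecidableEq F] (hF : Fintype.card F = q)
    (J : Matrix (Fin (2 * m + 1)) (Fin (2 * m + 1)) F) (hJunit : IsUnit J) (hJsymm : Jᵀ = J)
    (ι : Type) [Fintype ι] (R : ι → FDRep ℂ ↥(specialFixGroup J))
    (hsimple : ∀ i, Simple (R i))
    (hdistinct : ∀ i j : ι, Nonempty (R i ≅ R j) → i = j)
    (hcomplete : ∀ ρ : FDRep ℂ ↥(specialFixGroup J), Simple ρ → ∃ i, Nonempty (ρ ≅ R i)) :
    ∑ i : ι, (Module.finrank ℂ (R i) : ℝ)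
      = ∑ k ∈ Finset.range (m + 1),
          (q : ℝ) ^ (2 * k * (m - k + 1)) * gbinom m k ((q : ℝ) ^ 2) := by
  have h2 : (2 : F) ≠ 0 := by
    obtain ⟨p, r, -, hp, -, rfl⟩ := hq
    refine Ring.two_ne_zero fun hc => ?_
    have := FiniteField.even_card_of_char_two hc
    rw [hF] at this
    exact (Nat.not_even_iff_odd.2 (hp.pow (n := r))) (Nat.even_iff.2 this)
  have hB := isForm_toBilin' hJunit hJsymm
  have hn : Fintype.card (Fin (2 * m + 1)) = 2 * m + 1 := Fintype.card_fin _
  obtain ⟨f, hf⟩ := exists_orth_hom_surjective h2 hn hB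
  have hreal (g : specialFixGroup J) : ∃ t, t * g * t⁻¹ = g⁻¹ := by
    obtain ⟨g, rfl⟩ := hf g
    obtain ⟨t, ht, -, h⟩ := exists_involution_conj h2 hB g.2
    refine ⟨f ⟨t, ht⟩, ?_⟩
    rw [← map_inv, ← map_inv, ← map_mul, ← map_mul]
    exact congrArg f (Subtype.ext h)
  have hV : Module.finrank F (Fin (2 * m + 1) → F) = 2 * m + 1 := by
    rw [Module.finrank_fintype_fun_eq_card, hn]
  have hFq : Nat.card F = q := Nat.card_eq_fintype_card.trans hF
  have hsum := sum_finrank_eq_card_involutions ((good_orth h2 hB).of_surjective f hf) hreal R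
    hsimple hdistinct hcomplete
  rw [Fintype.card_eq_nat_card] at hsum
  rw [← Nat.cast_sum, hsum, natCard_involutions_specialFixGroup,
    natCard_involutions h2 hB hV, Nat.cast_sum]
  refine Finset.sum_congr rfl fun k hk => ?_
  rw [natCard_nondegSub h2 m (Nat.lt_succ_iff.1 (Finset.mem_range.1 hk)) hB hV, hFq]

end
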